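/- Let G be a finite simple graph on [n] without isolated vertices and I(G) its edge ideal in S = k[x_1,…,x_n]. The following are equivalent: (i) S/I(G)^2 is Buchsbaum; (ii) S/I(G)^2 is 1-Buchsbaum; (iii) G is Cohen-Macaulay and S/I(G)^2 is generalized Cohen-Macaulay; (iv) G is Cohen-Macaulay and, for every vertex i ∈ [n], the graph G_i = G \ ({i} ∪ N(i)) is special Cohen-Macaulay and contains no triangle. -/

import Mathlib

open MvPolynomial CategoryTheory CategoryTheory.Limits

noncomputable section

/-- A simplicial complex on a vertex set `V`: a collection of finite subsets of `V`
closed under taking subsets. -/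
def IsSimplicialComplex {V : Type} (Δ : Set (Finset V)) : Prop :=
  ∀ F ∈ Δ, ∀ G : Finset V, G ⊆ F → G ∈ Δ

/-- The dimension of a simplicial complex: `max {|F| - 1 : F ∈ Δ}`. -/
def complexDim {V : Type} (Δ : Set (Finset V)) : ℤ :=
  sSup ((fun F : Finset V => (F.card : ℤ) - 1) '' Δ)

/-- The star of a face: `st_Δ(F) = {H ∈ Δ : H ∪ F ∈ Δ}`. -/
def complexStar {V : Type} [DecidableEq V] (Δ : Set (Finset V)) (F : Finset V) :
    Set (Finset V) :=
  {H | H ∈ Δ ∧ H ∪ F ∈ Δ}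

/-- The facets (maximal faces) of a simplicial complex. -/
def facets {V : Type} (Δ : Set (Finset V)) : Set (Finset V) :=
  {F | F ∈ Δ ∧ ∀ G ∈ Δ, F ⊆ G → F = G}

/-- The Stanley–Reisner ideal of a simplicial complex `Δ`:
generated by the squarefree monomials `∏_{i ∈ F} x_i` with `F ∉ Δ`. -/
def srIdeal (k : Type) [Field k] {V : Type} (Δ : Set (Finset V)) :
    Ideal (MvPolynomial V k) :=
  Ideal.span {m | ∃ F : Finset V, F ∉ Δ ∧ m = ∏ i ∈ F, X i}

/-- The face prime `P_F = (x_j : j ∉ F)`. -/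
def facePrime (k : Type) [Field k] {V : Type} (F : Finset V) :
    Ideal (MvPolynomial V k) :=
  Ideal.span ((X : V → MvPolynomial V k) '' {j | j ∉ F})

/-- The `m`-th symbolic power of the Stanley–Reisner ideal:
`I_Δ^{(m)} = ⋂_{F facet of Δ} P_F^m`. -/
def symbolicPower (k : Type) [Field k] {V : Type} (Δ : Set (Finset V)) (m : ℕ) :
    Ideal (MvPolynomial V k) :=
  ⨅ F ∈ facets Δ, (facePrime k F) ^ m

/-- The homogeneous maximal ideal `m = (x_1, …, x_n)` of the polynomial ring. -/
def maxIdeal (k : Type) [Field k] (V : Type) : Ideal (MvPolynomial V k) :=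
  Ideal.span (Set.range (X : V → MvPolynomial V k))

/-- The `i`-th local cohomology module `H^i_m(S/I)`. -/
def locCoh (k : Type) [Field k] (V : Type) (I : Ideal (MvPolynomial V k)) (i : ℕ) :
    ModuleCat (MvPolynomial V k) :=
  (localCohomology (maxIdeal k V) i).obj
    (ModuleCat.of (MvPolynomial V k) (MvPolynomial V k ⧸ I))

/-- `S/I` is Cohen–Macaulay: `H^i_m(S/I) = 0` for all `i < dim S/I`. -/
def quotCM (k : Type) [Field k] (V : Type) (I : Ideal (MvPolynomial V k)) : Prop :=
  ∀ i : ℕ, (i : WithBot (WithTop ℕ)) < ringKrullDim (MvPolynomial V k ⧸ I) →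
    Subsingleton (locCoh k V I i)

/-- `S/I` is generalized Cohen–Macaulay: `H^i_m(S/I)` has finite length for all
`i < dim S/I`. -/
def quotGCM (k : Type) [Field k] (V : Type) (I : Ideal (MvPolynomial V k)) : Prop :=
  ∀ i : ℕ, (i : WithBot (WithTop ℕ)) < ringKrullDim (MvPolynomial V k ⧸ I) →
    IsFiniteLength (MvPolynomial V k) (locCoh k V I i)

/-- `S/I` is `r`-Buchsbaum: `m^r · H^i_m(S/I) = 0` for all `i < dim S/I`. -/
def quotKBuchsbaum (k : Type) [Field k] (V : Type) (I : Ideal (MvPolynomial V k))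
    (r : ℕ) : Prop :=
  ∀ i : ℕ, (i : WithBot (WithTop ℕ)) < ringKrullDim (MvPolynomial V k ⧸ I) →
    ∀ x ∈ (maxIdeal k V) ^ r, ∀ y : locCoh k V I i, x • y = 0

/-- The canonical map `Ext^i_S(S/m, S/I) → H^i_m(S/I)`, realized as the colimit
injection at the first power of `m` in the direct system defining local cohomology. -/
def canonicalExtToLocCoh (k : Type) [Field k] (V : Type) (I : Ideal (MvPolynomial V k))
    (i : ℕ) :
    ((localCohomology.diagram (localCohomology.idealPowersDiagram (maxIdeal k V)) i).obj
        (Opposite.op (Opposite.op (1 : ℕ)))).obj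
      (ModuleCat.of (MvPolynomial V k) (MvPolynomial V k ⧸ I)) ⟶ locCoh k V I i :=
  letI := localCohomology.hasColimitDiagram.{0,0}
    (localCohomology.idealPowersDiagram (maxIdeal k V)) i
  (colimit.ι (localCohomology.diagram (localCohomology.idealPowersDiagram (maxIdeal k V)) i)
    (Opposite.op (Opposite.op (1 : ℕ)))).app (ModuleCat.of (MvPolynomial V k) (MvPolynomial V k ⧸ I))

/-- `S/I` is Buchsbaum: the canonical map `Ext^i_S(S/m, S/I) → H^i_m(S/I)` is
surjective for all `i < dim S/I`. -/
def quotBuchsbaum (k : Type) [Field k] (V : Type) (I : Ideal (MvPolynomial V k)) : Prop :=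
  ∀ i : ℕ, (i : WithBot (WithTop ℕ)) < ringKrullDim (MvPolynomial V k ⧸ I) →
    Function.Surjective (canonicalExtToLocCoh k V I i)

/-- A simplicial complex is Cohen–Macaulay if its Stanley–Reisner ring is
Cohen–Macaulay over every field. -/
def complexCM {V : Type} (Δ : Set (Finset V)) : Prop :=
  ∀ (k : Type) [Field k], quotCM k V (srIdeal k Δ)

/-- A simplicial complex is Buchsbaum if its Stanley–Reisner ring is Buchsbaum over
every field. -/
def complexBuchsbaum {V : Type} (Δ : Set (Finset V)) : Prop :=
  ∀ (k : Type) [Field k], quotBuchsbaum k V (srIdeal k Δ)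

/-- The independence complex of a graph: faces are the independent sets. -/
def indepComplex {V : Type} (G : SimpleGraph V) : Set (Finset V) :=
  {F | ∀ i ∈ F, ∀ j ∈ F, ¬ G.Adj i j}

/-- The edge ideal `I(G) = (x_i x_j : ij ∈ E(G))`. -/
def edgeIdeal (k : Type) [Field k] {V : Type} (G : SimpleGraph V) :
    Ideal (MvPolynomial V k) :=
  Ideal.span {m | ∃ i j : V, G.Adj i j ∧ m = X i * X j}

/-- The independence number `α(G)`. -/
def indepNumber {V : Type} (G : SimpleGraph V) : ℕ :=
  sSup {c | ∃ F ∈ indepComplex G, F.card = c}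

/-- A graph is Cohen–Macaulay if its independence complex is. -/
def graphCM {V : Type} (G : SimpleGraph V) : Prop :=
  complexCM (indepComplex G)

/-- The vertex set of the localization `G_{pq} = G \ (N(p) ∪ N(q))` of `G` at an
edge `pq`. -/
def edgeLocSet {V : Type} (G : SimpleGraph V) (p q : V) : Set V :=
  {v | v ∉ G.neighborSet p ∪ G.neighborSet q}

/-- The localization of `G` at an edge `pq`: the induced subgraph on the vertices not
adjacent to `p` or `q` (this removes `p` and `q` as well). -/
def edgeLoc {V : Type} (G : SimpleGraph V) (p q : V) :
    SimpleGraph (edgeLocSet G p q) :=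
  G.induce (edgeLocSet G p q)

/-- `G` is special Cohen–Macaulay: `G` is Cohen–Macaulay and for every edge `pq`,
`G_{pq}` is Cohen–Macaulay with `α(G_{pq}) = α(G) - 1`. -/
def specialCM {V : Type} (G : SimpleGraph V) : Prop :=
  graphCM G ∧ ∀ p q : V, G.Adj p q →
    graphCM (edgeLoc G p q) ∧ indepNumber (edgeLoc G p q) + 1 = indepNumber G

/-- The vertex set of `G_i = G \ ({i} ∪ N(i))`. -/
def vertexLocSet {V : Type} (G : SimpleGraph V) (i : V) : Set V :=
  {v | v ≠ i ∧ v ∉ G.neighborSet i}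

/-- `G_i = G \ ({i} ∪ N(i))`: the induced subgraph obtained by deleting `i` and all
its neighbors. -/
def vertexLoc {V : Type} (G : SimpleGraph V) (i : V) :
    SimpleGraph (vertexLocSet G i) :=
  G.induce (vertexLocSet G i)

/-- A graph is unmixed if all its maximal independent sets have the same cardinality. -/
def graphUnmixed {V : Type} (G : SimpleGraph V) : Prop :=
  ∀ F ∈ facets (indepComplex G), ∀ F' ∈ facets (indepComplex G), F.card = F'.card

/-- `G` has no isolated vertices. -/
def noIsolated {V : Type} (G : SimpleGraph V) : Prop :=
  ∀ v : V, ∃ w : V, G.Adj v w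

end

universe u
namespace ExtClass
variable {R : Type u} [CommRing R] {X X' : ModuleCat.{u} R}

section generic
variable (K : CochainComplex (ModuleCat.{u} R) ℕ) (n : ℕ)

/-- The cycle defined by an element of the kernel of a differential. -/
noncomputable def toCyc : ModuleCat.of R (LinearMap.ker (K.d n (n+1)).hom) ⟶ K.cycles n :=
  K.liftCycles (ModuleCat.ofHom (LinearMap.ker (K.d n (n+1)).hom).subtype) (n+1) (by simp)
    (by ext x; exact x.2)

/-- The class of a cocycle in the homology of a cochain complex of modules. -/
noncomputable def homCls : LinearMap.ker (K.d n (n+1)).hom →ₗ[R] K.homology n :=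
  (toCyc K n ≫ K.homologyπ n).hom

lemma iCycles_injective : Function.Injective (K.iCycles n).hom :=
    (ModuleCat.mono_iff_injective _).1 inferInstance

lemma iCycles_toCyc (x) : (K.iCycles n).hom ((toCyc K n).hom x) = x.1 :=
  LinearMap.congr_fun (congrArg ModuleCat.Hom.hom (K.liftCycles_i
    (ModuleCat.ofHom (LinearMap.ker (K.d n (n+1)).hom).subtype) (n+1) (by simp)
      (by ext x; exact x.2))) x

lemma homCls_apply (x) : homCls K n x = (K.homologyπ n).hom ((toCyc K n).hom x) := rfl

lemma homCls_surjective : Function.Surjective (homCls K n) := by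
  intro y
  have hs : Function.Surjective (K.homologyπ n).hom :=
    (ModuleCat.epi_iff_surjective _).1 inferInstance
  obtain ⟨c, rfl⟩ := hs y
  have hc : (K.d n (n+1)).hom ((K.iCycles n).hom c) = 0 :=
    LinearMap.congr_fun (congrArg ModuleCat.Hom.hom (K.iCycles_d n (n+1))) c
  refine ⟨⟨(K.iCycles n).hom c, hc⟩, ?_⟩
  rw [homCls_apply]
  congr 1
  apply iCycles_injective
  rw [iCycles_toCyc]

lemma homCls_eq_zero_iff (m : ℕ) (hm : (ComplexShape.up ℕ).prev n = m)
    (x : LinearMap.ker (K.d n (n+1)).hom) :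
    homCls K n x = 0 ↔ ∃ y : K.X m, (K.d m n).hom y = x.1 := by
  have hex := ShortComplex.exact_of_g_is_cokernel (ShortComplex.mk (K.toCycles m n) (K.homologyπ n) (by simp))
    (K.homologyIsCokernel m n hm)
  rw [ShortComplex.moduleCat_exact_iff] at hex
  rw [homCls_apply]
  have key : ∀ y, (K.iCycles n).hom ((K.toCycles m n).hom y) = (K.d m n).hom y := fun y =>
    LinearMap.congr_fun (congrArg ModuleCat.Hom.hom (K.toCycles_i m n)) y
  constructor
  · intro h
    obtain ⟨y, hy⟩ := hex _ h
    refine ⟨y, ?_⟩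
    rw [← key, ← iCycles_toCyc]
    exact congrArg _ hy
  · rintro ⟨y, hy⟩
    have : (toCyc K n).hom x = (K.toCycles m n).hom y := by
      apply iCycles_injective
      rw [iCycles_toCyc, key, hy]
    rw [this]
    exact LinearMap.congr_fun (congrArg ModuleCat.Hom.hom (K.toCycles_comp_homologyπ m n)) y

lemma homCls_naturality {K L : CochainComplex (ModuleCat.{u} R) ℕ} (φ : K ⟶ L) (n : ℕ)
    (x : LinearMap.ker (K.d n (n+1)).hom) (y : LinearMap.ker (L.d n (n+1)).hom)
    (h : (φ.f n).hom x.1 = y.1) :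
    (HomologicalComplex.homologyMap φ n).hom (homCls K n x) = homCls L n y := by
  rw [homCls_apply, homCls_apply]
  have h1 := LinearMap.congr_fun (congrArg ModuleCat.Hom.hom (HomologicalComplex.homologyπ_naturality φ n)) ((toCyc K n).hom x)
  refine h1.trans ?_
  change (L.homologyπ n).hom _ = _
  congr 1
  apply iCycles_injective
  have h2 := LinearMap.congr_fun (congrArg ModuleCat.Hom.hom (HomologicalComplex.cyclesMap_i φ n)) ((toCyc K n).hom x)
  refine h2.trans ?_
  rw [iCycles_toCyc, ← h]
  change (φ.f n).hom ((K.iCycles n).hom _) = _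
  rw [iCycles_toCyc]
end generic

variable (P : ProjectiveResolution X) (Q : ProjectiveResolution X')
lemma unop_comm_aux {D : Type*} [Category D] {LX LX' HP HQ : Dᵒᵖ} {KP KQ : D} (e : LX ⟶ LX')
    (p : LX ≅ HP) (q : LX' ≅ HQ) (hm : HP ⟶ HQ) (oP : HP ≅ Opposite.op KP)
    (oQ : HQ ≅ Opposite.op KQ) (HM : KQ ⟶ KP) (h1 : p.inv ≫ e = hm ≫ q.inv)
    (h2 : hm ≫ oQ.hom = oP.hom ≫ HM.op) :
    e.unop ≫ (p.unop.symm ≪≫ oP.unop.symm).hom = (q.unop.symm ≪≫ oQ.unop.symm).hom ≫ HM := by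
  have h3 : oP.inv ≫ p.inv ≫ e = HM.op ≫ oQ.inv ≫ q.inv := by
    rw [h1, Iso.inv_comp_eq, ← Category.assoc, ← Category.assoc, ← h2]
    simp
  have := congrArg Quiver.Hom.unop h3
  simpa using this

lemma isoExt_naturality (Y : ModuleCat.{u} R) (n : ℕ) (g : P.complex ⟶ Q.complex)  (f : X ⟶ X')
  (comm : g.f 0 ≫ Q.π.f 0 = P.π.f 0 ≫ f) :
  ((Ext R (ModuleCat.{u} R) n).map f.op).app Y ≫ (P.isoExt (R := R) n Y).hom =
   (Q.isoExt (R := R) n Y).hom ≫ HomologicalComplex.homologyMap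
    (((HomologicalComplex.unopFunctor _ _).map (((((linearYoneda R _).obj Y).rightOp.mapHomologicalComplex _).map g).op))) n := by
  exact unop_comm_aux _ _ _ _ _ _ _
    (ProjectiveResolution.isoLeftDerivedObj_inv_naturality f P Q g comm
      ((linearYoneda R (ModuleCat.{u} R)).obj Y).rightOp n)
    (HomologicalComplex.homologyOp_hom_naturality (((HomologicalComplex.unopFunctor _ _).map
      (((((linearYoneda R _).obj Y).rightOp.mapHomologicalComplex _).map g).op))) n)

variable {P Q}

lemma inv_comm_aux {D : Type*} [Category D] {A B A' B' : D} {e : A ⟶ B} {p : B ≅ B'} {q : A ≅ A'}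
    {m : A' ⟶ B'} (h : e ≫ p.hom = q.hom ≫ m) : q.inv ≫ e = m ≫ p.inv := by
  rw [Iso.inv_comp_eq, ← Category.assoc, ← h]
  simp

/-- The class in `Ext` of a cocycle on a projective resolution. -/
noncomputable def extCls {Y : ModuleCat.{u} R} {n : ℕ} (φ : P.complex.X n ⟶ Y)
    (h : P.complex.d (n + 1) n ≫ φ = 0) : ((Ext R (ModuleCat.{u} R) n).obj (Opposite.op X)).obj Y :=
  (P.isoExt (R := R) n Y).inv.hom (homCls (P.complex.linearYonedaObj R Y) n ⟨φ, h⟩)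

variable {Y : ModuleCat.{u} R} {n : ℕ}

lemma isoExt_inv_injective : Function.Injective (P.isoExt (R := R) n Y).inv.hom :=
  (ModuleCat.mono_iff_injective _).1 inferInstance

lemma extCls_surjective (P : ProjectiveResolution X)
    (e : ((Ext R (ModuleCat.{u} R) n).obj (Opposite.op X)).obj Y) :
    ∃ (φ : P.complex.X n ⟶ Y) (h : P.complex.d (n + 1) n ≫ φ = 0), extCls φ h = e := by
  have hs : Function.Surjective (P.isoExt (R := R) n Y).inv.hom :=
    (ModuleCat.epi_iff_surjective _).1 inferInstance
  obtain ⟨c, rfl⟩ := hs e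
  obtain ⟨⟨φ, h⟩, rfl⟩ := homCls_surjective _ _ c
  exact ⟨φ, h, rfl⟩

lemma extCls_add {φ ψ : P.complex.X n ⟶ Y} (h : P.complex.d (n + 1) n ≫ φ = 0)
    (h' : P.complex.d (n + 1) n ≫ ψ = 0) (h'' : P.complex.d (n + 1) n ≫ (φ + ψ) = 0) :
    extCls (φ + ψ) h'' = extCls φ h + extCls ψ h' := by
  rw [extCls, extCls, extCls, ← map_add, ← map_add]
  rfl

lemma extCls_smul (r : R) {φ : P.complex.X n ⟶ Y} (h : P.complex.d (n + 1) n ≫ φ = 0)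
    (h'' : P.complex.d (n + 1) n ≫ (r • φ) = 0) :
    extCls (r • φ) h'' = r • extCls φ h := by
  rw [extCls, extCls, ← map_smul, ← map_smul]
  rfl

lemma extCls_eq_zero_iff (m : ℕ) (hm : (ComplexShape.up ℕ).prev n = m)
    {φ : P.complex.X n ⟶ Y} (h : P.complex.d (n + 1) n ≫ φ = 0) :
    extCls φ h = 0 ↔ ∃ ψ : P.complex.X m ⟶ Y, P.complex.d n m ≫ ψ = φ := by
  rw [extCls, map_eq_zero_iff _ isoExt_inv_injective]
  exact homCls_eq_zero_iff _ _ m hm _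

lemma extCls_naturality (g : P.complex ⟶ Q.complex) (f : X ⟶ X')
    (comm : g.f 0 ≫ Q.π.f 0 = P.π.f 0 ≫ f) {φ : Q.complex.X n ⟶ Y}
    (h : Q.complex.d (n + 1) n ≫ φ = 0) (h' : P.complex.d (n + 1) n ≫ g.f n ≫ φ = 0) :
    (((Ext R (ModuleCat.{u} R) n).map f.op).app Y).hom (extCls φ h) = extCls (g.f n ≫ φ) h' := by
  have h1 := isoExt_naturality P Q Y n g f comm
  have h2 := LinearMap.congr_fun (congrArg ModuleCat.Hom.hom (inv_comm_aux h1))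
    (homCls (Q.complex.linearYonedaObj R Y) n ⟨φ, h⟩)
  refine h2.trans ?_
  refine congrArg (P.isoExt (R := R) n Y).inv.hom ?_
  exact homCls_naturality _ n _ _ rfl

end ExtClass

namespace ExtClass
variable {R : Type u} [CommRing R]

/-- A projective resolution of modules from elementwise exactness. -/
noncomputable def resolutionOfExact {X : ModuleCat.{u} R} (K : ChainComplex (ModuleCat.{u} R) ℕ)
    (hproj : ∀ n, Projective (K.X n)) (p : K.X 0 ⟶ X)
    (hp : Function.Surjective p.hom) (hz : K.d 1 0 ≫ p = 0)
    (h0 : ∀ x, p.hom x = 0 → ∃ y, (K.d 1 0).hom y = x)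
    (hs : ∀ n x, (K.d (n + 1) n).hom x = 0 → ∃ y, (K.d (n + 2) (n + 1)).hom y = x) :
    ProjectiveResolution X where
  complex := K
  projective := hproj
  π := (ChainComplex.toSingle₀Equiv _ _).symm ⟨p, hz⟩
  quasiIso := ⟨fun n => by
    cases n
    · rw [ChainComplex.quasiIsoAt₀_iff, ShortComplex.quasiIso_iff_of_zeros']
      · have hf : ((ChainComplex.toSingle₀Equiv K X).symm ⟨p, hz⟩).f 0 = p :=
          ChainComplex.toSingle₀Equiv_symm_apply_f_zero p hz
        constructor
        · refine (ShortComplex.moduleCat_exact_iff _).2 fun x hx => h0 x ?_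
          exact (LinearMap.congr_fun (congrArg ModuleCat.Hom.hom hf.symm) x).trans hx
        · refine (ModuleCat.epi_iff_surjective _).2 fun x => ?_
          obtain ⟨y, hy⟩ := hp x
          exact ⟨y, (LinearMap.congr_fun (congrArg ModuleCat.Hom.hom hf) y).trans hy⟩
      · exact K.shape 0 0 (by simp)
      all_goals rfl
    · rename_i n
      rw [quasiIsoAt_iff_exactAt']
      · rw [HomologicalComplex.exactAt_iff' _ (n + 1 + 1) (n + 1) n (by simp) (by simp),
          ShortComplex.moduleCat_exact_iff]
        exact hs n
      · apply ChainComplex.exactAt_succ_single_obj⟩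

lemma resolutionOfExact_π {X : ModuleCat.{u} R} (K : ChainComplex (ModuleCat.{u} R) ℕ)
    (hproj : ∀ n, Projective (K.X n)) (p : K.X 0 ⟶ X)
    (hp : Function.Surjective p.hom) (hz : K.d 1 0 ≫ p = 0)
    (h0 : ∀ x, p.hom x = 0 → ∃ y, (K.d 1 0).hom y = x)
    (hs : ∀ n x, (K.d (n + 1) n).hom x = 0 → ∃ y, (K.d (n + 2) (n + 1)).hom y = x) :
    (resolutionOfExact K hproj p hp hz h0 hs).π.f 0 = p :=
  ChainComplex.toSingle₀Equiv_symm_apply_f_zero p hz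

end ExtClass

namespace Koszul
variable {V : Type} [LinearOrder V]

/-- The Koszul sign of `j` in `F`. -/
def sg (F : Finset V) (j : V) : ℤ := (-1) ^ (F.filter (· < j)).card

lemma sg_mul_self (F : Finset V) (j : V) : sg F j * sg F j = 1 := by
  rw [sg, ← pow_add, ← two_mul, pow_mul]; simp

lemma sg_erase_of_lt {F : Finset V} {i j : V} (h : i < j) : sg (F.erase j) i = sg F i := by
  unfold sg
  congr 2
  ext x
  simp only [Finset.mem_filter, Finset.mem_erase]
  constructor
  · tauto
  · rintro ⟨h1, h2⟩; exact ⟨⟨(h2.trans h).ne, h1⟩, h2⟩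

lemma sg_erase_of_gt {F : Finset V} {i j : V} (hi : i ∈ F) (h : i < j) :
    sg (F.erase i) j = - sg F j := by
  unfold sg
  have : F.filter (· < j) = insert i ((F.erase i).filter (· < j)) := by
    ext x
    simp only [Finset.mem_filter, Finset.mem_erase, Finset.mem_insert]
    constructor
    · intro hx; by_cases hxi : x = i <;> tauto
    · rintro (rfl | hx) <;> tauto
  rw [this, Finset.card_insert_of_notMem (by simp), pow_succ]
  ring

lemma sg_mul_sg {F : Finset V} {i j : V} (hi : i ∈ F) (hj : j ∈ F) (h : i ≠ j) :
    sg F i * sg (F.erase i) j = - (sg F j * sg (F.erase j) i) := by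
  rcases lt_or_gt_of_ne h with h | h
  · rw [sg_erase_of_lt h, sg_erase_of_gt hi h]; ring
  · rw [sg_erase_of_lt h, sg_erase_of_gt hj h]; ring

variable {R : Type} [CommRing R] {M : Type} [AddCommGroup M] [Module R M]

/-- The Koszul coboundary on cochains. -/
def cobd (y : V → R) (c : Finset V → M) (F : Finset V) : M :=
  ∑ j ∈ F, sg F j • y j • c (F.erase j)

lemma cobd_cobd (y : V → R) (c : Finset V → M) : cobd y (cobd y c) = 0 := by
  funext F
  simp only [cobd, Finset.smul_sum, Pi.zero_apply]
  rw [Finset.sum_sigma']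
  refine Finset.sum_involution (fun x _ => ⟨x.2, x.1⟩) ?_ ?_ ?_ ?_
  · rintro ⟨i, j⟩ h
    simp only [Finset.mem_sigma, Finset.mem_erase] at h
    dsimp only
    obtain ⟨hi, hji, hj⟩ := h
    rw [Finset.erase_right_comm (a := j)]
    have := sg_mul_sg hi hj hji.symm
    have e1 : sg F i • y i • sg (F.erase i) j • y j • c ((F.erase i).erase j)
      = (sg F i * sg (F.erase i) j) • (y i * y j) • c ((F.erase i).erase j) := by module
    rw [e1, this]
    module
  · rintro ⟨i, j⟩ h _ heq
    simp only [Finset.mem_sigma, Finset.mem_erase] at h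
    simp only [Sigma.mk.injEq] at heq
    exact h.2.1 heq.1
  · rintro ⟨i, j⟩ h
    simp only [Finset.mem_sigma, Finset.mem_erase] at h ⊢
    exact ⟨h.2.2, Ne.symm h.2.1, h.1⟩
  · intros; rfl

/-- The Koszul differential. -/
noncomputable def bd (y : V → R) : (Finset V →₀ R) →ₗ[R] (Finset V →₀ R) :=
  Finsupp.linearCombination R (cobd y (fun F => Finsupp.single F 1))

lemma linearCombination_comp_bd (y : V → R) (c : Finset V → M) :
    Finsupp.linearCombination R c ∘ₗ bd y = Finsupp.linearCombination R (cobd y c) := by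
  refine Finsupp.lhom_ext' fun F => LinearMap.ext_ring ?_
  simp only [bd, LinearMap.comp_apply, Finsupp.lsingle_apply, Finsupp.linearCombination_single,
    one_smul, cobd, map_sum, map_zsmul, map_smul]

lemma bd_bd (y : V → R) : bd y ∘ₗ bd y = 0 := by
  conv_lhs => lhs; rw [bd]
  rw [linearCombination_comp_bd, cobd_cobd]
  refine Finsupp.lhom_ext' fun F => LinearMap.ext_ring ?_
  simp

/-- The Koszul module in degree `p`. -/
abbrev kosMod (V : Type) (R : Type) [CommRing R] (p : ℕ) : Submodule R (Finset V →₀ R) :=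
  Finsupp.supported R R {F : Finset V | F.card = p}

omit [LinearOrder V] in
lemma single_mem_kosMod {p : ℕ} {F : Finset V} (h : F.card = p) (r : R) :
    Finsupp.single F r ∈ kosMod V R p := Finsupp.single_mem_supported R r h

omit [LinearOrder V] in
lemma map_kosMod_le {p : ℕ} {N : Type} [AddCommGroup N] [Module R N] (f : (Finset V →₀ R) →ₗ[R] N) (q : Submodule R N)
    (h : ∀ F : Finset V, F.card = p → f (Finsupp.single F 1) ∈ q) :
    ∀ x ∈ kosMod V R p, f x ∈ q := by
  intro x hx
  rw [kosMod, Finsupp.supported_eq_span_single] at hx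
  induction hx using Submodule.span_induction with
  | mem x h' => obtain ⟨F, hF, rfl⟩ := h'; exact h F hF
  | zero => simp
  | add x y _ _ hx hy => rw [map_add]; exact add_mem hx hy
  | smul a x _ hx => rw [map_smul]; exact q.smul_mem _ hx

lemma bd_mem (y : V → R) (p : ℕ) : ∀ x ∈ kosMod V R (p + 1), bd y x ∈ kosMod V R p := by
  refine map_kosMod_le _ _ fun F hF => ?_
  simp only [bd, Finsupp.linearCombination_single, one_smul, cobd]
  refine sum_mem fun j hj => zsmul_mem (Submodule.smul_mem _ _ (single_mem_kosMod ?_ _)) _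
  rw [Finset.card_erase_of_mem hj, hF]; rfl

instance kosMod_projective (p : ℕ) : Module.Projective R (kosMod V R p) :=
  Module.Projective.of_equiv (Finsupp.supportedEquivFinsupp {F : Finset V | F.card = p}).symm

/-- The Koszul complex. -/
noncomputable def kos (y : V → R) : ChainComplex (ModuleCat R) ℕ :=
  ChainComplex.of (fun p => ModuleCat.of R (kosMod V R p))
    (fun p => ModuleCat.ofHom ((bd y).restrict (bd_mem y p)))
    (fun p => by
      ext x
      exact DFunLike.congr_fun (LinearMap.congr_fun (bd_bd y) x.1) _)

lemma kos_d (y : V → R) (p : ℕ) :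
    (kos y).d (p + 1) p = ModuleCat.ofHom ((bd y).restrict (bd_mem y p)) :=
  ChainComplex.of_d (fun p => ModuleCat.of R (kosMod V R p))
    (fun p => ModuleCat.ofHom ((bd y).restrict (bd_mem y p))) p

omit [LinearOrder V] in
lemma linearCombination_apply_kosMod {p : ℕ} {N : Type} [AddCommGroup N] [Module R N]
    (f g : (Finset V →₀ R) →ₗ[R] N) (h : ∀ F : Finset V, F.card = p → f (Finsupp.single F 1) = g (Finsupp.single F 1))
    (x) (hx : x ∈ kosMod V R p) : f x = g x := by
  have := map_kosMod_le (p := p) (f - g) ⊥ (fun F hF => by simp [h F hF]) x hx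
  simpa [sub_eq_zero] using this

end Koszul

namespace Koszul
variable {V : Type} [LinearOrder V] [Fintype V] {k : Type} [Field k]

/-- The weights `x_j ^ t`. -/
noncomputable def wt (k : Type) [Field k] (V : Type) (t : ℕ) (j : V) : MvPolynomial V k := X j ^ t

omit [Fintype V] in
lemma bd_single (t : ℕ) (F : Finset V) (b : V →₀ ℕ) :
    bd (wt k V t) (Finsupp.single F (monomial b 1)) =
      ∑ j ∈ F, sg F j • Finsupp.single (F.erase j) (monomial (b + Finsupp.single j t) (1 : k)) := by
  simp only [bd, Finsupp.linearCombination_single, cobd, Finset.smul_sum]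
  refine Finset.sum_congr rfl fun j _ => ?_
  rw [smul_comm, ← mul_smul, wt, X_pow_eq_monomial, monomial_mul, Finsupp.smul_single]
  simp

/-- The active indices of a multigraded piece. -/
def act (t : ℕ) (F : Finset V) (b : V →₀ ℕ) : Finset V := Finset.univ.filter (fun j => j ∈ F ∨ t ≤ b j)

/-- The contraction on basis elements. -/
noncomputable def con₀ (k : Type) [Field k] (t : ℕ) (F : Finset V) (b : V →₀ ℕ) : Finset V →₀ MvPolynomial V k :=
  if h : (act t F b).Nonempty then
    if (act t F b).min' h ∈ F then 0 else
      Finsupp.single (insert ((act t F b).min' h) F)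
        (monomial (b - Finsupp.single ((act t F b).min' h) t) 1)
  else 0

lemma con₀_eq_zero {t : ℕ} {F : Finset V} {b : V →₀ ℕ} {m : V} (hm : m ∈ act t F b)
    (hmin : ∀ j ∈ act t F b, m ≤ j) (hF : m ∈ F) : con₀ k t F b = 0 := by
  have hne : (act t F b).Nonempty := ⟨m, hm⟩
  have : (act t F b).min' hne = m :=
    le_antisymm (Finset.min'_le _ _ hm) (hmin _ (Finset.min'_mem _ _))
  rw [con₀, dif_pos hne, this, if_pos hF]

lemma con₀_eq_single {t : ℕ} {F : Finset V} {b : V →₀ ℕ} {m : V} (hm : m ∈ act t F b)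
    (hmin : ∀ j ∈ act t F b, m ≤ j) (hF : m ∉ F) : con₀ k t F b =
      Finsupp.single (insert m F) (monomial (b - Finsupp.single m t) 1) := by
  have hne : (act t F b).Nonempty := ⟨m, hm⟩
  have : (act t F b).min' hne = m :=
    le_antisymm (Finset.min'_le _ _ hm) (hmin _ (Finset.min'_mem _ _))
  rw [con₀, dif_pos hne, this, if_neg hF]

/-- The contracting homotopy. -/
noncomputable def con (k : Type) [Field k] (V : Type) [LinearOrder V] [Fintype V] (t : ℕ) :
    (Finset V →₀ MvPolynomial V k) →ₗ[k] (Finset V →₀ MvPolynomial V k) :=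
  Finsupp.lsum k (fun F => (basisMonomials V k).constr k (con₀ k t F))

lemma con_single (t : ℕ) (F : Finset V) (b : V →₀ ℕ) :
    con k V t (Finsupp.single F (monomial b 1)) = con₀ k t F b := by
  rw [con, Finsupp.lsum_single]
  have := (basisMonomials V k).constr_basis k (con₀ k t F) b
  rwa [coe_basisMonomials] at this

lemma act_erase {t : ℕ} {F : Finset V} {b : V →₀ ℕ} {j : V} (hj : j ∈ F) :
    act t (F.erase j) (b + Finsupp.single j t) = act t F b := by
  ext i
  simp only [act, Finset.mem_filter, Finset.mem_univ, true_and, Finset.mem_erase,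
    Finsupp.add_apply, Finsupp.single_apply]
  by_cases h : j = i
  · subst h; simp [hj]
  · simp [h, Ne.symm h]

lemma homotopy_single (t : ℕ) (F : Finset V) (b : V →₀ ℕ) (hne : (act t F b).Nonempty) :
    bd (wt k V t) (con₀ k t F b) + con k V t (bd (wt k V t) (Finsupp.single F (monomial b 1))) =
      Finsupp.single F (monomial b 1) := by
  set m := (act t F b).min' hne with hmdef
  have hm : m ∈ act t F b := Finset.min'_mem _ _
  have hmin : ∀ j ∈ act t F b, m ≤ j := fun j hj => Finset.min'_le _ _ hj
  have hFa : ∀ j ∈ F, j ∈ act t F b := fun j hj => by simp [act, hj]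
  rw [bd_single]
  simp only [map_sum, map_zsmul, con_single]
  by_cases hF : m ∈ F
  · rw [con₀_eq_zero hm hmin hF, map_zero, zero_add, Finset.sum_eq_single m]
    · rw [con₀_eq_single (m := m) (by rwa [act_erase hF]) (by rwa [act_erase hF]) (by simp)]
      have : sg F m = 1 := by
        rw [sg, Finset.filter_eq_empty_iff.2 (fun {x} hx => not_lt.2 (hmin x (hFa x hx)))]; simp
      rw [this, Finset.insert_erase hF]; simp
    · intro j hj hjm
      rw [con₀_eq_zero (m := m) (by rwa [act_erase hj]) (by rwa [act_erase hj]) (by simp [hF, hjm.symm])]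
      simp
    · intro h; exact absurd hF h
  · have hbt : t ≤ b m := by
      have := hm; simp only [act, Finset.mem_filter, Finset.mem_univ, true_and] at this; tauto
    have hsub : b - Finsupp.single m t + Finsupp.single m t = b := by
      ext i; simp only [Finsupp.add_apply, Finsupp.tsub_apply, Finsupp.single_apply]; split_ifs with h <;> [subst h; skip] <;> omega
    rw [con₀_eq_single hm hmin hF, bd_single, Finset.sum_insert hF, Finset.erase_insert hF, hsub]
    have : sg (insert m F) m = 1 := by
      rw [sg, Finset.filter_eq_empty_iff.2 (fun {x} hx => ?_)]; · simp
      rcases Finset.mem_insert.1 hx with rfl | hx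
      · exact lt_irrefl _
      · exact not_lt.2 (hmin x (hFa x hx))
    rw [this, one_smul, add_assoc, ← Finset.sum_add_distrib]
    rw [Finset.sum_eq_zero, add_zero]
    intro j hj
    have hmj : m < j := lt_of_le_of_ne (hmin j (hFa j hj)) (fun h => hF (h ▸ hj))
    rw [con₀_eq_single (m := m) (by rwa [act_erase hj]) (by rwa [act_erase hj]) (by simp [hF])]
    have h1 : sg (insert m F) j = - sg F j := by
      have := sg_erase_of_gt (Finset.mem_insert_self m F) hmj
      rw [Finset.erase_insert hF] at this
      rw [this, neg_neg]
    have h2 : (insert m F).erase j = insert m (F.erase j) := Finset.erase_insert_of_ne hmj.ne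
    have h3 : b + Finsupp.single j t - Finsupp.single m t = b - Finsupp.single m t + Finsupp.single j t := by
      ext i; simp only [Finsupp.add_apply, Finsupp.tsub_apply, Finsupp.single_apply]
      by_cases h : m = i
      · subst h; rw [if_neg hmj.ne', if_pos rfl]; omega
      · rw [if_neg h]; omega
    rw [h1, h2, h3, neg_smul, neg_add_cancel]

lemma homotopy (t : ℕ) (x : Finset V →₀ MvPolynomial V k) (hx : x ∅ = 0) :
    bd (wt k V t) (con k V t x) + con k V t (bd (wt k V t) x) = x := by
  let T : (Finset V →₀ MvPolynomial V k) →ₗ[k] (Finset V →₀ MvPolynomial V k) :=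
    (bd (wt k V t)).restrictScalars k ∘ₗ con k V t + con k V t ∘ₗ (bd (wt k V t)).restrictScalars k - LinearMap.id
  have hT : ∀ F : Finset V, F.Nonempty → T ∘ₗ Finsupp.lsingle F = 0 := by
    intro F hF
    refine (basisMonomials V k).ext fun b => ?_
    rw [coe_basisMonomials]
    simp only [T, LinearMap.comp_apply, Finsupp.lsingle_apply, LinearMap.sub_apply, LinearMap.add_apply,
      LinearMap.restrictScalars_apply, LinearMap.id_apply, LinearMap.zero_apply, con_single]
    rw [homotopy_single, sub_self]
    obtain ⟨j, hj⟩ := hF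
    exact ⟨j, by simp [act, hj]⟩
  have : T x = 0 := by
    rw [← Finsupp.sum_single x, Finsupp.sum, map_sum]
    refine Finset.sum_eq_zero fun F hF => ?_
    refine LinearMap.congr_fun (hT F ?_) (x F)
    rw [Finset.nonempty_iff_ne_empty]
    rintro rfl
    exact (Finsupp.mem_support_iff.1 hF) hx
  exact sub_eq_zero.1 this

lemma con_mem (t p : ℕ) (x) (hx : x ∈ kosMod V (MvPolynomial V k) p) :
    con k V t x ∈ kosMod V (MvPolynomial V k) (p + 1) := by
  rw [← Finsupp.sum_single x, Finsupp.sum, map_sum]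
  refine sum_mem fun F hF => ?_
  have hFp : F.card = p := hx hF
  generalize x F = f
  induction f using MvPolynomial.induction_on' with
  | monomial b r =>
    have : Finsupp.single F (monomial b r) = r • Finsupp.single F (monomial b (1:k)) := by
      rw [Finsupp.smul_single, smul_monomial]; simp
    rw [this, map_smul, con_single]
    refine Submodule.smul_of_tower_mem _ _ ?_
    unfold con₀
    split_ifs with h h'
    · exact zero_mem _
    · exact single_mem_kosMod (by rw [Finset.card_insert_of_notMem h', hFp]) _
    · exact zero_mem _
  | add p q hp hq => rw [Finsupp.single_add, map_add]; exact add_mem hp hq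

end Koszul

namespace Koszul
variable {V : Type} [LinearOrder V] {R : Type} [CommRing R]

section maps
variable {M : Type} [AddCommGroup M] [Module R M]

/-- The map on the Koszul module in degree `p` given by a cochain. -/
noncomputable def mor (y : V → R) (p : ℕ) (c : Finset V → M) : (kos y).X p ⟶ ModuleCat.of R M :=
  ModuleCat.ofHom (Finsupp.linearCombination R c ∘ₗ (kosMod V R p).subtype)

lemma mor_congr (y : V → R) (p : ℕ) {c c' : Finset V → M} (h : ∀ F, F.card = p → c F = c' F) :
    mor y p c = mor y p c' := by
  refine ModuleCat.hom_ext (LinearMap.ext fun x => ?_)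
  exact linearCombination_apply_kosMod (Finsupp.linearCombination R c) (Finsupp.linearCombination R c')
    (fun F hF => by simp [h F hF]) x.1 x.2

lemma mor_eq_iff (y : V → R) (p : ℕ) {c c' : Finset V → M} :
    mor y p c = mor y p c' ↔ ∀ F, F.card = p → c F = c' F := by
  refine ⟨fun h F hF => ?_, mor_congr y p⟩
  have : Finsupp.linearCombination R c (Finsupp.single F 1) =
      Finsupp.linearCombination R c' (Finsupp.single F 1) :=
    LinearMap.congr_fun (congrArg ModuleCat.Hom.hom h) ⟨_, single_mem_kosMod hF 1⟩
  simpa using this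

lemma exists_mor (y : V → R) (p : ℕ) (φ : (kos y).X p ⟶ ModuleCat.of R M) :
    ∃ c, mor y p c = φ := by
  let φ' : kosMod V R p →ₗ[R] M := φ.hom
  let c : Finset V → M := fun F => if h : F.card = p then φ' ⟨_, single_mem_kosMod h 1⟩ else 0
  refine ⟨c, ModuleCat.hom_ext ?_⟩
  have key : ∀ x (hmem : x ∈ kosMod V R p), Finsupp.linearCombination R c x = φ' ⟨x, hmem⟩ := by
    intro x hmem
    have hx' := hmem
    rw [kosMod, Finsupp.supported_eq_span_single] at hx'
    induction hx' using Submodule.span_induction with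
    | mem x h' =>
      obtain ⟨F, hF, rfl⟩ := h'
      have hF' : F.card = p := hF
      simp [c, hF']
    | zero => rw [map_zero]; exact (map_zero φ').symm
    | add x y h1 h2 ih1 ih2 =>
      have h1' : x ∈ kosMod V R p := by rw [kosMod, Finsupp.supported_eq_span_single]; exact h1
      have h2' : y ∈ kosMod V R p := by rw [kosMod, Finsupp.supported_eq_span_single]; exact h2
      rw [map_add, ih1 h1', ih2 h2', ← map_add]; rfl
    | smul a x h1 ih =>
      have h1' : x ∈ kosMod V R p := by rw [kosMod, Finsupp.supported_eq_span_single]; exact h1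
      rw [map_smul, ih h1', ← map_smul]; rfl
  exact LinearMap.ext fun x => key x.1 x.2

lemma d_comp_mor (y : V → R) (p : ℕ) (c : Finset V → M) :
    (kos y).d (p + 1) p ≫ mor y p c = mor y (p + 1) (cobd y c) := by
  rw [kos_d]
  refine ModuleCat.hom_ext (LinearMap.ext fun x => ?_)
  exact LinearMap.congr_fun (linearCombination_comp_bd y c) x.1

lemma mor_add (y : V → R) (p : ℕ) (c c' : Finset V → M) :
    mor y p (c + c') = mor y p c + mor y p c' := by
  refine ModuleCat.hom_ext (LinearMap.ext fun x => ?_)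
  change Finsupp.linearCombination R (c + c') x.1 = Finsupp.linearCombination R c x.1 + Finsupp.linearCombination R c' x.1
  simp [Finsupp.linearCombination_apply, Finsupp.sum_add]

lemma mor_smul (y : V → R) (p : ℕ) (r : R) (c : Finset V → M) :
    mor y p (r • c) = r • mor y p c := by
  refine ModuleCat.hom_ext (LinearMap.ext fun x => ?_)
  change Finsupp.linearCombination R (r • c) x.1 = r • Finsupp.linearCombination R c x.1
  simp only [Finsupp.linearCombination_apply, Finsupp.sum, Finset.smul_sum, Pi.smul_apply]
  exact Finset.sum_congr rfl fun _ _ => smul_comm ..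

/-- The total transition map. -/
noncomputable def trTot (z : V → R) : (Finset V →₀ R) →ₗ[R] (Finset V →₀ R) :=
  Finsupp.linearCombination R (fun F => Finsupp.single F (∏ j ∈ F, z j))

omit [LinearOrder V] in
lemma trTot_mem (z : V → R) (p : ℕ) : ∀ x ∈ kosMod V R p, trTot z x ∈ kosMod V R p :=
  map_kosMod_le _ _ fun F hF => by
    simp only [trTot, Finsupp.linearCombination_single, one_smul]; exact single_mem_kosMod hF _

lemma trTot_bd (y z : V → R) : trTot z ∘ₗ bd (y * z) = bd y ∘ₗ trTot z := by
  refine Finsupp.lhom_ext' fun F => LinearMap.ext_ring ?_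
  simp only [trTot, bd, LinearMap.comp_apply, Finsupp.lsingle_apply, Finsupp.linearCombination_single,
    one_smul, cobd, map_sum, map_zsmul, map_smul, Finset.smul_sum]
  refine Finset.sum_congr rfl fun j hj => ?_
  rw [smul_comm (∏ j ∈ F, z j)]
  congr 1
  rw [Finsupp.smul_single, ← mul_smul, Finsupp.smul_single, ← Finset.mul_prod_erase F z hj]
  simp only [Pi.mul_apply, smul_eq_mul]
  congr 1; ring

/-- The transition map between Koszul complexes. -/
noncomputable def tr (y z : V → R) : kos (y * z) ⟶ kos y :=
  ChainComplex.ofHom (fun p => ModuleCat.ofHom ((trTot z).restrict (trTot_mem z p)))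
    (fun p => by
      rw [kos_d, kos_d]
      refine ModuleCat.hom_ext (LinearMap.ext fun x => Subtype.ext ?_)
      exact (LinearMap.congr_fun (trTot_bd y z) x.1).symm)

lemma tr_f_mor (y z : V → R) (p : ℕ) (c : Finset V → M) :
    (tr y z).f p ≫ mor y p c = mor (y * z) p (fun F => (∏ j ∈ F, z j) • c F) := by
  refine ModuleCat.hom_ext (LinearMap.ext fun x => ?_)
  have h : (tr y z).f p = ModuleCat.ofHom ((trTot z).restrict (trTot_mem z p)) := rfl
  rw [h]
  refine linearCombination_apply_kosMod (Finsupp.linearCombination R c ∘ₗ trTot z)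
    (Finsupp.linearCombination R (fun F => (∏ j ∈ F, z j) • c F)) (fun F hF => ?_) x.1 x.2
  simp [trTot]
end maps

section res
variable [Fintype V] (k : Type) [Field k] (V)

/-- The ideal generated by the `t`-th powers of the variables. -/
noncomputable def qI (t : ℕ) : Ideal (MvPolynomial V k) := Ideal.span (Set.range (wt k V t))

/-- The augmentation of the Koszul complex. -/
noncomputable def aug (t : ℕ) : (kos (wt k V t)).X 0 ⟶ ModuleCat.of (MvPolynomial V k) (MvPolynomial V k ⧸ qI V k t) :=
  ModuleCat.ofHom ((qI V k t).mkQ ∘ₗ Finsupp.lapply ∅ ∘ₗ (kosMod V (MvPolynomial V k) 0).subtype)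

omit [Fintype V] in
lemma eq_single_of_mem_kosMod_zero {x : Finset V →₀ R} (hx : x ∈ kosMod V R 0) :
    x = Finsupp.single ∅ (x ∅) := by
  ext F
  by_cases h : F = ∅
  · subst h; simp
  · rw [Finsupp.single_eq_of_ne h]
    by_contra h'
    exact h (Finset.card_eq_zero.1 (hx (Finsupp.mem_support_iff.2 h')))

/-- The Koszul resolution. -/
noncomputable def kosRes (t : ℕ) :
    ProjectiveResolution (ModuleCat.of (MvPolynomial V k) (MvPolynomial V k ⧸ qI V k t)) :=
  ExtClass.resolutionOfExact (kos (wt k V t))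
    (fun p => (IsProjective.iff_projective (kosMod V (MvPolynomial V k) p)).1 inferInstance) (aug V k t)
    (by
      intro x
      obtain ⟨s, rfl⟩ := Submodule.mkQ_surjective _ x
      refine ⟨⟨Finsupp.single ∅ s, single_mem_kosMod rfl s⟩, ?_⟩
      change (qI V k t).mkQ (Finsupp.single ∅ s ∅) = _
      simp)
    (by
      rw [kos_d]
      refine ModuleCat.hom_ext (LinearMap.ext fun x => ?_)
      refine linearCombination_apply_kosMod ((qI V k t).mkQ ∘ₗ Finsupp.lapply ∅ ∘ₗ bd (wt k V t)) 0 (fun F hF => ?_) x.1 x.2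
      obtain ⟨j, rfl⟩ := Finset.card_eq_one.1 hF
      simp only [bd, LinearMap.comp_apply, Finsupp.linearCombination_single, cobd, Finset.sum_singleton,
        one_smul, Finset.erase_singleton, map_zsmul, map_smul, LinearMap.zero_apply]
      have h1 : (Finsupp.lapply ∅ : (Finset V →₀ MvPolynomial V k) →ₗ[MvPolynomial V k] _) (Finsupp.single ∅ 1) = 1 := by simp
      rw [h1, ← map_smul, smul_eq_mul, mul_one]
      have : (qI V k t).mkQ (wt k V t j) = 0 := by
        rw [Submodule.mkQ_apply, Submodule.Quotient.mk_eq_zero]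
        exact Ideal.subset_span ⟨j, rfl⟩
      rw [this, smul_zero])
    (by
      rw [kos_d]
      intro x hx
      have hx' : x.1 ∅ ∈ qI V k t := by
        rw [← Submodule.Quotient.mk_eq_zero]; exact hx
      have hle : qI V k t ≤ ((kosMod V (MvPolynomial V k) 1).map (bd (wt k V t))).comap (Finsupp.lsingle ∅) := by
        rw [qI, Ideal.span_le]
        rintro _ ⟨j, rfl⟩
        refine ⟨Finsupp.single {j} 1, single_mem_kosMod (by simp) 1, ?_⟩
        simp only [bd, Finsupp.linearCombination_single, cobd, Finset.sum_singleton, one_smul]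
        rw [Finset.erase_singleton, Finsupp.smul_single, smul_eq_mul, mul_one, sg,
          Finset.filter_eq_empty_iff.2 (by simp)]
        simp
      obtain ⟨y, hy, hyx⟩ := hle hx'
      refine ⟨⟨y, hy⟩, Subtype.ext (hyx.trans ?_)⟩
      exact (eq_single_of_mem_kosMod_zero V x.2).symm)
    (by
      intro p x hx
      rw [kos_d] at hx ⊢
      refine ⟨⟨con k V t x.1, con_mem t _ _ x.2⟩, Subtype.ext ?_⟩
      have h0 : x.1 ∅ = 0 := by
        by_contra h
        have := x.2 (Finsupp.mem_support_iff.2 h)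
        simp at this
      have := homotopy t x.1 h0
      have hb : bd (wt k V t) x.1 = 0 := congrArg Subtype.val hx
      rwa [hb, map_zero, add_zero] at this)

lemma kosRes_π (t : ℕ) : (kosRes V k t).π.f 0 = aug V k t := ExtClass.resolutionOfExact_π ..

end res
end Koszul

namespace LocCoh
variable {R : Type} [CommRing R] (J : Ideal R) (i : ℕ) (Y : ModuleCat.{0} R)

/-- The module `Ext^i(R/a, Y)`. -/
noncomputable abbrev E (a : Ideal R) : ModuleCat.{0} R :=
  ((Ext R (ModuleCat.{0} R) i).obj (Opposite.op (ModuleCat.of R (R ⧸ a)))).obj Y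

/-- The projection between quotient rings. -/
def quo {a b : Ideal R} (h : a ≤ b) : ModuleCat.of R (R ⧸ a) ⟶ ModuleCat.of R (R ⧸ b) :=
  ModuleCat.ofHom (Submodule.mapQ a b LinearMap.id h)

/-- The map on `Ext` induced by a projection. -/
noncomputable def exm {a b : Ideal R} (h : a ≤ b) : E i Y b →ₗ[R] E i Y a :=
  (((Ext R (ModuleCat.{0} R) i).map (quo h).op).app Y).hom

lemma quo_comp {a b c : Ideal R} (h : a ≤ b) (h' : b ≤ c) : quo h ≫ quo h' = quo (h.trans h') := by
  refine ModuleCat.hom_ext (LinearMap.ext fun x => ?_)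
  obtain ⟨s, rfl⟩ := Submodule.mkQ_surjective _ x
  rfl

lemma exm_comp {a b c : Ideal R} (h : a ≤ b) (h' : b ≤ c) (e : E i Y c) :
    exm i Y h (exm i Y h' e) = exm i Y (h.trans h') e := by
  have : (Ext R (ModuleCat.{0} R) i).map (quo (h.trans h')).op =
    (Ext R (ModuleCat.{0} R) i).map (quo h').op ≫ (Ext R (ModuleCat.{0} R) i).map (quo h).op := by
    rw [← quo_comp h h', op_comp, Functor.map_comp]
  exact (LinearMap.congr_fun (congrArg (fun f => ModuleCat.Hom.hom (NatTrans.app f Y)) this) e).symm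

open localCohomology in
/-- The map from `Ext` to local cohomology. -/
noncomputable def lam (n : ℕ) : E i Y (J ^ n) →ₗ[R] (localCohomology J i).obj Y :=
  letI := localCohomology.hasColimitDiagram.{0,0} (idealPowersDiagram J) i
  ((colimit.ι (diagram (idealPowersDiagram J) i) (Opposite.op (Opposite.op n))).app Y).hom

/-- The arrow in the index category. -/
def arr {n m : ℕ} (h : n ≤ m) : (Opposite.op (Opposite.op n) : ℕᵒᵖᵒᵖ) ⟶ Opposite.op (Opposite.op m) :=
  (homOfLE h).op.op

open localCohomology in
lemma lam_exm {n m : ℕ} (h : n ≤ m) (e : E i Y (J ^ n)) :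
    lam J i Y m (exm i Y (Ideal.pow_le_pow_right h) e) = lam J i Y n e := by
  let := localCohomology.hasColimitDiagram.{0,0} (idealPowersDiagram J) i
  have := colimit.w (diagram (idealPowersDiagram J) i) (arr h)
  have h2 := congrArg (fun f => ModuleCat.Hom.hom (NatTrans.app f Y)) this
  exact LinearMap.congr_fun h2 e

open localCohomology in
/-- The colimit cocone evaluated at a module. -/
noncomputable def isColim :
    letI := localCohomology.hasColimitDiagram.{0,0} (idealPowersDiagram J) i
    IsColimit (((evaluation _ _).obj Y).mapCocone (colimit.cocone (diagram (idealPowersDiagram J) i))) :=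
  letI := localCohomology.hasColimitDiagram.{0,0} (idealPowersDiagram J) i
  isColimitOfPreserves ((evaluation _ _).obj Y) (colimit.isColimit _)

open localCohomology in
lemma exists_lam (x : (localCohomology J i).obj Y) : ∃ n e, lam J i Y n e = x := by
  let := localCohomology.hasColimitDiagram.{0,0} (idealPowersDiagram J) i
  obtain ⟨j, e, h⟩ := Concrete.isColimit_exists_rep _ (isColim J i Y) x
  exact ⟨j.unop.unop, e, h⟩

open localCohomology in
lemma exists_of_lam_eq_zero {n : ℕ} {e : E i Y (J ^ n)} (h : lam J i Y n e = 0) :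
    ∃ m, ∃ h : n ≤ m, exm i Y (Ideal.pow_le_pow_right h) e = 0 := by
  let := localCohomology.hasColimitDiagram.{0,0} (idealPowersDiagram J) i
  have h0 : lam J i Y n e = lam J i Y n 0 := by rw [h, map_zero]
  obtain ⟨j, f, g, hfg⟩ := Concrete.isColimit_exists_of_rep_eq _ (isColim J i Y)
    (i := Opposite.op (Opposite.op n)) (j := Opposite.op (Opposite.op n)) e 0 h0
  have hg : ∀ g : (Opposite.op (Opposite.op n) : ℕᵒᵖᵒᵖ) ⟶ j, ∃ hle : n ≤ j.unop.unop, g = arr hle :=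
    fun g => ⟨g.unop.unop.down.down, rfl⟩
  obtain ⟨hle, rfl⟩ := hg f
  obtain ⟨_, rfl⟩ := hg g
  refine ⟨j.unop.unop, hle, ?_⟩
  exact (show exm i Y (Ideal.pow_le_pow_right hle) e = exm i Y (Ideal.pow_le_pow_right hle) 0 from hfg).trans
    (map_zero _)

/-- The map to local cohomology from `Ext` of a quotient by an ideal containing a power of `J`. -/
lemma lam_well {a : Ideal R} {n m : ℕ} (hn : J ^ n ≤ a) (hm : J ^ m ≤ a) (e : E i Y a) :
    lam J i Y n (exm i Y hn e) = lam J i Y m (exm i Y hm e) := by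
  wlog h : n ≤ m generalizing n m
  · exact (this hm hn (le_of_not_ge h)).symm
  rw [← lam_exm J i Y h, exm_comp]

end LocCoh

namespace Koszul
variable {V : Type} [LinearOrder V] {R : Type} [CommRing R]

/-- The transition map between Koszul complexes, up to an equality of weights. -/
noncomputable def trW {w y z : V → R} (h : w = y * z) : kos w ⟶ kos y := h ▸ tr y z

lemma trW_f_mor {M : Type} [AddCommGroup M] [Module R M] {w y z : V → R} (h : w = y * z) (p : ℕ) (c : Finset V → M) :
    (trW h).f p ≫ mor y p c = mor w p (fun F => (∏ j ∈ F, z j) • c F) := by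
  subst h; exact tr_f_mor y z p c

lemma trW_apply {w y z : V → R} (h : w = y * z) (p : ℕ) (x : kosMod V R p) :
    (((trW h).f p).hom x : kosMod V R p).1 = trTot z x.1 := by
  subst h; rfl

omit [LinearOrder V] in
lemma wt_add {k : Type} [Field k] (t s : ℕ) : wt k V (t + s) = wt k V t * wt k V s := by
  funext j; exact pow_add _ _ _
end Koszul

namespace LocCoh
open Koszul
variable {V : Type} [LinearOrder V] [Fintype V] {k : Type} [Field k]
  {M : Type} [AddCommGroup M] [Module (MvPolynomial V k) M]

omit [LinearOrder V] [Fintype V] in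
lemma qI_le_pow (t : ℕ) : qI V k t ≤ maxIdeal k V ^ t := by
  rw [qI, Ideal.span_le]
  rintro _ ⟨j, rfl⟩
  exact Ideal.pow_mem_pow (show X j ∈ maxIdeal k V from Ideal.subset_span ⟨j, rfl⟩) t

omit [LinearOrder V] in
lemma exists_pow_le_qI (t : ℕ) : ∃ n, maxIdeal k V ^ n ≤ qI V k t := by
  refine Ideal.exists_pow_le_of_le_radical_of_fg ?_ (IsNoetherian.noetherian _)
  rw [maxIdeal, Ideal.span_le]
  rintro _ ⟨j, rfl⟩
  exact ⟨t, Ideal.subset_span ⟨j, rfl⟩⟩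

omit [LinearOrder V] [Fintype V] in
lemma pow_one_le_qI : maxIdeal k V ^ 1 ≤ qI V k 1 := by
  rw [pow_one, maxIdeal, Ideal.span_le]
  rintro _ ⟨j, rfl⟩
  exact Ideal.subset_span ⟨j, pow_one _⟩

omit [LinearOrder V] [Fintype V] in
lemma qI_add_le (t s : ℕ) : qI V k (t + s) ≤ qI V k t := by
  rw [qI, Ideal.span_le]
  rintro _ ⟨j, rfl⟩
  change (X j ^ (t + s) : MvPolynomial V k) ∈ _
  rw [pow_add]
  exact Ideal.mul_mem_right _ _ (Ideal.subset_span ⟨j, rfl⟩)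

variable (i : ℕ)

/-- The map from Koszul-type `Ext` to local cohomology. -/
noncomputable def kap (Y : ModuleCat.{0} (MvPolynomial V k)) (t : ℕ) :
    E i Y (qI V k t) →ₗ[MvPolynomial V k] (localCohomology (maxIdeal k V) i).obj Y :=
  lam (maxIdeal k V) i Y _ ∘ₗ exm i Y (exists_pow_le_qI t).choose_spec

omit [LinearOrder V] in
lemma kap_eq (Y : ModuleCat.{0} (MvPolynomial V k)) (t : ℕ) {n : ℕ} (h : maxIdeal k V ^ n ≤ qI V k t)
    (e : E i Y (qI V k t)) :
    kap i Y t e = lam (maxIdeal k V) i Y n (exm i Y h e) := by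
  rw [kap, LinearMap.comp_apply]
  exact lam_well (maxIdeal k V) i Y (exists_pow_le_qI t).choose_spec h e

omit [LinearOrder V] in
lemma kap_exm (Y : ModuleCat.{0} (MvPolynomial V k)) (t s : ℕ) (e : E i Y (qI V k t)) :
    kap i Y (t + s) (exm i Y (qI_add_le t s) e) = kap i Y t e := by
  obtain ⟨n, hn⟩ := exists_pow_le_qI (V := V) (k := k) (t + s)
  rw [kap_eq i Y _ hn, exm_comp, kap_eq]

omit [LinearOrder V] in
lemma kap_surj (Y : ModuleCat.{0} (MvPolynomial V k)) (x : (localCohomology (maxIdeal k V) i).obj Y) :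
    ∃ t e, kap i Y t e = x := by
  obtain ⟨n, e, rfl⟩ := exists_lam _ i Y x
  refine ⟨n, exm i Y (qI_le_pow n) e, ?_⟩
  obtain ⟨m, hm⟩ := exists_pow_le_qI (V := V) (k := k) n
  rw [kap_eq i Y _ hm, exm_comp, lam_well _ i Y (hm.trans (qI_le_pow n)) le_rfl]
  exact lam_exm _ i Y le_rfl e

omit [LinearOrder V] in
lemma exists_of_kap_eq_zero (Y : ModuleCat.{0} (MvPolynomial V k)) (t : ℕ) (e : E i Y (qI V k t)) (h : kap i Y t e = 0) :
    ∃ s, exm i Y (qI_add_le t s) e = 0 := by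
  obtain ⟨n, hn⟩ := exists_pow_le_qI (V := V) (k := k) t
  rw [kap_eq i Y _ hn] at h
  obtain ⟨m, hm, h0⟩ := exists_of_lam_eq_zero _ i Y h
  refine ⟨m, ?_⟩
  have h1 : qI V k (t + m) ≤ maxIdeal k V ^ m :=
    (qI_le_pow _).trans (Ideal.pow_le_pow_right (Nat.le_add_left _ _))
  rw [exm_comp] at h0
  rw [← exm_comp i Y h1 ((Ideal.pow_le_pow_right hm).trans hn), h0, map_zero]

/-- Koszul cocycles. -/
def IsCoc (k : Type) [Field k] [Module (MvPolynomial V k) M] (t i : ℕ) (c : Finset V → M) : Prop :=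
  ∀ F, F.card = i + 1 → cobd (wt k V t) c F = 0

variable {i} {t : ℕ}

omit [Fintype V] in
lemma IsCoc.d_comp {c : Finset V → M} (h : IsCoc k t i c) :
    (kos (wt k V t)).d (i + 1) i ≫ mor (wt k V t) i c = 0 := by
  rw [d_comp_mor, mor_congr _ _ (c' := (0 : Finset V → M)) (fun F hF => h F hF)]
  refine ModuleCat.hom_ext (LinearMap.ext fun x => ?_)
  change Finsupp.linearCombination _ (0 : Finset V → M) _ = 0
  simp

/-- The class of a cocycle in `Ext`. -/
noncomputable def ecls {c : Finset V → M} (h : IsCoc k t i c) : E i (ModuleCat.of _ M) (qI V k t) :=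
  ExtClass.extCls (P := kosRes V k t) (mor (wt k V t) i c) h.d_comp

/-- The class of a cocycle in local cohomology. -/
noncomputable def cls {c : Finset V → M} (h : IsCoc k t i c) :
    (localCohomology (maxIdeal k V) i).obj (ModuleCat.of _ M) := kap i _ t (ecls h)

omit [Fintype V] in
lemma isCoc_of_d_comp {c : Finset V → M}
    (h : (kos (wt k V t)).d (i + 1) i ≫ mor (wt k V t) i c = 0) : IsCoc k t i c := by
  rw [d_comp_mor] at h
  have h0 : mor (wt k V t) (i + 1) (0 : Finset V → M) = 0 := by
    refine ModuleCat.hom_ext (LinearMap.ext fun x => ?_)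
    change Finsupp.linearCombination _ (0 : Finset V → M) _ = 0
    simp
  rw [← h0, mor_eq_iff] at h
  exact h

lemma exists_ecls (e : E i (ModuleCat.of _ M) (qI V k t)) :
    ∃ (c : Finset V → M) (h : IsCoc k t i c), ecls h = e := by
  obtain ⟨φ, h, rfl⟩ := ExtClass.extCls_surjective (kosRes V k t) e
  obtain ⟨c, rfl⟩ := exists_mor _ _ φ
  exact ⟨c, isCoc_of_d_comp h, rfl⟩

lemma ecls_eq_zero_iff {c : Finset V → M} (h : IsCoc k t i c) :
    ecls h = 0 ↔ ∃ c' : Finset V → M, ∀ F, F.card = i → cobd (wt k V t) c' F = c F := by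
  cases i with
  | zero =>
    refine (ExtClass.extCls_eq_zero_iff (P := kosRes V k t) 0 (by simp) h.d_comp).trans ?_
    have hd : (kosRes V k t).complex.d 0 0 = 0 := HomologicalComplex.shape _ _ _ (by simp)
    have h0 : mor (wt k V t) 0 (0 : Finset V → M) = 0 := by
      refine ModuleCat.hom_ext (LinearMap.ext fun x => ?_)
      change Finsupp.linearCombination _ (0 : Finset V → M) _ = 0
      simp
    constructor
    · rintro ⟨ψ, hψ⟩
      have hψ' : mor (wt k V t) 0 (0 : Finset V → M) = mor (wt k V t) 0 c := by
        rw [h0]; refine Eq.trans ?_ hψ; rw [hd, zero_comp]; rfl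
      refine ⟨0, fun F hF => ?_⟩
      rw [← (mor_eq_iff _ _).1 hψ' F hF, Finset.card_eq_zero.1 hF]; simp [cobd]
    · rintro ⟨c', hc'⟩
      refine ⟨0, ?_⟩
      rw [comp_zero]
      refine h0.symm.trans (mor_congr _ _ fun F hF => ?_)
      rw [← hc' F hF, Finset.card_eq_zero.1 hF]; simp [cobd]
  | succ n =>
    refine (ExtClass.extCls_eq_zero_iff (P := kosRes V k t) n ((ComplexShape.up ℕ).prev_eq' rfl) h.d_comp).trans ?_
    constructor
    · rintro ⟨ψ, hψ⟩
      obtain ⟨c', rfl⟩ := exists_mor _ _ ψ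
      exact ⟨c', (mor_eq_iff (wt k V t) (n + 1)).1 ((d_comp_mor (wt k V t) n c').symm.trans hψ)⟩
    · rintro ⟨c', hc'⟩
      refine ⟨mor (wt k V t) n c', ?_⟩
      exact (d_comp_mor _ _ _).trans (mor_congr _ _ hc')

/-- The transition on cochains. -/
noncomputable def up (k : Type) [Field k] [Module (MvPolynomial V k) M] (s : ℕ) (c : Finset V → M) (F : Finset V) : M :=
  (∏ j ∈ F, wt k V s j) • c F

omit [Fintype V] in
lemma IsCoc.up {c : Finset V → M} (h : IsCoc k t i c) (s : ℕ) : IsCoc k (t + s) i (up k s c) := by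
  refine isCoc_of_d_comp ?_
  have h1 := trW_f_mor (wt_add (k := k) t s) i c
  change _ ≫ mor (wt k V (t + s)) i (fun F => (∏ j ∈ F, wt k V s j) • c F) = 0
  rw [← h1, ← Category.assoc, ← HomologicalComplex.Hom.comm, Category.assoc, h.d_comp, comp_zero]

lemma exm_ecls {c : Finset V → M} (h : IsCoc k t i c) (s : ℕ) :
    exm i _ (qI_add_le t s) (ecls h) = ecls (h.up s) := by
  refine (ExtClass.extCls_naturality (P := kosRes V k (t + s)) (Q := kosRes V k t)
    (trW (wt_add t s)) (quo (qI_add_le t s)) ?_ h.d_comp ?_).trans ?_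
  · rw [kosRes_π, kosRes_π]
    refine ModuleCat.hom_ext (LinearMap.ext fun x => ?_)
    have h0 := trW_apply (wt_add (k := k) (V := V) t s) 0 x
    refine congrArg (qI V k t).mkQ ((DFunLike.congr_fun h0 ∅).trans ?_)
    refine linearCombination_apply_kosMod (Finsupp.lapply ∅ ∘ₗ trTot (wt k V s)) (Finsupp.lapply ∅) (fun F hF => ?_) x.1 x.2
    rw [Finset.card_eq_zero.1 hF]
    simp [trTot]
  · have : (kos (wt k V (t + s))).d (i + 1) i ≫ (trW (wt_add (k := k) t s)).f i ≫ mor (wt k V t) i c = 0 := by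
      rw [trW_f_mor]; exact (h.up s).d_comp
    exact this
  · unfold ecls
    congr 1
    exact trW_f_mor _ _ _

lemma cls_up {c : Finset V → M} (h : IsCoc k t i c) (s : ℕ) : cls (h.up s) = cls h := by
  rw [cls, ← exm_ecls, kap_exm, cls]

lemma exists_cls (x : (localCohomology (maxIdeal k V) i).obj (ModuleCat.of _ M)) :
    ∃ (t : ℕ) (c : Finset V → M) (h : IsCoc k t i c), cls h = x := by
  obtain ⟨t, e, rfl⟩ := kap_surj i _ x
  obtain ⟨c, h, rfl⟩ := exists_ecls e
  exact ⟨t, c, h, rfl⟩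

lemma cls_eq_zero_iff {c : Finset V → M} (h : IsCoc k t i c) :
    cls h = 0 ↔ ∃ (s : ℕ) (c' : Finset V → M), ∀ F, F.card = i → cobd (wt k V (t + s)) c' F = up k s c F := by
  constructor
  · intro h0
    obtain ⟨s, hs⟩ := exists_of_kap_eq_zero i _ t _ h0
    rw [exm_ecls, ecls_eq_zero_iff] at hs
    exact ⟨s, hs⟩
  · rintro ⟨s, hs⟩
    rw [← cls_up h s, cls, (ecls_eq_zero_iff (h.up s)).2 hs, map_zero]

omit [Fintype V] in
lemma IsCoc.add {c c' : Finset V → M} (h : IsCoc k t i c) (h' : IsCoc k t i c') : IsCoc k t i (c + c') := by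
  intro F hF
  have := h F hF
  have := h' F hF
  simp_all [cobd, Finset.sum_add_distrib]

omit [Fintype V] in
lemma IsCoc.smul {c : Finset V → M} (h : IsCoc k t i c) (r : MvPolynomial V k) : IsCoc k t i (r • c) := by
  intro F hF
  have e : cobd (wt k V t) (r • c) F = r • cobd (wt k V t) c F := by
    simp only [cobd, Finset.smul_sum, Pi.smul_apply]
    refine Finset.sum_congr rfl fun j _ => ?_
    rw [smul_comm _ r, smul_comm _ r]
  rw [e, h F hF, smul_zero]

lemma cls_add {c c' : Finset V → M} (h : IsCoc k t i c) (h' : IsCoc k t i c') :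
    cls (h.add h') = cls h + cls h' := by
  rw [cls, cls, cls, ← map_add]
  congr 1
  have hd : (kos (wt k V t)).d (i + 1) i ≫ (mor (wt k V t) i c + mor (wt k V t) i c') = 0 := by
    rw [← mor_add]; exact (h.add h').d_comp
  have := ExtClass.extCls_add (P := kosRes V k t) h.d_comp h'.d_comp hd
  rw [ecls, ecls, ecls, ← this]
  congr 1
  exact mor_add _ _ _ _

lemma cls_smul {c : Finset V → M} (h : IsCoc k t i c) (r : MvPolynomial V k) :
    cls (h.smul r) = r • cls h := by
  rw [cls, cls, ← map_smul]
  congr 1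
  have hd : (kos (wt k V t)).d (i + 1) i ≫ (r • mor (wt k V t) i c) = 0 := by
    rw [← mor_smul]; exact (h.smul r).d_comp
  have := ExtClass.extCls_smul (P := kosRes V k t) r h.d_comp hd
  rw [ecls, ecls, ← this]
  congr 1
  exact mor_smul _ _ _ _

lemma range_lam_one (y : (localCohomology (maxIdeal k V) i).obj (ModuleCat.of _ M)) :
    (∃ e, lam (maxIdeal k V) i (ModuleCat.of _ M) 1 e = y) ↔ ∃ (c : Finset V → M) (h : IsCoc k 1 i c), cls h = y := by
  constructor
  · rintro ⟨e, rfl⟩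
    obtain ⟨c, h, he⟩ := exists_ecls (exm i _ (qI_le_pow 1) e)
    refine ⟨c, h, ?_⟩
    rw [cls, he, kap_eq i _ 1 pow_one_le_qI, exm_comp]
    exact lam_exm _ i _ le_rfl e
  · rintro ⟨c, h, rfl⟩
    exact ⟨_, (kap_eq i _ 1 pow_one_le_qI _).symm⟩

end LocCoh

namespace Mono
open Classical in
section
variable {V : Type} {k : Type} [Field k]

/-- The ideal generated by the monomials with exponents in `A`. -/
noncomputable def idl (k : Type) [Field k] (A : Set (V →₀ ℕ)) : Ideal (MvPolynomial V k) :=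
  Ideal.span ((fun s => monomial s (1 : k)) '' A)

/-- The exponents of the monomials outside a monomial ideal. -/
def out (A : Set (V →₀ ℕ)) (b : V →₀ ℕ) : Prop := ∀ s ∈ A, ¬ s ≤ b

lemma coeff_eq_zero_of_mem {A : Set (V →₀ ℕ)} {b : V →₀ ℕ} (hb : out A b) {f : MvPolynomial V k}
    (hf : f ∈ idl k A) : coeff b f = 0 := by
  rw [idl, mem_ideal_span_monomial_image] at hf
  by_contra h
  obtain ⟨s, hs, hle⟩ := hf b (mem_support_iff.2 h)
  exact hb s hs hle

lemma coeff_eq_zero_of_mem_restrictScalars {A : Set (V →₀ ℕ)} {b : V →₀ ℕ} (hb : out A b) :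
    (idl k A).restrictScalars k ≤ LinearMap.ker (lcoeff k b) :=
  fun _ hf => coeff_eq_zero_of_mem hb (Submodule.restrictScalars_mem k _ _ |>.1 hf)

/-- The coefficient functional on a quotient by a monomial ideal. -/
noncomputable def qcoeff (k : Type) [Field k] (A : Set (V →₀ ℕ)) (b : V →₀ ℕ) :
    (MvPolynomial V k ⧸ idl k A) →ₗ[k] k :=
  if h : out A b then
    ((idl k A).restrictScalars k).liftQ (lcoeff k b) (coeff_eq_zero_of_mem_restrictScalars h)
  else 0

lemma qcoeff_of_not {A : Set (V →₀ ℕ)} {b : V →₀ ℕ} (h : ¬ out A b) : qcoeff k A b = 0 := dif_neg h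

lemma qcoeff_mk {A : Set (V →₀ ℕ)} {b : V →₀ ℕ} (f : MvPolynomial V k) :
    qcoeff k A b (Submodule.Quotient.mk f) = if out A b then coeff b f else 0 := by
  by_cases h : out A b
  · have : qcoeff k A b = _ := dif_pos h
    rw [this, if_pos h]; rfl
  · rw [qcoeff_of_not h, if_neg h]; rfl

lemma ext_qcoeff {A : Set (V →₀ ℕ)} {x : MvPolynomial V k ⧸ idl k A} (h : ∀ b, out A b → qcoeff k A b x = 0) : x = 0 := by
  obtain ⟨f, rfl⟩ := Submodule.Quotient.mk_surjective _ x
  rw [Submodule.Quotient.mk_eq_zero, idl, mem_ideal_span_monomial_image]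
  intro b hb
  by_contra hne
  have hne : out A b := fun s hs hle => hne ⟨s, hs, hle⟩
  have := h b hne
  rw [qcoeff_mk, if_pos hne] at this
  exact (mem_support_iff.1 hb) this

/-- The nonnegative integral vector as an exponent. -/
def ok (A : Set (V →₀ ℕ)) (a : V → ℤ) : Prop := ∃ b : V →₀ ℕ, (∀ j, (b j : ℤ) = a j) ∧ out A b

/-- The coefficient functional for integral exponents. -/
noncomputable def cf (k : Type) [Field k] (A : Set (V →₀ ℕ)) (a : V → ℤ) :
    (MvPolynomial V k ⧸ idl k A) →ₗ[k] k :=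
  if h : ok A a then qcoeff k A h.choose else 0

lemma cf_of_not {A : Set (V →₀ ℕ)} {a : V → ℤ} (h : ¬ ok A a) : cf k A a = 0 := dif_neg h

lemma cf_eq {A : Set (V →₀ ℕ)} {a : V → ℤ} {b : V →₀ ℕ} (h : ∀ j, (b j : ℤ) = a j) :
    cf k A a = qcoeff k A b := by
  by_cases hb : out A b
  · have h' : ok A a := ⟨b, h, hb⟩
    rw [cf, dif_pos h']
    congr 1
    ext j
    have := h'.choose_spec.1 j
    have := h j
    omega
  · have h' : ¬ ok A a := by
      rintro ⟨b', h1, h2⟩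
      refine hb ?_
      have : b = b' := by
        ext j; have := h j; have := h1 j; omega
      rwa [this]
    rw [cf, dif_neg h', qcoeff_of_not hb]

lemma ext_cf {A : Set (V →₀ ℕ)} {x y : MvPolynomial V k ⧸ idl k A} (h : ∀ a, ok A a → cf k A a x = cf k A a y) : x = y := by
  refine sub_eq_zero.1 (ext_qcoeff fun b hb => ?_)
  have := h (fun j => b j) ⟨b, fun _ => rfl, hb⟩
  rw [cf_eq (b := b) (fun _ => rfl)] at this
  rw [map_sub, this, sub_self]

lemma cf_smul {A : Set (V →₀ ℕ)} (a : V → ℤ) (v : V →₀ ℕ) (x : MvPolynomial V k ⧸ idl k A) :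
    cf k A a (monomial v (1 : k) • x) = if ok A a then cf k A (fun j => a j - v j) x else 0 := by
  split_ifs with h
  · obtain ⟨b, hb, ho⟩ := h
    obtain ⟨f, rfl⟩ := Submodule.Quotient.mk_surjective _ x
    rw [cf_eq hb, ← Submodule.Quotient.mk_smul, qcoeff_mk, if_pos ho, smul_eq_mul, coeff_monomial_mul']
    split_ifs with hv
    · have : out A (b - v) := fun s hs hle => ho s hs (hle.trans tsub_le_self)
      rw [cf_eq (b := b - v), qcoeff_mk, if_pos this, one_mul]
      intro j
      have := hv j
      have := hb j
      rw [Finsupp.tsub_apply]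
      push_cast [hv j]
      omega
    · rw [cf_of_not]; · rfl
      rintro ⟨b', hb', -⟩
      refine hv fun j => ?_
      have h1 : (b' j : ℤ) = a j - v j := hb' j
      have := hb j
      omega
  · rw [cf_of_not h]; rfl

/-- The monomial with a given integral exponent, in the quotient. -/
noncomputable def mon (k : Type) [Field k] (A : Set (V →₀ ℕ)) (a : V → ℤ) : MvPolynomial V k ⧸ idl k A :=
  if h : ok A a then Submodule.Quotient.mk (monomial h.choose 1) else 0

lemma cf_mon {A : Set (V →₀ ℕ)} (a a' : V → ℤ) : cf k A a (mon k A a') = if a = a' ∧ ok A a then 1 else 0 := by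
  by_cases h : ok A a
  · by_cases h' : ok A a'
    · rw [mon, dif_pos h']
      obtain ⟨b, hb, ho⟩ := h
      rw [cf_eq hb, qcoeff_mk, if_pos ho, coeff_monomial]
      have key : h'.choose = b ↔ a = a' := by
        constructor
        · intro e; funext j; have := h'.choose_spec.1 j; rw [e] at this; rw [← this, hb]
        · rintro rfl; ext j; have := h'.choose_spec.1 j; have := hb j; omega
      by_cases e : a = a'
      · rw [if_pos (key.2 e), if_pos ⟨e, ⟨b, hb, ho⟩⟩]
      · rw [if_neg (fun h => e (key.1 h)), if_neg (fun h => e h.1)]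
    · rw [mon, dif_neg h', map_zero, if_neg]; rintro ⟨rfl, _⟩; exact h' h
  · rw [cf_of_not h, if_neg (fun h' => h h'.2)]; rfl

lemma finite_cf {A : Set (V →₀ ℕ)} (x : MvPolynomial V k ⧸ idl k A) : {a | cf k A a x ≠ 0}.Finite := by
  obtain ⟨f, rfl⟩ := Submodule.Quotient.mk_surjective _ x
  refine (f.support.finite_toSet.image (fun b j => (b j : ℤ))).subset ?_
  intro a ha
  by_cases h : ok A a
  · obtain ⟨b, hb, ho⟩ := h
    refine ⟨b, ?_, funext hb⟩
    rw [Set.mem_ofPred_eq, cf_eq hb, qcoeff_mk, if_pos ho] at ha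
    exact mem_support_iff.2 ha
  · exact absurd (by rw [cf_of_not h]; rfl) ha

end
open Koszul LocCoh
open Classical in
section
variable {V : Type} [LinearOrder V] {k : Type} [Field k]

/-- The simplicial coboundary. -/
def dl (u : Finset V → k) (F : Finset V) : k := ∑ j ∈ F, sg F j • u (F.erase j)

lemma dl_eq_cobd (u : Finset V → k) : dl u = cobd (fun _ => (1 : k)) u := by
  funext F; simp [dl, cobd]

lemma dl_dl (u : Finset V → k) : dl (dl u) = 0 := by
  rw [dl_eq_cobd, dl_eq_cobd, cobd_cobd]

/-- Cocycles on a family of finite sets. -/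
def Coc (Γ : Set (Finset V)) (i : ℕ) (u : Finset V → k) : Prop :=
  (∀ F, F ∉ Γ → u F = 0) ∧ ∀ F ∈ Γ, F.card = i + 1 → dl u F = 0

/-- Coboundaries on a family of finite sets. -/
def Cob (Γ : Set (Finset V)) (i : ℕ) (u : Finset V → k) : Prop :=
  ∃ ψ : Finset V → k, (∀ F, F ∉ Γ → ψ F = 0) ∧ ∀ F ∈ Γ, F.card = i → dl ψ F = u F

/-- Vanishing of the cohomology of a family of finite sets. -/
def Van (k : Type) [Field k] (Γ : Set (Finset V)) (i : ℕ) : Prop :=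
  ∀ u : Finset V → k, Coc Γ i u → Cob Γ i u

lemma Cob.congr {Γ : Set (Finset V)} {i : ℕ} {u v : Finset V → k} (h : Cob Γ i u)
    (huv : ∀ F ∈ Γ, u F = v F) : Cob Γ i v := by
  obtain ⟨ψ, h1, h2⟩ := h
  exact ⟨ψ, h1, fun F hF hi => (h2 F hF hi).trans (huv F hF)⟩

lemma dl_add (u v : Finset V → k) (F : Finset V) : dl (u + v) F = dl u F + dl v F := by
  simp [dl, Finset.sum_add_distrib]

lemma dl_sub (u v : Finset V → k) (F : Finset V) : dl (u - v) F = dl u F - dl v F := by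
  simp [dl, smul_sub, Finset.sum_sub_distrib]

lemma dl_neg (u : Finset V → k) (F : Finset V) : dl (-u) F = - dl u F := by
  simp [dl]

/-- The exponent of a component of a cochain. -/
def sh (a : V → ℤ) (t : ℕ) (F : Finset V) (j : V) : ℤ := a j + if j ∈ F then (t : ℤ) else 0

variable (A : Set (V →₀ ℕ))

/-- The family of nonvanishing components at a finite level. -/
def gam (a : V → ℤ) (t : ℕ) : Set (Finset V) := {F | ok A (sh a t F)}

/-- The degree complex. -/
def dlt (a : V → ℤ) : Set (Finset V) :=
  {F | (∀ j ∉ F, 0 ≤ a j) ∧ ∀ s ∈ A, ∃ j ∉ F, a j < s j}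

variable {A}

omit [LinearOrder V] in
lemma ok_iff [Finite V] (a : V → ℤ) : ok A a ↔ (∀ j, 0 ≤ a j) ∧ ∀ s ∈ A, ∃ j, a j < s j := by
  constructor
  · rintro ⟨b, hb, ho⟩
    refine ⟨fun j => by rw [← hb]; positivity, fun s hs => ?_⟩
    by_contra h
    push Not at h
    refine ho s hs fun j => ?_
    have := h j
    rw [← hb] at this
    exact_mod_cast this
  · rintro ⟨h, h'⟩
    have := Fintype.ofFinite V
    refine ⟨Finsupp.equivFunOnFinite.symm (fun j => (a j).toNat), fun j => ?_, fun s hs hle => ?_⟩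
    · simp [h j]
    · obtain ⟨j, hj⟩ := h' s hs
      have h1 := hle j
      have h2 := h j
      simp only [Finsupp.equivFunOnFinite_symm_apply_apply] at h1
      have h3 : a j < (s j : ℤ) := hj
      omega

variable [Fintype V]

lemma mem_gam {a : V → ℤ} {t : ℕ} {F : Finset V} : F ∈ gam A a t ↔
    (∀ j, 0 ≤ sh a t F j) ∧ ∀ s ∈ A, ∃ j, sh a t F j < s j := ok_iff _

lemma gam_mono {a : V → ℤ} {t t' : ℕ} {F : Finset V} (hF : F ∈ dlt A a) (h : t ≤ t')
    (hg : F ∈ gam A a t) : F ∈ gam A a t' := by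
  rw [mem_gam] at hg ⊢
  refine ⟨fun j => ?_, fun s hs => ?_⟩
  · have := hg.1 j
    unfold sh at *
    split_ifs at * <;> omega
  · obtain ⟨j, hj, hlt⟩ := hF.2 s hs
    exact ⟨j, by unfold sh; rw [if_neg hj]; omega⟩

lemma exists_gam_eq (A : Set (V →₀ ℕ)) (a : V → ℤ) : ∃ T, ∀ t, T ≤ t → gam A a t = dlt A a := by
  have key : ∀ F : Finset V, ∃ T, ∀ t, T ≤ t → (F ∈ gam A a t ↔ F ∈ dlt A a) := by
    intro F
    have hb : ∀ f : V → ℤ, ∃ T : ℕ, ∀ j, f j ≤ T := fun f =>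
      ⟨∑ j, (f j).toNat, fun j => by
        have : (f j).toNat ≤ ∑ j, (f j).toNat := Finset.single_le_sum (f := fun j => (f j).toNat) (fun _ _ => Nat.zero_le _) (Finset.mem_univ j)
        omega⟩
    by_cases hF : F ∈ dlt A a
    · obtain ⟨T, hT⟩ := hb (fun j => - a j)
      refine ⟨T, fun t ht => iff_of_true ?_ hF⟩
      rw [mem_gam]
      refine ⟨fun j => ?_, fun s hs => ?_⟩
      · have := hT j
        unfold sh
        split_ifs with h
        · omega
        · have := hF.1 j h; omega
      · obtain ⟨j, hj, hlt⟩ := hF.2 s hs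
        exact ⟨j, by unfold sh; rw [if_neg hj]; omega⟩
    · by_cases h0 : ∀ j ∉ F, 0 ≤ a j
      · have : ∃ s ∈ A, ∀ j ∉ F, (s j : ℤ) ≤ a j := by
          by_contra h; push Not at h; exact hF ⟨h0, h⟩
        obtain ⟨s, hs, hsa⟩ := this
        obtain ⟨T, hT⟩ := hb (fun j => s j - a j)
        refine ⟨T, fun t ht => iff_of_false ?_ hF⟩
        rw [mem_gam]
        rintro ⟨-, h2⟩
        obtain ⟨j, hj⟩ := h2 s hs
        have := hT j
        unfold sh at hj
        split_ifs at hj with h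
        · omega
        · have := hsa j h; omega
      · push Not at h0
        obtain ⟨j, hj, hlt⟩ := h0
        refine ⟨0, fun t _ => iff_of_false ?_ hF⟩
        rw [mem_gam]
        rintro ⟨h, -⟩
        have := h j
        unfold sh at this
        rw [if_neg hj] at this; omega
  choose T hT using key
  refine ⟨Finset.univ.sup T, fun t ht => Set.ext fun F => hT F t (le_trans (Finset.le_sup (Finset.mem_univ F)) ht)⟩

/-- The component of a cochain in a given degree. -/
noncomputable def comp (a : V → ℤ) (t : ℕ) (c : Finset V → MvPolynomial V k ⧸ idl k A) (F : Finset V) : k :=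
  cf k A (sh a t F) (c F)

omit [Fintype V] in
lemma comp_of_notMem {a : V → ℤ} {t : ℕ} {c : Finset V → MvPolynomial V k ⧸ idl k A} {F : Finset V}
    (h : F ∉ gam A a t) : comp a t c F = 0 := by
  rw [comp, cf_of_not h]; rfl

omit [Fintype V] in
lemma cf_cobd (a : V → ℤ) (t : ℕ) (c : Finset V → MvPolynomial V k ⧸ idl k A) {F : Finset V}
    (h : F ∈ gam A a t) : cf k A (sh a t F) (cobd (wt k V t) c F) = dl (comp a t c) F := by
  simp only [cobd, map_sum, map_zsmul, dl]
  refine Finset.sum_congr rfl fun j hj => ?_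
  rw [wt, X_pow_eq_monomial, cf_smul, if_pos (show ok A _ from h), comp]
  congr 3
  funext l
  unfold sh
  by_cases hl : l = j
  · subst hl; simp [hj]
  · simp [hl]

omit [Fintype V] in
lemma isCoc_iff {t i : ℕ} {c : Finset V → MvPolynomial V k ⧸ idl k A} :
    IsCoc k t i c ↔ ∀ a, Coc (gam A a t) i (comp a t c) := by
  constructor
  · intro h a
    refine ⟨fun F hF => comp_of_notMem hF, fun F hF hi => ?_⟩
    rw [← cf_cobd a t c hF, h F hi, map_zero]
  · intro h F hF
    refine ext_cf fun a ha => ?_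
    rw [map_zero]
    have : a = sh (fun j => a j - if j ∈ F then (t : ℤ) else 0) t F := by
      funext j; unfold sh; ring
    rw [this] at ha ⊢
    rw [cf_cobd _ _ _ ha]
    exact (h _).2 F ha hF

omit [Fintype V] in
lemma comp_smul (a : V → ℤ) (t : ℕ) (v : V →₀ ℕ) (c : Finset V → MvPolynomial V k ⧸ idl k A) {F : Finset V}
    (h : F ∈ gam A a t) : comp a t (monomial v (1 : k) • c) F = comp (fun j => a j - v j) t c F := by
  rw [comp, Pi.smul_apply, cf_smul, if_pos (show ok A _ from h), comp]
  congr 2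
  funext j
  unfold sh; ring

omit [LinearOrder V] [Fintype V] in
lemma prod_wt (s : ℕ) (F : Finset V) : ∏ j ∈ F, wt k V s j = monomial (∑ j ∈ F, Finsupp.single j s) 1 := by
  rw [monomial_sum_one]
  exact Finset.prod_congr rfl fun j _ => X_pow_eq_monomial

omit [Fintype V] in
lemma comp_up (a : V → ℤ) (t s : ℕ) (c : Finset V → MvPolynomial V k ⧸ idl k A) {F : Finset V}
    (h : F ∈ gam A a (t + s)) : comp a (t + s) (up k s c) F = comp a t c F := by
  rw [comp, up, prod_wt, cf_smul, if_pos (show ok A _ from h), comp]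
  congr 2
  funext j
  unfold sh
  rw [Finsupp.finsetSum_apply]
  simp only [Finsupp.single_apply, Finset.sum_ite_eq']
  split_ifs <;> push_cast <;> ring

lemma comp_up' (a : V → ℤ) (t s : ℕ) (c : Finset V → MvPolynomial V k ⧸ idl k A) {F : Finset V}
    (h : F ∈ dlt A a) : comp a (t + s) (up k s c) F = comp a t c F := by
  by_cases h1 : F ∈ gam A a (t + s)
  · exact comp_up a t s c h1
  · rw [comp_of_notMem h1, comp_of_notMem (fun h2 => h1 (gam_mono h (Nat.le_add_right _ _) h2))]

/-- The cochain in several degrees with given components. -/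
noncomputable def coch (B : Finset (V → ℤ)) (t : ℕ) (u : (V → ℤ) → Finset V → k) (F : Finset V) :
    MvPolynomial V k ⧸ idl k A := ∑ a ∈ B, u a F • mon k A (sh a t F)

omit [Fintype V] in
lemma sh_injective {a a' : V → ℤ} {t : ℕ} {F : Finset V} (h : sh a t F = sh a' t F) : a = a' := by
  funext j
  have := congrFun h j
  unfold sh at this
  linarith

lemma comp_coch (B : Finset (V → ℤ)) (t : ℕ) (u : (V → ℤ) → Finset V → k) (a : V → ℤ) {F : Finset V}
    (h : F ∈ gam A a t) : comp a t (coch (A := A) B t u) F = if a ∈ B then u a F else 0 := by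
  simp only [comp, coch, map_sum, map_smul, cf_mon, smul_eq_mul]
  rw [← Finset.sum_ite_eq B a (fun a => u a F)]
  refine Finset.sum_congr rfl fun a' _ => ?_
  by_cases e : a = a'
  · subst e
    rw [if_pos ⟨rfl, h⟩, if_pos rfl, mul_one]
  · rw [if_neg (fun h => e (sh_injective h.1)), if_neg e, mul_zero]

lemma comp_coch_eq (B : Finset (V → ℤ)) (t : ℕ) (u : (V → ℤ) → Finset V → k) (a : V → ℤ) (ha : a ∈ B)
    (hu : ∀ F, F ∉ gam A a t → u a F = 0) : comp a t (coch (A := A) B t u) = u a := by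
  funext F
  by_cases h : F ∈ gam A a t
  · rw [comp_coch _ _ _ _ h, if_pos ha]
  · rw [comp_of_notMem h, hu F h]

lemma isCoc_coch (B : Finset (V → ℤ)) (t i : ℕ) (u : (V → ℤ) → Finset V → k)
    (hu : ∀ a ∈ B, Coc (gam A a t) i (u a)) : IsCoc k t i (coch (A := A) B t u) := by
  rw [isCoc_iff]
  intro a
  by_cases ha : a ∈ B
  · rw [comp_coch_eq _ _ _ _ ha (hu a ha).1]; exact hu a ha
  · have : comp a t (coch (A := A) B t u) = 0 := by
      funext F
      by_cases h : F ∈ gam A a t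
      · rw [comp_coch _ _ _ _ h, if_neg ha]; rfl
      · exact comp_of_notMem h
    rw [this]
    exact ⟨fun _ _ => rfl, fun _ _ _ => by simp [dl]⟩

lemma exists_degrees (t : ℕ) (c : Finset V → MvPolynomial V k ⧸ idl k A) :
    ∃ B : Finset (V → ℤ), ∀ a ∉ B, comp a t c = 0 := by
  have : (⋃ F : Finset V, {a | comp a t c F ≠ 0}).Finite := by
    refine Set.finite_iUnion fun F => ?_
    exact (finite_cf (c F)).preimage (fun a _ a' _ h => sh_injective h)
  refine ⟨this.toFinset, fun a ha => funext fun F => ?_⟩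
  by_contra h
  exact ha (this.mem_toFinset.2 (Set.mem_iUnion.2 ⟨F, h⟩))

lemma coc_comp {t i : ℕ} {c : Finset V → MvPolynomial V k ⧸ idl k A} (h : IsCoc k t i c) (a : V → ℤ) :
    Coc (dlt A a) i ((dlt A a).indicator (comp a t c)) := by
  obtain ⟨T, hT⟩ := exists_gam_eq A a
  have h1 := isCoc_iff.1 (h.up T) a
  rw [hT _ (Nat.le_add_left _ _)] at h1
  convert h1 using 1
  funext F
  by_cases hF : F ∈ dlt A a
  · rw [Set.indicator_of_mem hF, comp_up' _ _ _ _ hF]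
  · rw [Set.indicator_of_notMem hF, h1.1 F hF]

lemma cls_eq_zero_iff_cob {t i : ℕ} {c : Finset V → MvPolynomial V k ⧸ idl k A} (h : IsCoc k t i c) :
    cls h = 0 ↔ ∀ a, Cob (dlt A a) i (comp a t c) := by
  constructor
  · intro h0 a
    obtain ⟨T, hT⟩ := exists_gam_eq A a
    rw [← cls_up h T, cls_eq_zero_iff] at h0
    obtain ⟨s, c', hc'⟩ := h0
    have hg : gam A a (t + T + s) = dlt A a := hT _ (by omega)
    refine ⟨comp a (t + T + s) c', fun F hF => comp_of_notMem (hg ▸ hF), fun F hF hi => ?_⟩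
    rw [← cf_cobd _ _ _ (hg ▸ hF), hc' F hi]
    exact (comp_up' a (t + T) s _ hF).trans (comp_up' a t T c hF)
  · intro h0
    choose ψ h1 h2 using h0
    obtain ⟨B, hB⟩ := exists_degrees t c
    choose T hT using exists_gam_eq A
    refine (cls_eq_zero_iff h).2 ⟨B.sup T, coch B (t + B.sup T) ψ, fun F hF => ext_cf fun e he => ?_⟩
    obtain ⟨a, rfl⟩ : ∃ a, e = sh a (t + B.sup T) F :=
      ⟨fun j => e j - if j ∈ F then ((t + B.sup T : ℕ) : ℤ) else 0, by funext j; unfold sh; ring⟩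
    rw [cf_cobd _ _ _ he]
    refine Eq.trans ?_ (comp_up a t _ c he).symm
    by_cases ha : a ∈ B
    · have hg : gam A a (t + B.sup T) = dlt A a :=
        hT a _ ((Finset.le_sup ha).trans (Nat.le_add_left _ _))
      rw [comp_coch_eq _ _ _ _ ha (by rw [hg]; exact h1 a)]
      exact h2 a F (hg ▸ he) hF
    · rw [hB a ha]
      have : comp a (t + B.sup T) (coch (A := A) B (t + B.sup T) ψ) = 0 := by
        funext F
        by_cases h : F ∈ gam A a (t + B.sup T)
        · rw [comp_coch _ _ _ _ h, if_neg ha]; rfl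
        · exact comp_of_notMem h
      rw [this]; simp [dl]

end
end Mono

namespace Koszul
variable {V : Type} [LinearOrder V] {R M : Type} [CommRing R] [AddCommGroup M] [Module R M]

lemma cobd_contract (y : V → R) (c : Finset V → M) (F : Finset V) (j : V)
    (h : j ∉ F → cobd y c (insert j F) = 0) :
    cobd y (fun G => if j ∈ G then 0 else sg (insert j G) j • c (insert j G)) F = y j • c F := by
  by_cases hj : j ∈ F
  · rw [cobd, Finset.sum_eq_single j]
    · simp only [Finset.notMem_erase, if_false, Finset.insert_erase hj]
      rw [smul_comm (y j), smul_smul, sg_mul_self, one_smul]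
    · intro l hl hlj
      rw [if_pos (Finset.mem_erase.2 ⟨Ne.symm hlj, hj⟩), smul_zero, smul_zero]
    · intro h; exact absurd hj h
  · have hc := h hj
    rw [cobd, Finset.sum_insert hj, Finset.erase_insert hj] at hc
    have hc' := congrArg (fun z => sg (insert j F) j • z) hc
    simp only [smul_add, smul_smul, sg_mul_self, one_smul, smul_zero, Finset.smul_sum] at hc'
    refine Eq.trans ?_ (eq_neg_of_add_eq_zero_left hc').symm
    rw [cobd, ← Finset.sum_neg_distrib]
    refine Finset.sum_congr rfl fun l hl => ?_
    have hlj : l ≠ j := fun e => hj (e ▸ hl)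
    have hje : j ∉ F.erase l := fun h => hj (Finset.mem_of_mem_erase h)
    have e1 : insert j (F.erase l) = (insert j F).erase l := (Finset.erase_insert_of_ne hlj.symm).symm
    rw [if_neg hje, smul_comm (y l), smul_smul, ← neg_smul, e1]
    congr 1
    have h1 := sg_mul_sg (Finset.mem_insert_self j F) (Finset.mem_insert_of_mem hl) hlj.symm
    rw [Finset.erase_insert hj] at h1
    have h2 := sg_mul_self (insert j F) j
    have h3 := sg_mul_self ((insert j F).erase l) j
    linear_combination (sg (insert j F) j * sg ((insert j F).erase l) j) * h1 -
      (sg F l * sg ((insert j F).erase l) j) * h2 - sg (insert j F) j * sg (insert j F) l * h3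

end Koszul

namespace LocCoh
open Koszul
variable {V : Type} [LinearOrder V] [Fintype V] {k : Type} [Field k]
  {M : Type} [AddCommGroup M] [Module (MvPolynomial V k) M] {i t : ℕ}

lemma cls_congr {t' : ℕ} {c c' : Finset V → M} (h : IsCoc k t i c) (h' : IsCoc k t' i c') (ht : t = t') (hc : c = c') :
    cls h = cls h' := by
  subst ht; subst hc; rfl

lemma X_pow_smul_cls {c : Finset V → M} (h : IsCoc k t i c) (j : V) :
    (X j ^ t : MvPolynomial V k) • cls h = 0 := by
  rw [← cls_smul h, cls_eq_zero_iff]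
  refine ⟨0, fun G => if j ∈ G then 0 else sg (insert j G) j • c (insert j G), fun F hF => ?_⟩
  have hup : up k 0 ((X j ^ t : MvPolynomial V k) • c) F = (X j ^ t : MvPolynomial V k) • c F := by
    simp [up, wt]
  rw [hup]
  rw [cobd_contract]
  · rfl
  · exact fun hj => h _ (by rw [Finset.card_insert_of_notMem hj, hF])

lemma exists_pow_smul (y : (localCohomology (maxIdeal k V) i).obj (ModuleCat.of _ M)) (j : V) :
    ∃ r : ℕ, (X j ^ r : MvPolynomial V k) • y = 0 := by
  obtain ⟨t, c, h, rfl⟩ := exists_cls y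
  exact ⟨t, X_pow_smul_cls h j⟩

lemma exists_pow_smul_all (hfin : IsFiniteLength (MvPolynomial V k)
    ((localCohomology (maxIdeal k V) i).obj (ModuleCat.of _ M))) (j : V) :
    ∃ r : ℕ, ∀ y : (localCohomology (maxIdeal k V) i).obj (ModuleCat.of _ M),
      (X j ^ r : MvPolynomial V k) • y = 0 := by
  have hN := (isFiniteLength_iff_isNoetherian_isArtinian.1 hfin).1
  obtain ⟨S, hS⟩ := (hN.noetherian ⊤ : (⊤ : Submodule (MvPolynomial V k) _).FG)
  choose r hr using fun y : (localCohomology (maxIdeal k V) i).obj (ModuleCat.of _ M) =>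
    exists_pow_smul y j
  refine ⟨S.sup r, fun y => ?_⟩
  have hle : (⊤ : Submodule (MvPolynomial V k)
        ((localCohomology (maxIdeal k V) i).obj (ModuleCat.of (MvPolynomial V k) M))) ≤
      Submodule.torsionBy (MvPolynomial V k)
        ((localCohomology (maxIdeal k V) i).obj (ModuleCat.of (MvPolynomial V k) M))
        (X j ^ S.sup r : MvPolynomial V k) := by
    rw [← hS, Submodule.span_le]
    intro z hz
    change (X j ^ S.sup r : MvPolynomial V k) • z = 0
    obtain ⟨m, hm⟩ := Nat.exists_eq_add_of_le (Finset.le_sup (f := r) hz)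
    rw [hm, add_comm, pow_add, mul_smul, hr, smul_zero]
  exact hle (Submodule.mem_top (x := y))

lemma smul_eq_zero_of_surjective
    (hs : Function.Surjective (lam (maxIdeal k V) i (ModuleCat.of _ M) 1))
    (y : (localCohomology (maxIdeal k V) i).obj (ModuleCat.of _ M)) {x : MvPolynomial V k}
    (hx : x ∈ maxIdeal k V ^ 1) : x • y = 0 := by
  obtain ⟨c, h, rfl⟩ := (range_lam_one y).1 (hs y)
  rw [pow_one] at hx
  refine Submodule.span_induction (p := fun x _ => x • cls h = 0) ?_ (zero_smul _ _) ?_ ?_ hx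
  · rintro _ ⟨j, rfl⟩
    have := X_pow_smul_cls h j
    rwa [pow_one] at this
  · intro a b _ _ ha hb
    rw [add_smul, ha, hb, add_zero]
  · intro a b _ hb
    rw [smul_eq_mul, mul_smul, hb, smul_zero]

end LocCoh

namespace Mono
open Koszul LocCoh
open Classical in
section
variable {V : Type} [LinearOrder V] [Fintype V] {k : Type} [Field k] {A : Set (V →₀ ℕ)} {i : ℕ}

omit [Fintype V] in
lemma cob_zero (Γ : Set (Finset V)) (i : ℕ) : Cob Γ i (0 : Finset V → k) :=
  ⟨0, fun _ _ => rfl, fun _ _ _ => by simp [dl]⟩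

omit [Fintype V] in
lemma comp_add (a : V → ℤ) (t : ℕ) (c c' : Finset V → MvPolynomial V k ⧸ idl k A) :
    comp a t (c + c') = comp a t c + comp a t c' := by
  funext F; simp [comp]

omit [Fintype V] in
lemma comp_C_smul (a : V → ℤ) (t : ℕ) (r : k) (c : Finset V → MvPolynomial V k ⧸ idl k A) :
    comp a t ((C r : MvPolynomial V k) • c) = r • comp a t c := by
  funext F
  have : (C r : MvPolynomial V k) • c F = r • c F := by
    rw [← algebraMap_eq, algebraMap_smul]
  simp [comp, this]

lemma cls_eq_of_cob_level {t : ℕ} {c c' : Finset V → MvPolynomial V k ⧸ idl k A}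
    (h : IsCoc k t i c) (h' : IsCoc k t i c')
    (hc : ∀ a, Cob (dlt A a) i (comp a t c - comp a t c')) : cls h = cls h' := by
  have h0 : cls (h.add (h'.smul (C (-1)))) = 0 := by
    rw [cls_eq_zero_iff_cob]
    intro a
    rw [comp_add, comp_C_smul, neg_one_smul, ← sub_eq_add_neg]
    exact hc a
  rw [cls_add h (h'.smul _), cls_smul h', map_neg, map_one, neg_one_smul] at h0
  exact eq_of_sub_eq_zero ((sub_eq_add_neg _ _).trans h0)

lemma cls_eq_of_cob {t t' : ℕ} {c c' : Finset V → MvPolynomial V k ⧸ idl k A}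
    (h : IsCoc k t i c) (h' : IsCoc k t' i c')
    (hc : ∀ a, Cob (dlt A a) i (comp a t c - comp a t' c')) : cls h = cls h' := by
  have e : t' + t = t + t' := add_comm _ _
  have h2 : IsCoc k (t + t') i (up k t c') := e ▸ h'.up t
  rw [← cls_up h t', ← cls_up h' t, cls_congr (h'.up t) h2 e rfl]
  refine cls_eq_of_cob_level _ _ fun a => (hc a).congr fun F hF => ?_
  rw [Pi.sub_apply, Pi.sub_apply, comp_up' a t t' c hF]
  congr 1
  rw [← e, comp_up' a t' t c' hF]

lemma comp_coch_of_notMem (B : Finset (V → ℤ)) (t : ℕ) (u : (V → ℤ) → Finset V → k) (a : V → ℤ)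
    (ha : a ∉ B) : comp a t (coch (A := A) B t u) = 0 := by
  funext F
  by_cases h : F ∈ gam A a t
  · rw [comp_coch _ _ _ _ h, if_neg ha]; rfl
  · exact comp_of_notMem h

variable (k A i) in
theorem subsingleton_iff :
    Subsingleton ((localCohomology (maxIdeal k V) i).obj
      (ModuleCat.of (MvPolynomial V k) (MvPolynomial V k ⧸ idl k A))) ↔
      ∀ a, Van k (dlt A a) i := by
  constructor
  · intro hs a u hu
    obtain ⟨t, ht⟩ := exists_gam_eq A a
    have hg := ht t le_rfl
    have hc : IsCoc k t i (coch (A := A) {a} t fun _ => u) := isCoc_coch _ _ _ _ fun a' ha' => by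
      rw [Finset.mem_singleton.1 ha', hg]; exact hu
    have := (cls_eq_zero_iff_cob hc).1 (Subsingleton.elim _ _) a
    rwa [comp_coch_eq _ _ _ _ (Finset.mem_singleton_self a) (by rw [hg]; exact hu.1)] at this
  · intro hv
    refine ⟨fun x y => ?_⟩
    have h0 : ∀ x : (localCohomology (maxIdeal k V) i).obj
      (ModuleCat.of (MvPolynomial V k) (MvPolynomial V k ⧸ idl k A)), x = 0 := by
      intro x
      obtain ⟨t, c, h, rfl⟩ := exists_cls x
      rw [cls_eq_zero_iff_cob]
      exact fun a => (hv a _ (coc_comp h a)).congr fun F hF => Set.indicator_of_mem hF _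
    rw [h0 x, h0 y]

theorem cob_of_smul {v : V →₀ ℕ} (hv : ∀ y : (localCohomology (maxIdeal k V) i).obj
      (ModuleCat.of (MvPolynomial V k) (MvPolynomial V k ⧸ idl k A)), monomial v (1 : k) • y = 0)
    {a : V → ℤ} {u : Finset V → k} (hu : Coc (dlt A a) i u) :
    Cob (dlt A (fun j => a j + v j)) i u := by
  obtain ⟨t₁, ht₁⟩ := exists_gam_eq A a
  obtain ⟨t₂, ht₂⟩ := exists_gam_eq A (fun j => a j + v j)
  have hg := ht₁ (max t₁ t₂) (le_max_left _ _)
  have hg₂ := ht₂ (max t₁ t₂) (le_max_right _ _)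
  have hc : IsCoc k (max t₁ t₂) i (coch (A := A) {a} (max t₁ t₂) fun _ => u) :=
    isCoc_coch _ _ _ _ fun a' ha' => by rw [Finset.mem_singleton.1 ha', hg]; exact hu
  have h0 := hv (cls hc)
  rw [← cls_smul, cls_eq_zero_iff_cob] at h0
  refine (h0 _).congr fun F hF => ?_
  rw [comp_smul _ _ _ _ (hg₂ ▸ hF)]
  have e : (fun j => (fun j => a j + (v j : ℤ)) j - (v j : ℤ)) = a := by funext j; simp
  rw [e, comp_coch_eq _ _ _ _ (Finset.mem_singleton_self a) (by rw [hg]; exact hu.1)]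

theorem surjective_of (hw : ∀ (a : V → ℤ) (u : Finset V → k), Coc (dlt A a) i u →
      ∃ w, Coc (gam A a 1) i w ∧ Cob (dlt A a) i (u - w)) :
    Function.Surjective (lam (maxIdeal k V) i
      (ModuleCat.of (MvPolynomial V k) (MvPolynomial V k ⧸ idl k A)) 1) := by
  intro y
  obtain ⟨t, c, h, rfl⟩ := exists_cls y
  refine (range_lam_one _).2 ?_
  obtain ⟨B, hB⟩ := exists_degrees t c
  choose w hw1 hw2 using fun a => hw a _ (coc_comp h a)
  refine ⟨coch B 1 w, isCoc_coch _ _ _ _ fun a _ => hw1 a, ?_⟩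
  refine cls_eq_of_cob _ _ fun a => ?_
  by_cases ha : a ∈ B
  · rw [comp_coch_eq _ _ _ _ ha (hw1 a).1]
    rw [← neg_sub]
    obtain ⟨ψ, h1, h2⟩ := hw2 a
    refine ⟨-ψ, fun F hF => by simp [h1 F hF], fun F hF hi => ?_⟩
    rw [dl_neg, h2 F hF hi]
    simp [Set.indicator_of_mem hF]
  · rw [comp_coch_of_notMem _ _ _ _ ha, hB a ha, sub_zero]
    exact cob_zero _ _

theorem van_of_eq {v : V →₀ ℕ} (hv : ∀ y : (localCohomology (maxIdeal k V) i).obj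
      (ModuleCat.of (MvPolynomial V k) (MvPolynomial V k ⧸ idl k A)), monomial v (1 : k) • y = 0)
    {a : V → ℤ} (h : dlt A (fun j => a j + v j) = dlt A a) : Van k (dlt A a) i :=
  fun _ hu => h ▸ cob_of_smul hv hu

omit [LinearOrder V] [Fintype V] in
lemma dlt_congr {a a' : V → ℤ} (h : ∀ j, a j = a' j ∨ (a j < 0 ∧ a' j < 0)) : dlt A a = dlt A a' := by
  have key : ∀ a a' : V → ℤ, (∀ j, a j = a' j ∨ (a j < 0 ∧ a' j < 0)) → dlt A a ⊆ dlt A a' := by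
    intro a a' h F hF
    have e : ∀ j ∉ F, a j = a' j := fun j hj => by
      have := hF.1 j hj; rcases h j with h | h <;> omega
    refine ⟨fun j hj => e j hj ▸ hF.1 j hj, fun s hs => ?_⟩
    obtain ⟨j, hj, hl⟩ := hF.2 s hs
    exact ⟨j, hj, e j hj ▸ hl⟩
  exact Set.Subset.antisymm (key a a' h) (key a' a fun j => by have := h j; omega)

theorem van_of_neg {j : V} {r : ℕ} (hv : ∀ y : (localCohomology (maxIdeal k V) i).obj
      (ModuleCat.of (MvPolynomial V k) (MvPolynomial V k ⧸ idl k A)), (X j ^ r : MvPolynomial V k) • y = 0)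
    {a : V → ℤ} (ha : a j < 0) : Van k (dlt A a) i := by
  rw [X_pow_eq_monomial] at hv
  have e : dlt A (fun l => a l - Finsupp.single j r l) = dlt A a := dlt_congr fun l => by
    by_cases hl : l = j
    · subst hl; right; simp; omega
    · left; simp [Ne.symm hl]
  rw [← e]
  refine van_of_eq hv ?_
  rw [e]
  congr 1
  funext l; ring

omit [Fintype V] in
lemma coch_add (B : Finset (V → ℤ)) (t : ℕ) (u u' : (V → ℤ) → Finset V → k) :
    coch (A := A) B t (u + u') = coch B t u + coch B t u' := by
  funext F; simp [coch, add_smul, Finset.sum_add_distrib]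

omit [Fintype V] in
lemma coch_smul (B : Finset (V → ℤ)) (t : ℕ) (r : k) (u : (V → ℤ) → Finset V → k) :
    coch (A := A) B t (r • u) = (C r : MvPolynomial V k) • coch B t u := by
  funext F
  rw [Pi.smul_apply, ← algebraMap_eq, algebraMap_smul]
  simp [coch, mul_smul, Finset.smul_sum]

theorem isFiniteLength_of_finite (hf : {a : V → ℤ | ¬ Van k (dlt A a) i}.Finite) :
    IsFiniteLength (MvPolynomial V k) ((localCohomology (maxIdeal k V) i).obj
      (ModuleCat.of (MvPolynomial V k) (MvPolynomial V k ⧸ idl k A))) := by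
  set H := (localCohomology (maxIdeal k V) i).obj
      (ModuleCat.of (MvPolynomial V k) (MvPolynomial V k ⧸ idl k A)) with hH
  let B := hf.toFinset
  choose T hT using exists_gam_eq A
  have hg : ∀ a ∈ B, gam A a (B.sup T) = dlt A a := fun a ha => hT a _ (Finset.le_sup ha)
  let _ : Module k H := Module.compHom H (algebraMap k (MvPolynomial V k))
  have : IsScalarTower k (MvPolynomial V k) H := IsScalarTower.of_algebraMap_smul fun _ _ => rfl
  let ex : (B → Finset V → k) → (V → ℤ) → Finset V → k := fun u a => if h : a ∈ B then u ⟨a, h⟩ else 0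
  let Z : Submodule k (B → Finset V → k) :=
    { carrier := {u | ∀ a : B, Coc (dlt A a.1) i (u a)}
      add_mem' := fun {u u'} hu hu' a => ⟨fun F hF => by simp [(hu a).1 F hF, (hu' a).1 F hF],
        fun F hF hi => by
          change dl (u a + u' a) F = 0
          rw [dl_add, (hu a).2 F hF hi, (hu' a).2 F hF hi, add_zero]⟩
      zero_mem' := fun a => ⟨fun _ _ => rfl, fun _ _ _ => by simp [dl]⟩
      smul_mem' := fun r u hu a => ⟨fun F hF => by simp [(hu a).1 F hF],
        fun F hF hi => by
          have h1 := (hu a).2 F hF hi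
          simp only [dl] at h1 ⊢
          have : ∀ j ∈ F, sg F j • (r • u) a (F.erase j) = r • (sg F j • u a (F.erase j)) :=
            fun j _ => smul_comm (sg F j) r (u a (F.erase j))
          rw [Finset.sum_congr rfl this, ← Finset.smul_sum, h1, smul_zero]⟩ }
  have hex : ∀ u a (h : a ∈ B), ex u a = u ⟨a, h⟩ := fun u a h => dif_pos h
  have hz : ∀ u : Z, IsCoc k (B.sup T) i (coch (A := A) B (B.sup T) (ex u.1)) := fun u =>
    isCoc_coch _ _ _ _ fun a ha => by rw [hg a ha, hex _ _ ha]; exact u.2 ⟨a, ha⟩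
  let Φ : Z →ₗ[k] H :=
    { toFun := fun u => cls (hz u)
      map_add' := fun u u' => by
        rw [← cls_add]
        refine cls_congr _ _ rfl ?_
        rw [← coch_add]
        congr 1
        funext a
        by_cases ha : a ∈ B <;> simp [ex, ha]
      map_smul' := fun r u => by
        change _ = (C r : MvPolynomial V k) • cls (hz u)
        rw [← cls_smul]
        refine cls_congr _ _ rfl ?_
        rw [← coch_smul]
        congr 1
        funext a
        by_cases ha : a ∈ B <;> simp [ex, ha] }
  have hΦ : ∀ u, Φ u = cls (hz u) := fun _ => rfl
  clear_value Φ
  have hsurj : Function.Surjective Φ := by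
    intro y
    obtain ⟨t, c, h, rfl⟩ := exists_cls y
    let u : Z := ⟨fun a => (dlt A a.1).indicator (comp a.1 t c), fun a => coc_comp h a.1⟩
    have hu : ∀ a (ha : a ∈ B), ex u.1 a = (dlt A a).indicator (comp a t c) := fun a ha => hex _ a ha
    refine ⟨u, (hΦ u).trans ?_⟩
    clear_value u ex Z
    refine cls_eq_of_cob (hz u) h fun a => ?_
    by_cases ha : a ∈ B
    · refine (cob_zero _ _).congr fun F hF => ?_
      rw [comp_coch_eq _ _ _ _ ha]
      · rw [hu _ ha]; simp [Set.indicator_of_mem hF]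
      · rw [hu _ ha, hg a ha]; exact fun F hF => Set.indicator_of_notMem hF _
    · rw [comp_coch_of_notMem _ _ _ _ ha, zero_sub]
      have hv : Van k (dlt A a) i := by
        by_contra hv; exact ha (hf.mem_toFinset.2 hv)
      obtain ⟨ψ, h1, h2⟩ := hv _ (coc_comp h a)
      refine ⟨-ψ, fun F hF => by simp [h1 F hF], fun F hF hi => ?_⟩
      rw [dl_neg, h2 F hF hi]
      simp [Set.indicator_of_mem hF]
  have : Module.Finite k H := Module.Finite.of_surjective Φ hsurj
  exact isFiniteLength_iff_isNoetherian_isArtinian.2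
    ⟨isNoetherian_of_tower k inferInstance, isArtinian_of_tower k inferInstance⟩

end
open Classical in
section
variable {V : Type} [LinearOrder V] {k : Type} [Field k] {Γ Γ₁ Γ₂ : Set (Finset V)} {i : ℕ}

/-- Convexity of a family with respect to inclusion. -/
def Cvx (Γ : Set (Finset V)) : Prop := ∀ F ∈ Γ, ∀ H ∈ Γ, ∀ G, F ⊆ G → G ⊆ H → G ∈ Γ

/-- A convex family is split into a lower part `Γ₁` and an upper part `Γ₂`. -/
structure Spl (Γ Γ₁ Γ₂ : Set (Finset V)) : Prop where
  cvx : Cvx Γ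
  eq : Γ = Γ₁ ∪ Γ₂
  not_le : ∀ F ∈ Γ₂, ∀ G ∈ Γ₁, ¬ F ⊆ G

lemma dl_congr {f g : Finset V → k} {F : Finset V} (h : ∀ j ∈ F, f (F.erase j) = g (F.erase j)) :
    dl f F = dl g F := Finset.sum_congr rfl fun j hj => by rw [h j hj]

lemma dl_eq_zero {f : Finset V → k} {F : Finset V} (h : ∀ j ∈ F, f (F.erase j) = 0) :
    dl f F = 0 := Finset.sum_eq_zero fun j hj => by rw [h j hj, smul_zero]

lemma Cvx.dl_eq_zero (hΓ : Cvx Γ) {ψ : Finset V → k} (hψ : ∀ F ∉ Γ, ψ F = 0) {G F : Finset V}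
    (hG : G ∉ Γ) (hF : F ∈ Γ) (h : G ⊆ F) : dl ψ G = 0 :=
  Mono.dl_eq_zero fun _ _ => hψ _ fun h' => hG (hΓ _ h' _ hF _ (Finset.erase_subset _ _) h)

omit [LinearOrder V] in
lemma Spl.mem_iff (h : Spl Γ Γ₁ Γ₂) {F : Finset V} : F ∈ Γ ↔ F ∈ Γ₁ ∨ F ∈ Γ₂ := by
  rw [h.eq]; rfl

omit [LinearOrder V] in
lemma Spl.notMem (h : Spl Γ Γ₁ Γ₂) {F : Finset V} (hF : F ∈ Γ₁) : F ∉ Γ₂ :=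
  fun h2 => h.not_le F h2 F hF subset_rfl

lemma Spl.dl_upper (h : Spl Γ Γ₁ Γ₂) {ψ : Finset V → k} (hψ : ∀ F ∉ Γ₂, ψ F = 0) {F : Finset V}
    (hF : F ∈ Γ₁) : dl ψ F = 0 :=
  Mono.dl_eq_zero fun _ _ => hψ _ fun h' => h.not_le _ h' _ hF (Finset.erase_subset _ _)

theorem Spl.van (h : Spl Γ Γ₁ Γ₂) (h1 : Van k Γ₁ i) (h2 : Van k Γ₂ i) : Van k Γ i := by
  intro u hu
  have c1 : Coc Γ₁ i (Γ₁.indicator u) := by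
    refine ⟨fun F hF => Set.indicator_of_notMem hF _, fun F hF hi => ?_⟩
    rw [← hu.2 F (h.mem_iff.2 (Or.inl hF)) hi]
    refine dl_congr fun j hj => ?_
    by_cases hj1 : F.erase j ∈ Γ₁
    · exact Set.indicator_of_mem hj1 _
    · rw [Set.indicator_of_notMem hj1, hu.1]
      intro h'
      rcases h.mem_iff.1 h' with h' | h'
      · exact hj1 h'
      · exact h.not_le _ h' _ hF (Finset.erase_subset _ _)
  obtain ⟨ψ₁, hs1, hd1⟩ := h1 _ c1
  have hs1' : ∀ F ∉ Γ, ψ₁ F = 0 := fun F hF => hs1 F fun h' => hF (h.mem_iff.2 (Or.inl h'))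
  have c2 : Coc Γ₂ i (Γ₂.indicator (u - dl ψ₁)) := by
    refine ⟨fun F hF => Set.indicator_of_notMem hF _, fun F hF hi => ?_⟩
    have hFΓ : F ∈ Γ := h.mem_iff.2 (Or.inr hF)
    have : dl (u - dl ψ₁) F = 0 := by
      rw [dl_sub, dl_dl, hu.2 F hFΓ hi]; simp
    rw [← this]
    refine dl_congr fun j hj => ?_
    have hc : (F.erase j).card = i := by rw [Finset.card_erase_of_mem hj, hi]; rfl
    by_cases hj2 : F.erase j ∈ Γ₂
    · exact Set.indicator_of_mem hj2 _
    · rw [Set.indicator_of_notMem hj2, Pi.sub_apply]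
      by_cases hj1 : F.erase j ∈ Γ₁
      · rw [hd1 _ hj1 hc, Set.indicator_of_mem hj1, sub_self]
      · have hj0 : F.erase j ∉ Γ := fun h' => (h.mem_iff.1 h').elim hj1 hj2
        rw [hu.1 _ hj0, h.cvx.dl_eq_zero hs1' hj0 hFΓ (Finset.erase_subset _ _), sub_zero]
  obtain ⟨ψ₂, hs2, hd2⟩ := h2 _ c2
  refine ⟨ψ₁ + ψ₂, fun F hF => ?_, fun F hF hi => ?_⟩
  · rw [Pi.add_apply, hs1' F hF, hs2 F fun h' => hF (h.mem_iff.2 (Or.inr h')), add_zero]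
  · rw [dl_add]
    rcases h.mem_iff.1 hF with hF1 | hF2
    · rw [hd1 _ hF1 hi, h.dl_upper hs2 hF1, Set.indicator_of_mem hF1, add_zero]
    · rw [hd2 _ hF2 hi, Set.indicator_of_mem hF2]; simp

theorem Spl.van_lower (h : Spl Γ Γ₁ Γ₂) (h0 : Van k Γ i) (h2 : Van k Γ₂ (i + 1)) : Van k Γ₁ i := by
  intro u hu
  have hu0 : ∀ F ∉ Γ, u F = 0 := fun F hF => hu.1 F fun h' => hF (h.mem_iff.2 (Or.inl h'))
  have c2 : Coc Γ₂ (i + 1) (Γ₂.indicator (dl u)) := by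
    refine ⟨fun F hF => Set.indicator_of_notMem hF _, fun F hF hi => ?_⟩
    have hFΓ : F ∈ Γ := h.mem_iff.2 (Or.inr hF)
    have : dl (dl u) F = 0 := by rw [dl_dl]; rfl
    rw [← this]
    refine dl_congr fun j hj => ?_
    have hc : (F.erase j).card = i + 1 := by rw [Finset.card_erase_of_mem hj, hi]; rfl
    by_cases hj2 : F.erase j ∈ Γ₂
    · exact Set.indicator_of_mem hj2 _
    · rw [Set.indicator_of_notMem hj2]
      by_cases hj1 : F.erase j ∈ Γ₁
      · rw [hu.2 _ hj1 hc]
      · have hj0 : F.erase j ∉ Γ := fun h' => (h.mem_iff.1 h').elim hj1 hj2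
        rw [h.cvx.dl_eq_zero hu0 hj0 hFΓ (Finset.erase_subset _ _)]
  obtain ⟨ψ₂, hs2, hd2⟩ := h2 _ c2
  have c0 : Coc Γ i (u - ψ₂) := by
    refine ⟨fun F hF => ?_, fun F hF hi => ?_⟩
    · rw [Pi.sub_apply, hu0 F hF, hs2 F fun h' => hF (h.mem_iff.2 (Or.inr h')), sub_zero]
    · rw [dl_sub]
      rcases h.mem_iff.1 hF with hF1 | hF2
      · rw [hu.2 F hF1 hi, h.dl_upper hs2 hF1, sub_zero]
      · rw [hd2 F hF2 hi, Set.indicator_of_mem hF2, sub_self]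
  obtain ⟨ψ, hs, hd⟩ := h0 _ c0
  refine ⟨Γ₁.indicator ψ, fun F hF => Set.indicator_of_notMem hF _, fun F hF hi => ?_⟩
  have := hd F (h.mem_iff.2 (Or.inl hF)) hi
  rw [Pi.sub_apply, hs2 F (h.notMem hF), sub_zero] at this
  rw [← this]
  refine dl_congr fun j hj => ?_
  by_cases hj1 : F.erase j ∈ Γ₁
  · exact Set.indicator_of_mem hj1 _
  · rw [Set.indicator_of_notMem hj1, hs]
    intro h'
    rcases h.mem_iff.1 h' with h' | h'
    · exact hj1 h'
    · exact h.not_le _ h' _ hF (Finset.erase_subset _ _)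

lemma Spl.coc_upper (h : Spl Γ Γ₁ Γ₂) {u : Finset V → k} (hu : Coc Γ₂ i u) : Coc Γ i u := by
  refine ⟨fun F hF => hu.1 F fun h' => hF (h.mem_iff.2 (Or.inr h')), fun F hF hi => ?_⟩
  rcases h.mem_iff.1 hF with hF1 | hF2
  · exact h.dl_upper hu.1 hF1
  · exact hu.2 F hF2 hi

theorem Spl.van_upper (h : Spl Γ Γ₁ Γ₂) (h0 : Van k Γ (i + 1)) (h1 : Van k Γ₁ i) : Van k Γ₂ (i + 1) := by
  intro u hu
  obtain ⟨ψ, hs, hd⟩ := h0 _ (h.coc_upper hu)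
  have c1 : Coc Γ₁ i (Γ₁.indicator ψ) := by
    refine ⟨fun F hF => Set.indicator_of_notMem hF _, fun F hF hi => ?_⟩
    rw [← hu.1 F (h.notMem hF), ← hd F (h.mem_iff.2 (Or.inl hF)) hi]
    refine dl_congr fun j hj => ?_
    by_cases hj1 : F.erase j ∈ Γ₁
    · exact Set.indicator_of_mem hj1 _
    · rw [Set.indicator_of_notMem hj1, hs]
      intro h'
      rcases h.mem_iff.1 h' with h' | h'
      · exact hj1 h'
      · exact h.not_le _ h' _ hF (Finset.erase_subset _ _)
  obtain ⟨φ, hs1, hd1⟩ := h1 _ c1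
  have hs1' : ∀ F ∉ Γ, φ F = 0 := fun F hF => hs1 F fun h' => hF (h.mem_iff.2 (Or.inl h'))
  refine ⟨Γ₂.indicator (ψ - dl φ), fun F hF => Set.indicator_of_notMem hF _, fun F hF hi => ?_⟩
  have hFΓ : F ∈ Γ := h.mem_iff.2 (Or.inr hF)
  have : dl (ψ - dl φ) F = u F := by rw [dl_sub, dl_dl, hd F hFΓ hi]; simp
  rw [← this]
  refine dl_congr fun j hj => ?_
  have hc : (F.erase j).card = i := by rw [Finset.card_erase_of_mem hj, hi]; rfl
  by_cases hj2 : F.erase j ∈ Γ₂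
  · exact Set.indicator_of_mem hj2 _
  · rw [Set.indicator_of_notMem hj2, Pi.sub_apply]
    by_cases hj1 : F.erase j ∈ Γ₁
    · rw [hd1 _ hj1 hc, Set.indicator_of_mem hj1, sub_self]
    · have hj0 : F.erase j ∉ Γ := fun h' => (h.mem_iff.1 h').elim hj1 hj2
      rw [hs _ hj0, h.cvx.dl_eq_zero hs1' hj0 hFΓ (Finset.erase_subset _ _), sub_zero]

theorem Spl.van_upper_zero (h : Spl Γ Γ₁ Γ₂) (h0 : Van k Γ 0) : Van k Γ₂ 0 := by
  intro u hu
  obtain ⟨ψ, hs, hd⟩ := h0 _ (h.coc_upper hu)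
  refine ⟨0, fun _ _ => rfl, fun F hF hi => ?_⟩
  rw [← hd F (h.mem_iff.2 (Or.inr hF)) hi, Finset.card_eq_zero.1 hi]
  simp [dl]

/-- The family is a cone. -/
def IsCone (Γ : Set (Finset V)) : Prop := ∃ v, ∀ F, v ∉ F → (insert v F ∈ Γ ↔ F ∈ Γ)

theorem IsCone.van (h : IsCone Γ) (i : ℕ) : Van k Γ i := by
  obtain ⟨v, hv⟩ := h
  intro u hu
  refine ⟨fun G => if v ∈ G then 0 else sg (insert v G) v • u (insert v G), fun F hF => ?_, fun F hF hi => ?_⟩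
  · by_cases h : v ∈ F
    · exact if_pos h
    · beta_reduce
      rw [if_neg h, hu.1 _ (fun h' => hF ((hv F h).1 h')), smul_zero]
  · rw [dl_eq_cobd, cobd_contract, one_smul]
    intro h
    rw [← dl_eq_cobd]
    exact hu.2 _ ((hv F h).2 hF) (by rw [Finset.card_insert_of_notMem h, hi])

theorem van_empty (i : ℕ) : Van k (∅ : Set (Finset V)) i :=
  fun _ _ => ⟨0, fun _ _ => rfl, fun _ h => absurd h (Set.notMem_empty _)⟩

theorem Spl.van_lower_iff (h : Spl Γ Γ₁ Γ₂) (h0 : ∀ i, Van k Γ i) : Van k Γ₁ i ↔ Van k Γ₂ (i + 1) :=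
  ⟨fun h1 => h.van_upper (h0 _) h1, fun h2 => h.van_lower (h0 _) h2⟩

theorem van_singleton_iff {N : Finset V} : Van k {N} i ↔ i ≠ N.card := by
  constructor
  · rintro h rfl
    obtain ⟨ψ, hs, hd⟩ := h (fun F => if F = N then 1 else 0)
      ⟨fun F hF => if_neg hF, fun F hF hi => by rw [Set.mem_singleton_iff.1 hF] at hi; omega⟩
    have := hd N rfl rfl
    beta_reduce at this
    rw [if_pos rfl, dl_eq_zero] at this
    · exact zero_ne_one this
    · exact fun j hj => hs _ fun h => Finset.erase_ne_self.2 hj h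
  · intro h u _
    exact ⟨0, fun _ _ => rfl, fun F hF hi => absurd hi (by rw [Set.mem_singleton_iff.1 hF]; exact h.symm)⟩

end

section
variable {V : Type} (G : SimpleGraph V)

/-- The independent sets containing `N` and avoiding `T`. -/
def Fam (N : Finset V) (T : Set V) : Set (Finset V) :=
  {F | F ∈ indepComplex G ∧ N ⊆ F ∧ ∀ x ∈ F, x ∉ T}

variable {G} {N : Finset V} {T : Set V}

lemma indep_mono {F F' : Finset V} (h : F ∈ indepComplex G) (h' : F' ⊆ F) : F' ∈ indepComplex G :=
  fun i hi j hj => h i (h' hi) j (h' hj)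

lemma indep_insert [DecidableEq V] {F : Finset V} {v : V} :
    insert v F ∈ indepComplex G ↔ F ∈ indepComplex G ∧ ∀ w ∈ F, ¬ G.Adj v w := by
  constructor
  · exact fun h => ⟨indep_mono h (Finset.subset_insert _ _),
      fun w hw => h v (Finset.mem_insert_self _ _) w (Finset.mem_insert_of_mem hw)⟩
  · rintro ⟨h1, h2⟩ i hi j hj hij
    rcases Finset.mem_insert.1 hi with hi' | hi'
    · rcases Finset.mem_insert.1 hj with hj' | hj'
      · exact hij.ne (hi'.trans hj'.symm)
      · exact h2 j hj' (hi' ▸ hij)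
    · rcases Finset.mem_insert.1 hj with hj' | hj'
      · exact h2 i hi' (hj' ▸ hij.symm)
      · exact h1 i hi' j hj' hij

lemma empty_mem_indep : ∅ ∈ indepComplex G := fun i hi => absurd hi (Finset.notMem_empty i)

lemma Fam_cvx : Cvx (Fam G N T) := fun _ hF _ hH _ h1 h2 =>
  ⟨indep_mono hH.1 h2, hF.2.1.trans h1, fun x hx => hH.2.2 x (h2 hx)⟩

lemma Fam_congr {T' : Set V} (h : ∀ w, (∀ x ∈ N, ¬ G.Adj x w) → (w ∈ T ↔ w ∈ T')) :
    Fam G N T = Fam G N T' := by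
  ext F
  refine and_congr_right fun h1 => and_congr_right fun h2 => forall₂_congr fun x hx => not_congr (h x fun y hy => h1 y (h2 hy) x hx)

lemma Fam_eq_singleton (hN : N ∈ indepComplex G) (hT : ∀ x ∈ N, x ∉ T)
    (h : ∀ w ∉ N, w ∉ T → ∃ x ∈ N, G.Adj x w) : Fam G N T = {N} := by
  ext F
  constructor
  · rintro ⟨h1, h2, h3⟩
    refine (Finset.Subset.antisymm h2 fun w hw => ?_).symm
    by_contra hwN
    obtain ⟨x, hx, hxw⟩ := h w hwN (h3 w hw)
    exact h1 x (h2 hx) w hw hxw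
  · rintro rfl
    exact ⟨hN, subset_rfl, hT⟩

lemma Fam_eq_empty (h : N ∉ indepComplex G ∨ ∃ x ∈ N, x ∈ T) : Fam G N T = ∅ := by
  refine Set.eq_empty_of_forall_notMem fun F hF => ?_
  rcases h with h | ⟨x, hx, hxT⟩
  · exact h (indep_mono hF.1 hF.2.1)
  · exact hF.2.2 x (hF.2.1 hx) hxT

end

section
variable {V : Type} [LinearOrder V] {k : Type} [Field k] {G : SimpleGraph V} {N : Finset V} {T : Set V} {i : ℕ}

lemma Fam_spl (v : V) : Spl (Fam G N T) (Fam G N (insert v T)) (Fam G (insert v N) T) where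
  cvx := Fam_cvx
  eq := by
    ext F
    by_cases hv : v ∈ F
    · constructor
      · exact fun h => Or.inr ⟨h.1, Finset.insert_subset hv h.2.1, h.2.2⟩
      · rintro (h | h)
        · exact absurd (Set.mem_insert _ _) (h.2.2 v hv)
        · exact ⟨h.1, (Finset.subset_insert _ _).trans h.2.1, h.2.2⟩
    · constructor
      · exact fun h => Or.inl ⟨h.1, h.2.1, fun x hx hxT => (Set.mem_insert_iff.1 hxT).elim
          (fun e => hv (e ▸ hx)) (h.2.2 x hx)⟩
      · rintro (h | h)
        · exact ⟨h.1, h.2.1, fun x hx hxT => h.2.2 x hx (Set.mem_insert_of_mem _ hxT)⟩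
        · exact absurd (h.2.1 (Finset.mem_insert_self _ _)) hv
  not_le F hF H hH h := hH.2.2 v (h (hF.2.1 (Finset.mem_insert_self _ _))) (Set.mem_insert _ _)

lemma Fam_cone {v : V} (hN : v ∉ N) (hT : v ∉ T) (h : ∀ w, G.Adj v w → w ∈ T ∨ ∃ x ∈ N, G.Adj x w) :
    IsCone (Fam G N T) := by
  refine ⟨v, fun F hv => ⟨fun hF => ⟨indep_mono hF.1 (Finset.subset_insert _ _), ?_, ?_⟩,
    fun hF => ⟨indep_insert.2 ⟨hF.1, fun w hw hvw => ?_⟩, hF.2.1.trans (Finset.subset_insert _ _), ?_⟩⟩⟩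
  · intro x hx
    exact (Finset.mem_insert.1 (hF.2.1 hx)).resolve_left fun e => hN (e ▸ hx)
  · exact fun x hx => hF.2.2 x (Finset.mem_insert_of_mem hx)
  · rcases h w hvw with h | ⟨x, hx, hxw⟩
    · exact hF.2.2 w hw h
    · exact hF.1 x (hF.2.1 hx) w hw hxw
  · intro x hx
    rcases Finset.mem_insert.1 hx with rfl | hx
    · exact hT
    · exact hF.2.2 x hx

end

section
variable {W V : Type} [LinearOrder W] [LinearOrder V] {k : Type} [Field k] {i : ℕ}

lemma sg_map (e : W ↪o V) (F : Finset W) (j : W) : sg (F.map e.toEmbedding) (e j) = sg F j := by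
  unfold sg
  congr 1
  rw [Finset.filter_map, Finset.card_map]
  congr 1
  ext x; simp

lemma dl_map (e : W ↪o V) (u : Finset V → k) (F : Finset W) :
    dl u (F.map e.toEmbedding) = dl (fun H => u (H.map e.toEmbedding)) F := by
  unfold dl
  rw [Finset.sum_map]
  refine Finset.sum_congr rfl fun j _ => ?_
  have h : (F.map e.toEmbedding).erase (e.toEmbedding j) = (F.erase j).map e.toEmbedding := by
    ext x
    simp only [Finset.mem_erase, Finset.mem_map]
    constructor
    · rintro ⟨hx, y, hy, rfl⟩
      exact ⟨y, ⟨fun h => hx (h ▸ rfl), hy⟩, rfl⟩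
    · rintro ⟨y, ⟨hy, hyF⟩, rfl⟩
      exact ⟨fun h => hy (e.injective h), y, hyF, rfl⟩
  rw [h]
  congr 1
  exact sg_map e F j

theorem van_map (e : W ↪o V) (Γ : Set (Finset W)) :
    Van k (Finset.map e.toEmbedding '' Γ) i ↔ Van k Γ i := by
  have inj : Function.Injective (Finset.map e.toEmbedding) := Finset.map_injective _
  have hext : ∀ (u : Finset W → k), (∀ F ∉ Γ, u F = 0) →
      ∀ F ∉ Finset.map e.toEmbedding '' Γ, Function.extend (Finset.map e.toEmbedding) u 0 F = 0 := by
    intro u hu F hF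
    by_cases h : ∃ H : Finset W, H.map e.toEmbedding = F
    · obtain ⟨H, rfl⟩ := h
      rw [inj.extend_apply]
      exact hu _ fun h => hF ⟨H, h, rfl⟩
    · rw [Function.extend_apply' _ _ _ h]; rfl
  have hcomp : ∀ (u : Finset W → k), (fun H : Finset W => Function.extend (Finset.map e.toEmbedding) u 0 (H.map e.toEmbedding)) = u :=
    fun u => funext fun H => inj.extend_apply _ _ _
  constructor
  · intro h u hu
    obtain ⟨ψ, hs, hd⟩ := h (Function.extend (Finset.map e.toEmbedding) u 0) ⟨hext u hu.1, by
      rintro _ ⟨F, hF, rfl⟩ hi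
      rw [dl_map, hcomp]
      exact hu.2 F hF (by rwa [Finset.card_map] at hi)⟩
    refine ⟨fun H => ψ (H.map e.toEmbedding), fun F hF => hs _ ?_, fun F hF hi => ?_⟩
    · rintro ⟨H, hH, e⟩; exact hF (inj e ▸ hH)
    · rw [← dl_map, hd _ ⟨F, hF, rfl⟩ (by rwa [Finset.card_map]), inj.extend_apply]
  · intro h u hu
    obtain ⟨ψ, hs, hd⟩ := h (fun H => u (H.map e.toEmbedding)) ⟨fun F hF => hu.1 _ (by
        rintro ⟨H, hH, e⟩; exact hF (inj e ▸ hH)), fun F hF hi => by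
      rw [← dl_map]; exact hu.2 _ ⟨F, hF, rfl⟩ (by rwa [Finset.card_map])⟩
    refine ⟨Function.extend (Finset.map e.toEmbedding) ψ 0, hext ψ hs, ?_⟩
    rintro _ ⟨F, hF, rfl⟩ hi
    rw [dl_map, hcomp]
    exact hd F hF (by rwa [Finset.card_map] at hi)

end

section
variable {V : Type} [LinearOrder V] {k : Type} [Field k] {G : SimpleGraph V} {i : ℕ}

omit [LinearOrder V] in
lemma map_mem_indep {s : Set V} {F : Finset s} :
    F.map (Function.Embedding.subtype _) ∈ indepComplex G ↔ F ∈ indepComplex (G.induce s) := by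
  constructor
  · intro h i hi j hj hij
    exact h i (Finset.mem_map_of_mem _ hi) j (Finset.mem_map_of_mem _ hj) hij
  · intro h i hi j hj hij
    obtain ⟨a, ha, rfl⟩ := Finset.mem_map.1 hi
    obtain ⟨b, hb, rfl⟩ := Finset.mem_map.1 hj
    exact h a ha b hb hij

omit [LinearOrder V] in
lemma exists_map_eq {s : Set V} {F : Finset V} (h : ∀ x ∈ F, x ∈ s) :
    ∃ F' : Finset s, F'.map (Function.Embedding.subtype _) = F := by
  classical
  refine ⟨F.subtype (· ∈ s), ?_⟩
  rw [Finset.subtype_map]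
  exact Finset.filter_true_of_mem h

omit [LinearOrder V] in
theorem image_Fam_induce (s : Set V) (N : Finset s) (T : Set s) :
    Finset.map (Function.Embedding.subtype _) '' Fam (G.induce s) N T =
      Fam G (N.map (Function.Embedding.subtype _)) (sᶜ ∪ Subtype.val '' T) := by
  ext F
  constructor
  · rintro ⟨F, hF, rfl⟩
    refine ⟨map_mem_indep.2 hF.1, Finset.map_subset_map.2 hF.2.1, ?_⟩
    intro x hx
    obtain ⟨a, ha, rfl⟩ := Finset.mem_map.1 hx
    rintro (h | ⟨b, hb, e⟩)
    · exact h a.2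
    · exact hF.2.2 a ha (Subtype.ext e ▸ hb)
  · intro hF
    obtain ⟨F, rfl⟩ := exists_map_eq (s := s) (F := F) fun x hx => by
      by_contra h; exact hF.2.2 x hx (Or.inl h)
    refine ⟨F, ⟨map_mem_indep.1 hF.1, Finset.map_subset_map.1 hF.2.1, fun x hx hT => ?_⟩, rfl⟩
    exact hF.2.2 _ (Finset.mem_map_of_mem _ hx) (Or.inr ⟨x, hT, rfl⟩)

theorem van_induce (s : Set V) (N : Finset s) (T : Set s) :
    Van k (Fam (G.induce s) N T) i ↔
      Van k (Fam G (N.map (Function.Embedding.subtype _)) (sᶜ ∪ Subtype.val '' T)) i := by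
  rw [← image_Fam_induce]
  exact (van_map (OrderEmbedding.subtype (· ∈ s)) _).symm

/-- Passing from the independent sets of a link to those containing the vertex. -/
theorem van_insert_iff {v : V} {N : Finset V} {T : Set V} (hN : v ∉ N) (hT : v ∉ T)
    (h : ∀ w, G.Adj v w → w ∈ T ∨ ∃ x ∈ N, G.Adj x w) :
    Van k (Fam G N (insert v T)) i ↔ Van k (Fam G (insert v N) T) (i + 1) :=
  (Fam_spl v).van_lower_iff (Fam_cone hN hT h).van

end

section
variable {V : Type} (G : SimpleGraph V)

/-- Exponents of the generators of the edge ideal. -/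
def A1 : Set (V →₀ ℕ) := {s | ∃ p q, G.Adj p q ∧ s = Finsupp.single p 1 + Finsupp.single q 1}

/-- Exponents of the generators of the square of the edge ideal. -/
def A2 : Set (V →₀ ℕ) := {s | ∃ p q r t, G.Adj p q ∧ G.Adj r t ∧
  s = (Finsupp.single p 1 + Finsupp.single q 1) + (Finsupp.single r 1 + Finsupp.single t 1)}

/-- Two edges inside `F ∪ B` meeting only inside `F`. -/
def Bad (F : Finset V) (B : Set V) : Prop := ∃ p q r t, G.Adj p q ∧ G.Adj r t ∧
  (p ∈ F ∨ p ∈ B) ∧ (q ∈ F ∨ q ∈ B) ∧ (r ∈ F ∨ r ∈ B) ∧ (t ∈ F ∨ t ∈ B) ∧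
  (p = r → p ∈ F) ∧ (p = t → p ∈ F) ∧ (q = r → q ∈ F) ∧ (q = t → q ∈ F)

/-- The squarefree degree complexes of the square of the edge ideal. -/
def Sq (N : Finset V) (B : Set V) : Set (Finset V) := {F | N ⊆ F ∧ ¬ Bad G F B}

variable {G}

lemma A2_le_two {s : V →₀ ℕ} (hs : s ∈ A2 G) (v : V) : s v ≤ 2 := by
  classical
  obtain ⟨p, q, r, t, h, h', rfl⟩ := hs
  have h1 := h.ne
  have h2 := h'.ne
  simp only [Finsupp.add_apply, Finsupp.single_apply]
  split_ifs <;> subst_vars <;> simp_all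

lemma mem_dlt1 {a : V → ℤ} {F : Finset V} : F ∈ dlt (A1 G) a ↔ (∀ j ∉ F, 0 ≤ a j) ∧
    ∀ p q, G.Adj p q → ¬ ((p ∈ F ∨ 1 ≤ a p) ∧ (q ∈ F ∨ 1 ≤ a q)) := by
  classical
  refine and_congr_right fun h0 => ⟨?_, ?_⟩
  · intro h p q hpq ⟨hp, hq⟩
    obtain ⟨j, hj, hl⟩ := h _ ⟨p, q, hpq, rfl⟩
    have hne := hpq.ne
    have := h0 j hj
    simp only [Finsupp.add_apply, Finsupp.single_apply] at hl
    have ep : p = j → 1 ≤ a j := fun e => e ▸ hp.resolve_left (e ▸ hj)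
    have eq : q = j → 1 ≤ a j := fun e => e ▸ hq.resolve_left (e ▸ hj)
    grind
  · rintro h s ⟨p, q, hpq, rfl⟩
    by_contra hc
    push Not at hc
    have hne := hpq.ne
    refine h p q hpq ⟨?_, ?_⟩
    · by_contra hp
      push Not at hp
      have := hc p hp.1
      simp [hne.symm] at this; omega
    · by_contra hp
      push Not at hp
      have := hc q hp.1
      simp [hne] at this; omega

lemma dlt2_eq {a : V → ℤ} (ha : ∀ j, a j ≤ 1) {N : Finset V} (hN : ∀ j, j ∈ N ↔ a j < 0) :
    dlt (A2 G) a = Sq G N {j | a j = 1} := by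
  classical
  ext F
  have h0 : (∀ j ∉ F, 0 ≤ a j) ↔ N ⊆ F := by
    constructor
    · intro h j hj
      by_contra hF
      have := h j hF
      have := (hN j).1 hj
      omega
    · intro h j hj
      by_contra hc
      exact hj (h ((hN j).2 (by omega)))
  refine (and_congr_left' h0).trans (and_congr_right fun hNF => ⟨?_, ?_⟩)
  · rintro h ⟨p, q, r, t, hpq, hrt, hp, hq, hr, ht, h1, h2, h3, h4⟩
    obtain ⟨j, hj, hl⟩ := h _ ⟨p, q, r, t, hpq, hrt, rfl⟩
    have hne := hpq.ne
    have hne' := hrt.ne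
    have := h0.2 hNF j hj
    simp only [Set.mem_ofPred_eq] at hp hq hr ht
    have ep : p = j → a j = 1 := fun e => e ▸ hp.resolve_left (e ▸ hj)
    have eq : q = j → a j = 1 := fun e => e ▸ hq.resolve_left (e ▸ hj)
    have er : r = j → a j = 1 := fun e => e ▸ hr.resolve_left (e ▸ hj)
    have et : t = j → a j = 1 := fun e => e ▸ ht.resolve_left (e ▸ hj)
    simp only [Finsupp.add_apply, Finsupp.single_apply] at hl
    grind
  · rintro h s ⟨p, q, r, t, hpq, hrt, rfl⟩
    by_contra hc
    push Not at hc
    have hne := hpq.ne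
    have hne' := hrt.ne
    have key : ∀ j, j ∉ F → (((if p = j then 1 else 0) + if q = j then 1 else 0) +
        ((if r = j then 1 else 0) + if t = j then 1 else 0) : ℤ) ≤ a j := by
      intro j hj
      have := hc j hj
      simp only [Finsupp.add_apply, Finsupp.single_apply] at this
      push_cast at this
      exact this
    refine h ⟨p, q, r, t, hpq, hrt, ?_⟩
    have kp := key p
    have kq := key q
    have kr := key r
    have kt := key t
    have := ha p
    have := ha q
    have := ha r
    have := ha t
    simp only [Set.mem_ofPred_eq]
    grind

lemma dlt2_cone [DecidableEq V] {a : V → ℤ} {v : V} (hv : 2 ≤ a v) :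
    ∀ F, v ∉ F → (insert v F ∈ dlt (A2 G) a ↔ F ∈ dlt (A2 G) a) := by
  intro F hF
  constructor
  · rintro ⟨h1, h2⟩
    refine ⟨fun j hj => ?_, fun s hs => ?_⟩
    · by_cases e : j = v
      · subst e; omega
      · exact h1 j (by simp [e, hj])
    · obtain ⟨j, hj, hl⟩ := h2 s hs
      exact ⟨j, fun h => hj (Finset.mem_insert_of_mem h), hl⟩
  · rintro ⟨h1, h2⟩
    refine ⟨fun j hj => h1 j fun h => hj (Finset.mem_insert_of_mem h), fun s hs => ?_⟩
    obtain ⟨j, hj, hl⟩ := h2 s hs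
    refine ⟨j, fun h => ?_, hl⟩
    rcases Finset.mem_insert.1 h with e | h
    · subst e
      have := A2_le_two hs j
      omega
    · exact hj h

end

section
variable {V : Type} {G : SimpleGraph V} {N : Finset V} {B : Set V}

lemma Bad.mono {F F' : Finset V} (h : Bad G F B) (hF : F ⊆ F') : Bad G F' B := by
  obtain ⟨p, q, r, t, hpq, hrt, hp, hq, hr, ht, h1, h2, h3, h4⟩ := h
  exact ⟨p, q, r, t, hpq, hrt, hp.imp_left (@hF _), hq.imp_left (@hF _), hr.imp_left (@hF _),
    ht.imp_left (@hF _), fun e => hF (h1 e), fun e => hF (h2 e), fun e => hF (h3 e),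
    fun e => hF (h4 e)⟩

lemma bad_of_not_indep {F : Finset V} (h : F ∉ indepComplex G) : Bad G F B := by
  simp only [indepComplex, Set.mem_ofPred_eq, not_forall, not_not] at h
  obtain ⟨p, hp, q, hq, hpq⟩ := h
  exact ⟨p, q, p, q, hpq, hpq, .inl hp, .inl hq, .inl hp, .inl hq, fun _ => hp, fun _ => hp,
    fun _ => hq, fun _ => hq⟩

lemma bad_of_two {F : Finset V} {x x' y y' : V} (hx : x ∈ B) (hx' : x' ∈ B) (hxx : x ≠ x')
    (hy : y ∈ F) (hy' : y' ∈ F) (h : G.Adj x y) (h' : G.Adj x' y') : Bad G F B :=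
  ⟨x, y, x', y', h, h', .inr hx, .inl hy, .inr hx', .inl hy', fun e => absurd e hxx,
    fun e => e ▸ hy', fun _ => hy, fun _ => hy⟩

lemma bad_of_disjoint {F : Finset V} {p q r t : V} (hpq : G.Adj p q) (hrt : G.Adj r t)
    (hp : p ∈ F ∨ p ∈ B) (hq : q ∈ B) (hr : r ∈ B) (ht : t ∈ B)
    (h1 : p ∈ F ∨ p ≠ r) (h2 : p ∈ F ∨ p ≠ t) (h3 : q ≠ r) (h4 : q ≠ t) : Bad G F B :=
  ⟨p, q, r, t, hpq, hrt, hp, .inr hq, .inr hr, .inr ht,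
    fun e => h1.resolve_right (not_not.2 e), fun e => h2.resolve_right (not_not.2 e),
    fun e => absurd e h3, fun e => absurd e h4⟩

lemma Sq_indep {F : Finset V} (h : F ∈ Sq G N B) : F ∈ indepComplex G := by
  by_contra hc
  exact h.2 (bad_of_not_indep hc)

lemma Sq_cvx : Cvx (Sq G N B) := fun _ hF _ hH _ h1 h2 => ⟨hF.1.trans h1, fun h => hH.2 (h.mono h2)⟩

lemma Sq_empty (h : Bad G N B) : Sq G N B = ∅ :=
  Set.eq_empty_of_forall_notMem fun _ hF => hF.2 (h.mono hF.1)

lemma Sq_subsingleton (h : ∀ x ∈ B, ∀ y ∈ B, x = y) : Sq G N B = Fam G N ∅ := by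
  ext F
  refine ⟨fun hF => ⟨Sq_indep hF, hF.1, fun _ _ => id⟩, fun hF => ⟨hF.2.1, ?_⟩⟩
  have hi := hF.1
  simp only [indepComplex, Set.mem_ofPred_eq] at hi
  rintro ⟨p, q, r, t, hpq, hrt, hp, hq, hr, ht, h1, h2, h3, h4⟩
  have := hpq.ne
  have := hrt.ne
  grind

lemma bad_insert [DecidableEq V] {F : Finset V} {z : V} (hz : z ∈ B) (h : Bad G (insert z F) B) :
    Bad G F B ∨ ∃ u v, G.Adj z u ∧ G.Adj z v ∧ (u ∈ F ∨ u ∈ B) ∧ (v ∈ F ∨ v ∈ B) ∧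
      (u = v → u ∈ F) := by
  obtain ⟨p, q, r, t, hpq, hrt, hp, hq, hr, ht, h1, h2, h3, h4⟩ := h
  have := hpq.ne
  have := hrt.ne
  have e1 := hpq.symm
  have e2 := hrt.symm
  by_cases hb : Bad G F B
  · exact .inl hb
  right
  have h0 : ¬ ((p = r → p ∈ F) ∧ (p = t → p ∈ F) ∧ (q = r → q ∈ F) ∧ (q = t → q ∈ F)) :=
    fun h => hb ⟨p, q, r, t, hpq, hrt, by grind, by grind, by grind, by grind, h⟩
  simp only [Finset.mem_insert] at h1 h2 h3 h4 hp hq hr ht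
  by_cases c1 : p = r ∧ p ∉ F
  · exact ⟨q, t, by grind, by grind, by grind, by grind, by grind⟩
  by_cases c2 : p = t ∧ p ∉ F
  · exact ⟨q, r, by grind, by grind, by grind, by grind, by grind⟩
  by_cases c3 : q = r ∧ q ∉ F
  · exact ⟨p, t, by grind, by grind, by grind, by grind, by grind⟩
  by_cases c4 : q = t ∧ q ∉ F
  · exact ⟨p, r, by grind, by grind, by grind, by grind, by grind⟩
  grind

lemma Sq_cone_of [DecidableEq V] {z : V} (hz : z ∈ B) (hN : z ∉ N)
    (h : ∀ F, F ∈ Sq G N B → ∀ u v, G.Adj z u → G.Adj z v → (u ∈ F ∨ u ∈ B) → (v ∈ F ∨ v ∈ B) →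
      (u = v → u ∈ F) → False) : ∀ F, z ∉ F → (insert z F ∈ Sq G N B ↔ F ∈ Sq G N B) := by
  intro F hF
  constructor
  · rintro ⟨h1, h2⟩
    exact ⟨fun x hx => (Finset.mem_insert.1 (h1 hx)).resolve_left fun e => hN (e ▸ hx),
      fun hb => h2 (hb.mono (Finset.subset_insert _ _))⟩
  · intro hS
    refine ⟨hS.1.trans (Finset.subset_insert _ _), fun hb => ?_⟩
    rcases bad_insert hz hb with hb | ⟨u, v, h1, h2, h3, h4, h5⟩
    · exact hS.2 hb
    · exact h F hS u v h1 h2 h3 h4 h5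

lemma Sq_cone_one [DecidableEq V] {x y z : V} (hx : x ∈ B) (hy : y ∈ N) (hxy : G.Adj x y) (hz : z ∈ B)
    (hzx : z ≠ x) (hzN : z ∉ N) :
    ∀ F, z ∉ F → (insert z F ∈ Sq G N B ↔ F ∈ Sq G N B) := by
  refine Sq_cone_of hz hzN fun F hF u v hu hv hu1 hv1 huv => ?_
  have hyF := hF.1 hy
  have hxF : x ∉ F := fun h => Sq_indep hF x h y hyF hxy
  have key : ∀ u, G.Adj z u → (u ∈ F ∨ u ∈ B) → u = x := by
    intro u hu hu1
    by_contra hux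
    exact hF.2 ⟨z, u, x, y, hu, hxy, .inr hz, hu1, .inr hx, .inl hyF, fun e => absurd e hzx,
      fun e => e ▸ hyF, fun e => absurd e hux, fun e => e ▸ hyF⟩
  have e1 := key u hu hu1
  have e2 := key v hv hv1
  exact hxF (e1 ▸ huv (e1.trans e2.symm))

lemma Sq_cone_isolated [DecidableEq V] {p q z : V} (hp : p ∈ B) (hq : q ∈ B) (hpq : G.Adj p q)
    (hz : z ∈ B) (hzN : z ∉ N) (hzB : ∀ w ∈ B, ¬ G.Adj z w) :
    ∀ F, z ∉ F → (insert z F ∈ Sq G N B ↔ F ∈ Sq G N B) := by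
  refine Sq_cone_of hz hzN fun F hF u v hu _ hu1 _ _ => ?_
  refine hF.2 (bad_of_disjoint hu.symm hpq hu1 hz hp hq (.inl ?_) (.inl ?_) ?_ ?_)
  · exact hu1.resolve_right fun h => hzB u h hu
  · exact hu1.resolve_right fun h => hzB u h hu
  · rintro rfl; exact hzB _ hq hpq
  · rintro rfl; exact hzB _ hp hpq.symm

lemma Sq_cone_path [DecidableEq V] {p q z : V} (hp : p ∈ B) (hq : q ∈ B) (hpq : G.Adj p q)
    (hz : z ∈ B) (hzN : z ∉ N) (hzp : G.Adj z p) (hzq : ¬ G.Adj z q) (hzq' : z ≠ q) :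
    ∀ F, z ∉ F → (insert z F ∈ Sq G N B ↔ F ∈ Sq G N B) := by
  refine Sq_cone_of hz hzN fun F hF u v hu hv hu1 hv1 huv => ?_
  have h1 : ∀ u, G.Adj z u → u ∉ F := fun u hu huF =>
    hF.2 (bad_of_disjoint hu.symm hpq (.inl huF) hz hp hq (.inl huF) (.inl huF) hzp.ne hzq')
  have h2 : ∀ u, G.Adj z u → u ∈ B → u = p := by
    intro u hu huB
    by_contra hc
    refine hF.2 (bad_of_disjoint hu.symm hpq (.inr huB) hz hp hq (.inr hc) (.inr ?_) hzp.ne hzq')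
    rintro rfl; exact hzq hu
  have e1 := h2 u hu (hu1.resolve_left (h1 u hu))
  have e2 := h2 v hv (hv1.resolve_left (h1 v hv))
  exact h1 u hu (huv (e1.trans e2.symm))

lemma Sq_triangle {x y z : V} (hxy : G.Adj x y) (hyz : G.Adj y z) (hxz : G.Adj x z) :
    Sq G N {x, y, z} = Fam G N (G.neighborSet x ∪ G.neighborSet y ∪ G.neighborSet z) := by
  ext F
  have hx := hxy.symm
  have hy := hyz.symm
  have hz := hxz.symm
  constructor
  · refine fun hF => ⟨Sq_indep hF, hF.1, fun w hw => ?_⟩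
    rintro ((h | h) | h)
    · exact hF.2 (bad_of_disjoint h.symm hyz (.inl hw) (by simp) (by simp) (by simp) (.inl hw) (.inl hw) hxy.ne hxz.ne)
    · exact hF.2 (bad_of_disjoint h.symm hxz (.inl hw) (by simp) (by simp) (by simp) (.inl hw) (.inl hw) hx.ne hyz.ne)
    · exact hF.2 (bad_of_disjoint h.symm hxy (.inl hw) (by simp) (by simp) (by simp) (.inl hw) (.inl hw) hz.ne hy.ne)
  · rintro ⟨h1, h2, h3⟩
    refine ⟨h2, ?_⟩
    rintro ⟨p, q, r, t, hpq, hrt, hp, hq, hr, ht, h⟩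
    simp only [indepComplex, Set.mem_ofPred_eq, Set.mem_union, SimpleGraph.mem_neighborSet,
      Set.mem_insert_iff, Set.mem_singleton_iff] at *
    have := hpq.ne
    have := hrt.ne
    have := hpq.symm
    have := hrt.symm
    grind

lemma Sq_edge {p q : V} (hpq : G.Adj p q) :
    Sq G N {p, q} = {F | F ∈ Fam G N ∅ ∧ ¬ ((∃ x ∈ F, G.Adj p x) ∧ ∃ x ∈ F, G.Adj q x)} := by
  ext F
  have hqp := hpq.symm
  constructor
  · refine fun hF => ⟨⟨Sq_indep hF, hF.1, fun _ _ => id⟩, ?_⟩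
    rintro ⟨⟨x, hx, h⟩, y, hy, h'⟩
    exact hF.2 (bad_of_two (by simp) (by simp) hpq.ne hx hy h h')
  · rintro ⟨⟨h1, h2, -⟩, h3⟩
    refine ⟨h2, ?_⟩
    rintro ⟨a, b, r, t, hab, hrt, ha, hb, hr, ht, h⟩
    simp only [indepComplex, Set.mem_ofPred_eq,
      Set.mem_insert_iff, Set.mem_singleton_iff] at *
    have := hab.ne
    have := hrt.ne
    have := hab.symm
    have := hrt.symm
    grind
end

section
variable {V : Type} [LinearOrder V] {G : SimpleGraph V} {N : Finset V} {B : Set V}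

lemma mem_Sq_of_indep (hB : ∀ x ∈ B, ∀ y ∈ B, ¬ G.Adj x y) {F : Finset V} :
    F ∈ Sq G N B ↔ N ⊆ F ∧ F ∈ indepComplex G ∧
      ∀ x ∈ B, ∀ y ∈ B, (∃ a ∈ F, G.Adj x a) → (∃ b ∈ F, G.Adj y b) → x = y := by
  constructor
  · refine fun h => ⟨h.1, Sq_indep h, fun x hx y hy ⟨a, ha, hxa⟩ ⟨b, hb, hyb⟩ => ?_⟩
    by_contra hne
    exact h.2 (bad_of_two hx hy hne ha hb hxa hyb)
  · rintro ⟨h1, h2, h3⟩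
    refine ⟨h1, ?_⟩
    rintro ⟨p, q, r, t, hpq, hrt, hp, hq, hr, ht, h⟩
    simp only [indepComplex, Set.mem_ofPred_eq] at *
    have := hpq.ne
    have := hrt.ne
    have := hpq.symm
    have := hrt.symm
    have h4 : ∀ x ∈ B, ∀ y ∈ B, ∀ a ∈ F, ∀ b ∈ F, G.Adj x a → G.Adj y b → x = y :=
      fun x hx y hy a ha b hb h h' => h3 x hx y hy ⟨a, ha, h⟩ ⟨b, hb, h'⟩
    clear h3
    rcases hp with hp | hp <;> rcases hr with hr | hr
    · exact absurd (h4 q (by grind) t (by grind) p hp r hr ‹_› ‹_›) (by grind)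
    · exact absurd (h4 q (by grind) r hr p hp t (by grind) ‹_› ‹_›) (by grind)
    · exact absurd (h4 p hp t (by grind) q (by grind) r hr ‹_› ‹_›) (by grind)
    · exact absurd (h4 p hp r hr q (by grind) t (by grind) ‹_› ‹_›) (by grind)

omit [LinearOrder V] in
lemma Sq_spl_indep (x : V) :
    Spl (Sq G N B) {F | F ∈ Sq G N B ∧ ∀ a ∈ F, ¬ G.Adj x a} {F | F ∈ Sq G N B ∧ ∃ a ∈ F, G.Adj x a} where
  cvx := Sq_cvx
  eq := by
    ext F
    simp only [Set.mem_union, Set.mem_ofPred_eq, ← and_or_left]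
    refine ⟨fun h => ⟨h, ?_⟩, fun h => h.1⟩
    by_cases hc : ∃ a ∈ F, G.Adj x a
    · exact .inr hc
    · push Not at hc; exact .inl hc
  not_le := by
    rintro F ⟨_, a, ha, h⟩ H ⟨_, h'⟩ hle
    exact h' a (hle ha) h

lemma Sq_van_indep (k : Type) [Field k] (hB : ∀ x ∈ B, ∀ y ∈ B, ¬ G.Adj x y) {x y : V} (hx : x ∈ B) (hy : y ∈ B)
    (hxy : x ≠ y) (hN : ∀ z ∈ B, z ∉ N) (i : ℕ) : Van k (Sq G N B) i := by
  have hs : ∀ z ∈ B, ∀ F, (N ⊆ insert z F ↔ N ⊆ F) := fun z hz F =>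
    ⟨fun h w hw => (Finset.mem_insert.1 (h hw)).resolve_left fun e => hN z hz (e ▸ hw),
      fun h => h.trans (Finset.subset_insert _ _)⟩
  refine (Sq_spl_indep x).van (IsCone.van ⟨x, fun F hF => ?_⟩ i) (IsCone.van ⟨y, fun F hF => ?_⟩ i)
  · simp only [Set.mem_ofPred_eq, mem_Sq_of_indep hB, hs x hx, indep_insert, Finset.exists_mem_insert,
      Finset.forall_mem_insert]
    have := hB x hx
    have e : ∀ z ∈ B, ¬ G.Adj z x := fun z hz => hB z hz x hx
    grind
  · simp only [Set.mem_ofPred_eq, mem_Sq_of_indep hB, hs y hy, indep_insert, Finset.exists_mem_insert]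
    have := hB x hx y hy
    have e : ∀ z ∈ B, ¬ G.Adj z y := fun z hz => hB z hz y hy
    constructor
    · rintro ⟨⟨h1, ⟨h2, -⟩, h3⟩, h4⟩
      exact ⟨⟨h1, h2, fun a ha b hb h h' => h3 a ha b hb (.inr h) (.inr h')⟩, h4.resolve_left this⟩
    · rintro ⟨⟨h1, h2, h3⟩, h4⟩
      exact ⟨⟨h1, ⟨h2, fun w hw hyw => hxy (h3 x hx y hy h4 ⟨w, hw, hyw⟩)⟩, fun a ha b hb h h' =>
        h3 a ha b hb (h.resolve_left (e a ha)) (h'.resolve_left (e b hb))⟩, .inr h4⟩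

/-- The squarefree degree complexes with possibly nonzero cohomology. -/
theorem Sq_cases (hN : ∀ z ∈ B, z ∉ N) :
    (∀ (k : Type) [Field k] (i : ℕ), Van k (Sq G N B) i) ∨ Sq G N B = Fam G N ∅ ∨
    (∃ p q, G.Adj p q ∧ B = {p, q} ∧ ∀ x ∈ N, ¬ G.Adj p x ∧ ¬ G.Adj q x) ∨
    (∃ x y z, G.Adj x y ∧ G.Adj y z ∧ G.Adj x z ∧ B = {x, y, z} ∧
      ∀ w ∈ N, ¬ G.Adj x w ∧ ¬ G.Adj y w ∧ ¬ G.Adj z w) := by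
  by_cases hb : Bad G N B
  · rw [Sq_empty hb]; exact .inl fun k _ i => van_empty i
  by_cases hsub : ∀ x ∈ B, ∀ y ∈ B, x = y
  · exact .inr (.inl (Sq_subsingleton hsub))
  by_cases hM : ∃ x ∈ B, ∃ y ∈ N, G.Adj x y
  · obtain ⟨x, hx, y, hy, hxy⟩ := hM
    obtain ⟨z, hz, hzx⟩ : ∃ z ∈ B, z ≠ x := by
      by_contra hc
      push Not at hc
      exact hsub fun a ha b hb => (hc a ha).trans (hc b hb).symm
    refine .inl fun k _ i => IsCone.van ⟨z, Sq_cone_one hx hy hxy hz hzx (hN z hz)⟩ i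
  push Not at hM
  by_cases hE : ∃ p ∈ B, ∃ q ∈ B, G.Adj p q
  swap
  · push Not at hE hsub
    obtain ⟨x, hx, y, hy, hxy⟩ := hsub
    exact .inl fun k _ i => Sq_van_indep k hE hx hy hxy hN i
  obtain ⟨p, hp, q, hq, hpq⟩ := hE
  have hdis : ∀ a ∈ B, ∀ b ∈ B, ∀ c ∈ B, ∀ d ∈ B, G.Adj a b → G.Adj c d → a = c ∨ a = d ∨ b = c ∨ b = d := by
    intro a ha b hb' c hc d hd hab hcd
    by_contra hcon
    push Not at hcon
    exact hb (bad_of_disjoint hab hcd (.inr ha) hb' hc hd (.inr hcon.1) (.inr hcon.2.1) hcon.2.2.1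
      hcon.2.2.2)
  by_cases hiso : ∃ z ∈ B, ∀ w ∈ B, ¬ G.Adj z w
  · obtain ⟨z, hz, h⟩ := hiso
    exact .inl fun k _ i => IsCone.van ⟨z, Sq_cone_isolated hp hq hpq hz (hN z hz) h⟩ i
  push Not at hiso
  by_cases hpath : ∃ z ∈ B, ∃ p ∈ B, ∃ q ∈ B, G.Adj z p ∧ G.Adj p q ∧ ¬ G.Adj z q ∧ z ≠ q
  · obtain ⟨z, hz, p, hp, q, hq, hzp, hpq, hzq, hzq'⟩ := hpath
    exact .inl fun k _ i => IsCone.van ⟨z, Sq_cone_path hp hq hpq hz (hN z hz) hzp hzq hzq'⟩ i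
  push Not at hpath
  refine .inr (.inr ?_)
  by_cases h2 : ∃ z ∈ B, z ≠ p ∧ z ≠ q
  swap
  · refine .inl ⟨p, q, hpq, ?_, fun x hx => ⟨hM p hp x hx, hM q hq x hx⟩⟩
    ext z
    simp only [Set.mem_insert_iff, Set.mem_singleton_iff]
    grind
  obtain ⟨z, hz, hzp, hzq⟩ := h2
  obtain ⟨w, hw, hzw⟩ := hiso z hz
  have h12 : G.Adj z p ∧ G.Adj z q := by
    rcases hdis z hz w hw p hp q hq hzw hpq with h | h | rfl | rfl
    · exact absurd h hzp
    · exact absurd h hzq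
    · by_cases h : G.Adj z q
      · exact ⟨hzw, h⟩
      · exact absurd (hpath z hz w hp q hq hzw hpq h) hzq
    · by_cases h : G.Adj z p
      · exact ⟨h, hzw⟩
      · exact absurd (hpath z hz w hq p hp hzw hpq.symm h) hzp
  refine .inr ⟨p, q, z, hpq, h12.2.symm, h12.1.symm, ?_, fun x hx => ⟨hM p hp x hx, hM q hq x hx, hM z hz x hx⟩⟩
  ext w
  simp only [Set.mem_insert_iff, Set.mem_singleton_iff]
  refine ⟨fun hw => ?_, by grind⟩
  by_contra hc
  push Not at hc
  obtain ⟨u, hu, hwu⟩ := hiso w hw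
  have a1 := hdis w hw u hu p hp q hq hwu hpq
  have a2 := hdis w hw u hu p hp z hz hwu h12.1.symm
  have a3 := hdis w hw u hu q hq z hz hwu h12.2.symm
  have := hpq.ne
  grind
end

section
variable {V : Type} [LinearOrder V] {k : Type} [Field k] {G : SimpleGraph V} {N : Finset V} {i d : ℕ}

omit [LinearOrder V] in
lemma dlt1_cone [DecidableEq V] {a : V → ℤ} {v : V} (hv : 1 ≤ a v) :
    ∀ F, v ∉ F → (insert v F ∈ dlt (A1 G) a ↔ F ∈ dlt (A1 G) a) := by
  intro F hF
  simp only [mem_dlt1, Finset.mem_insert]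
  grind

omit [LinearOrder V] in
lemma dlt1_eq {a : V → ℤ} (ha : ∀ j, a j ≤ 0) (hN : ∀ j, j ∈ N ↔ a j < 0) :
    dlt (A1 G) a = Fam G N ∅ := by
  ext F
  rw [mem_dlt1]
  constructor
  · rintro ⟨h1, h2⟩
    refine ⟨fun p hp q hq h => h2 p q h ⟨.inl hp, .inl hq⟩, fun j hj => ?_, fun _ _ => id⟩
    by_contra hc
    have := h1 j hc
    have := (hN j).1 hj
    omega
  · rintro ⟨h1, h2, -⟩
    refine ⟨fun j hj => ?_, fun p q h hpq => ?_⟩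
    · by_contra hc
      exact hj (h2 ((hN j).2 (by omega)))
    · have := ha p
      have := ha q
      exact h1 p (hpq.1.resolve_right (by omega)) q (hpq.2.resolve_right (by omega)) h

variable [Fintype V]

theorem van_A1_iff : (∀ a, Van k (dlt (A1 G) a) i) ↔ ∀ N, Van k (Fam G N ∅) i := by
  constructor
  · intro h N
    rw [← dlt1_eq (a := fun j => if j ∈ N then -1 else 0)]
    · exact h _
    · intro j; split_ifs <;> omega
    · intro j; split_ifs <;> simp_all
  · intro h a
    by_cases hc : ∃ v, 1 ≤ a v
    · obtain ⟨v, hv⟩ := hc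
      exact IsCone.van ⟨v, dlt1_cone hv⟩ i
    · push Not at hc
      rw [dlt1_eq (N := Finset.univ.filter fun j => a j < 0) (fun j => by have := hc j; omega) (by simp)]
      exact h _

/-- The family of independent sets containing `N` and not adjacent to both ends of an edge. -/
def Gam2 (G : SimpleGraph V) (N : Finset V) (p q : V) : Set (Finset V) :=
  {F | F ∈ Fam G N ∅ ∧ ¬ ((∃ x ∈ F, G.Adj p x) ∧ ∃ x ∈ F, G.Adj q x)}

omit [Fintype V] in
theorem van_Gam2 {p q : V} (hpq : G.Adj p q) (hN : ∀ x ∈ N, ¬ G.Adj p x ∧ ¬ G.Adj q x) :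
    Van k (Gam2 G N p q) 0 ∧ ∀ i, (Van k (Gam2 G N p q) (i + 1) ↔
      Van k (Fam G N (G.neighborSet p ∪ G.neighborSet q)) i) := by
  have hp : p ∉ N := fun h => (hN p h).2 hpq.symm
  have hq : q ∉ N := fun h => (hN q h).1 hpq
  have c1 : IsCone (Fam G N (G.neighborSet p)) :=
    Fam_cone hp (by simp) fun w hw => .inl hw
  have c2 : IsCone (Fam G N (G.neighborSet q)) :=
    Fam_cone hq (by simp) fun w hw => .inl hw
  have s1 : Spl (Gam2 G N p q) (Fam G N (G.neighborSet p))
      {F | F ∈ Fam G N ∅ ∧ (∃ x ∈ F, G.Adj p x) ∧ ¬ ∃ x ∈ F, G.Adj q x} := by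
    refine ⟨fun F hF H hH G' h1 h2 => ⟨Fam_cvx F hF.1 H hH.1 G' h1 h2, fun ⟨⟨x, hx, h⟩, y, hy, h'⟩ =>
      hH.2 ⟨⟨x, h2 hx, h⟩, y, h2 hy, h'⟩⟩, ?_, ?_⟩
    · ext F
      simp only [Gam2, Fam, Set.mem_union, Set.mem_ofPred_eq, SimpleGraph.mem_neighborSet, Set.mem_empty_iff_false]
      grind
    · rintro F ⟨_, ⟨x, hx, h⟩, _⟩ H hH hle
      exact hH.2.2 x (hle hx) h
  have s2 : Spl (Fam G N (G.neighborSet q)) (Fam G N (G.neighborSet p ∪ G.neighborSet q))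
      {F | F ∈ Fam G N ∅ ∧ (∃ x ∈ F, G.Adj p x) ∧ ¬ ∃ x ∈ F, G.Adj q x} := by
    refine ⟨Fam_cvx, ?_, ?_⟩
    · ext F
      simp only [Fam, Set.mem_union, Set.mem_ofPred_eq, SimpleGraph.mem_neighborSet, Set.mem_empty_iff_false]
      grind
    · rintro F ⟨_, ⟨x, hx, h⟩, _⟩ H hH hle
      exact hH.2.2 x (hle hx) (.inl h)
  refine ⟨s1.van (c1.van 0) (s2.van_upper_zero (c2.van 0)), fun i => ?_⟩
  rw [s2.van_lower_iff fun i => c2.van i]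
  exact ⟨fun h => s1.van_upper h (c1.van i), fun h => s1.van (c1.van _) h⟩

variable (G) (k) (d)

/-- The vanishing conditions equivalent to the vanishing of the local cohomology of the square of
the edge ideal in degrees with a negative coordinate. -/
structure NegCond : Prop where
  lk : ∀ N : Finset V, N.Nonempty → ∀ i < d, Van k (Fam G N ∅) i
  tri : ∀ v x y z, G.Adj x y → G.Adj y z → G.Adj x z → G.Adj v x ∨ G.Adj v y ∨ G.Adj v z
  edge : ∀ N : Finset V, N.Nonempty → ∀ p q, G.Adj p q → ∀ i, i + 1 < d →
    Van k (Fam G N (G.neighborSet p ∪ G.neighborSet q)) i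

variable {G} {k} {d}

theorem NegCond.van (h : NegCond k G d) {a : V → ℤ} (ha : ∃ j, a j < 0) (hi : i < d) :
    Van k (dlt (A2 G) a) i := by
  by_cases hc : ∃ v, 2 ≤ a v
  · obtain ⟨v, hv⟩ := hc
    exact IsCone.van ⟨v, dlt2_cone hv⟩ i
  push Not at hc
  rw [dlt2_eq (N := Finset.univ.filter fun j => a j < 0) (fun j => by have := hc j; omega) (by simp)]
  set N := Finset.univ.filter fun j => a j < 0 with hN
  have hne : N.Nonempty := by
    obtain ⟨j, hj⟩ := ha
    exact ⟨j, by simp [hN, hj]⟩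
  rcases Sq_cases (G := G) (N := N) (B := {j | a j = 1}) (by
    intro z hz; simp only [Set.mem_ofPred_eq] at hz; simp [hN, hz]) with h1 | h1 | h1 | h1
  · exact h1 k i
  · rw [h1]; exact h.lk N hne i hi
  · obtain ⟨p, q, hpq, hB, hNpq⟩ := h1
    rw [hB, Sq_edge hpq]
    obtain ⟨h0, h1⟩ := van_Gam2 (k := k) hpq hNpq
    cases i with
    | zero => exact h0
    | succ i => exact (h1 i).2 (h.edge N hne p q hpq i hi)
  · obtain ⟨x, y, z, hxy, hyz, hxz, hB, hNw⟩ := h1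
    obtain ⟨w, hw⟩ := hne
    have := hNw w hw
    have := h.tri w x y z hxy hyz hxz
    simp only [G.adj_comm w] at this
    tauto

omit [Fintype V] in
theorem exists_dlt2 (N : Finset V) (B : Set V) (h : ∀ z ∈ B, z ∉ N) :
    ∃ a : V → ℤ, (∀ j, a j < 0 ↔ j ∈ N) ∧ dlt (A2 G) a = Sq G N B := by
  classical
  refine ⟨fun j => if j ∈ N then -1 else if j ∈ B then 1 else 0, fun j => ?_, ?_⟩
  · dsimp only; split_ifs <;> simp_all
  · rw [dlt2_eq (N := N)]
    · congr 1
      ext j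
      simp only [Set.mem_ofPred_eq]
      have := h j
      grind
    · intro j; split_ifs <;> omega
    · intro j; split_ifs <;> simp_all

theorem negCond_of_van (hd : ∀ F ∈ indepComplex G, F.card ≤ d)
    (h : ∀ a : V → ℤ, (∃ j, a j < 0) → ∀ i < d, Van k (dlt (A2 G) a) i) : NegCond k G d := by
  have key : ∀ (N : Finset V) (B : Set V), N.Nonempty → (∀ z ∈ B, z ∉ N) → ∀ i < d, Van k (Sq G N B) i := by
    rintro N B ⟨j, hj⟩ hB i hi
    obtain ⟨a, ha, e⟩ := exists_dlt2 (G := G) N B hB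
    exact e ▸ h a ⟨j, (ha j).2 hj⟩ i hi
  refine ⟨fun N hN i hi => ?_, fun v x y z hxy hyz hxz => ?_, fun N hN p q hpq i hi => ?_⟩
  · rw [← Sq_subsingleton (B := ∅) (by simp)]
    exact key N ∅ hN (by simp) i hi
  · by_contra hc
    push Not at hc
    let P : Finset V → Prop := fun N => N ∈ indepComplex G ∧ v ∈ N ∧
      ∀ w ∈ N, ¬ G.Adj w x ∧ ¬ G.Adj w y ∧ ¬ G.Adj w z
    have hPv : P {v} := ⟨by simp [indepComplex], by simp, by simpa using hc⟩
    obtain ⟨N, hvN, hN⟩ := (Set.toFinite {N | P N}).exists_le_maximal hPv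
    obtain ⟨hN1, hvN, hN2⟩ := hN.1
    have hxN : x ∉ N := fun h => (hN2 x h).2.1 hxy
    have hyN : y ∉ N := fun h => (hN2 y h).2.2 hyz
    have hzN : z ∉ N := fun h => (hN2 z h).1 hxz.symm
    have hS : Sq G N {x, y, z} = {N} := by
      rw [Sq_triangle hxy hyz hxz]
      refine Fam_eq_singleton hN1 (fun w hw => ?_) fun w hw hwT => ?_
      · rintro ((h | h) | h)
        · exact (hN2 w hw).1 h.symm
        · exact (hN2 w hw).2.1 h.symm
        · exact (hN2 w hw).2.2 h.symm
      · by_contra hcon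
        push Not at hcon
        have hP : P (insert w N) := by
          refine ⟨indep_insert.2 ⟨hN1, fun u hu h => hcon u hu h.symm⟩, Finset.mem_insert_of_mem hvN, ?_⟩
          intro u hu
          rcases Finset.mem_insert.1 hu with rfl | hu
          · simp only [Set.mem_union, SimpleGraph.mem_neighborSet, not_or] at hwT
            exact ⟨fun h => hwT.1.1 h.symm, fun h => hwT.1.2 h.symm, fun h => hwT.2 h.symm⟩
          · exact hN2 u hu
        exact hw (hN.2 hP (Finset.subset_insert _ _) (Finset.mem_insert_self _ _))
    have hcard : N.card < d := by
      have := hd (insert x N) (indep_insert.2 ⟨hN1, fun w hw h => (hN2 w hw).1 h.symm⟩)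
      rw [Finset.card_insert_of_notMem hxN] at this
      omega
    have := key N {x, y, z} ⟨v, hvN⟩ (by simp [hxN, hyN, hzN]) _ hcard
    rw [hS, van_singleton_iff] at this
    exact this rfl
  · by_cases hNpq : ∀ x ∈ N, ¬ G.Adj p x ∧ ¬ G.Adj q x
    · rw [← (van_Gam2 hpq hNpq).2, Gam2, ← Sq_edge hpq]
      refine key N _ hN ?_ _ hi
      simp only [Set.mem_insert_iff, Set.mem_singleton_iff, forall_eq_or_imp, forall_eq]
      exact ⟨fun h => (hNpq p h).2 hpq.symm, fun h => (hNpq q h).1 hpq⟩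
    · rw [Fam_eq_empty]
      · exact van_empty i
      · right
        push Not at hNpq
        obtain ⟨x, hx, h⟩ := hNpq
        refine ⟨x, hx, ?_⟩
        by_cases hp : G.Adj p x
        · exact .inl hp
        · exact .inr (h hp)

end

section
variable {V : Type} [LinearOrder V] [Fintype V] {k : Type} [Field k] {G : SimpleGraph V} {i d : ℕ}

theorem negCond_of_finiteLength (hd : ∀ F ∈ indepComplex G, F.card ≤ d)
    (h : ∀ i < d, IsFiniteLength (MvPolynomial V k) ((localCohomology (maxIdeal k V) i).obj
      (ModuleCat.of (MvPolynomial V k) (MvPolynomial V k ⧸ idl k (A2 G))))) : NegCond k G d := by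
  refine negCond_of_van hd fun a ⟨j, hj⟩ i hi => ?_
  obtain ⟨r, hr⟩ := exists_pow_smul_all (h i hi) j
  exact van_of_neg hr hj

theorem van_of_killed (h : ∀ x ∈ maxIdeal k V, ∀ y : (localCohomology (maxIdeal k V) i).obj
      (ModuleCat.of (MvPolynomial V k) (MvPolynomial V k ⧸ idl k (A2 G))), x • y = 0)
    {a : V → ℤ} (ha : ∃ j, a j < 0) : Van k (dlt (A2 G) a) i := by
  obtain ⟨j, hj⟩ := ha
  exact van_of_neg (r := 1) (j := j) (fun y => h _ (by
    rw [pow_one]; exact Ideal.subset_span ⟨j, rfl⟩) y) hj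

theorem van_empty_of_killed [Nonempty V] (h : ∀ x ∈ maxIdeal k V, ∀ y : (localCohomology (maxIdeal k V) i).obj
      (ModuleCat.of (MvPolynomial V k) (MvPolynomial V k ⧸ idl k (A2 G))), x • y = 0) :
    Van k (Fam G ∅ ∅) i := by
  obtain ⟨v⟩ := ‹Nonempty V›
  have e0 : dlt (A2 G) (fun _ => 0) = Fam G ∅ ∅ := by
    rw [dlt2_eq (N := ∅) (by simp) (by simp), Sq_subsingleton (by simp)]
  have e1 : dlt (A2 G) (fun j => 0 + ((Finsupp.single v 1 : V →₀ ℕ) j : ℤ)) = Fam G ∅ ∅ := by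
    rw [dlt2_eq (N := ∅), Sq_subsingleton]
    · simp [Finsupp.single_apply]
    · intro j; simp only [Finsupp.single_apply]; split_ifs <;> simp
    · intro j; simp
  rw [← e0]
  refine van_of_eq (v := Finsupp.single v 1) (fun y => ?_) (e1.trans e0.symm)
  exact h _ (Ideal.subset_span ⟨v, rfl⟩) y

theorem finiteLength_of_van (h : ∀ a : V → ℤ, (∃ j, a j < 0) → Van k (dlt (A2 G) a) i) :
    IsFiniteLength (MvPolynomial V k) ((localCohomology (maxIdeal k V) i).obj
      (ModuleCat.of (MvPolynomial V k) (MvPolynomial V k ⧸ idl k (A2 G)))) := by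
  refine isFiniteLength_of_finite ((Set.finite_Icc (0 : V → ℤ) 1).subset fun a ha => ⟨fun j => ?_, fun j => ?_⟩)
  · by_contra hc
    exact ha (h a ⟨j, not_le.1 hc⟩)
  · by_contra hc
    refine ha (IsCone.van ⟨j, dlt2_cone ?_⟩ i)
    simp only [Pi.one_apply, not_le] at hc
    omega

omit [Fintype V] in
lemma coc_of_sub {Γ Γ' : Set (Finset V)} {u : Finset V → k} (hu : Coc Γ i u) (hs : Γ ⊆ Γ')
    (h : ∀ F ∈ Γ', F ∉ Γ → F.card = i + 1 → ∀ j ∈ F, u (F.erase j) = 0) : Coc Γ' i u := by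
  refine ⟨fun F hF => hu.1 F fun h => hF (hs h), fun F hF hi => ?_⟩
  by_cases hc : F ∈ Γ
  · exact hu.2 F hc hi
  · exact dl_eq_zero (h F hF hc hi)

theorem surjective_of_negCond (h : NegCond k G d) (h0 : ∀ i < d, Van k (Fam G ∅ ∅) i) (hi : i < d) :
    Function.Surjective (lam (maxIdeal k V) i
      (ModuleCat.of (MvPolynomial V k) (MvPolynomial V k ⧸ idl k (A2 G))) 1) := by
  refine surjective_of fun a u hu => ?_
  have hvan : Van k (dlt (A2 G) a) i → ∃ w, Coc (gam (A2 G) a 1) i w ∧ Cob (dlt (A2 G) a) i (u - w) :=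
    fun hv => ⟨0, ⟨fun _ _ => rfl, fun F _ _ => by simp [dl]⟩, by simpa using hv u hu⟩
  by_cases ha : ∃ j, a j < 0
  · exact hvan (h.van ha hi)
  by_cases hc : ∃ v, 2 ≤ a v
  · obtain ⟨v, hv⟩ := hc
    exact hvan (IsCone.van ⟨v, dlt2_cone hv⟩ i)
  push Not at hc ha
  have hsub : dlt (A2 G) a ⊆ gam (A2 G) a 1 := by
    intro F hF
    refine mem_gam.2 ⟨fun j => ?_, fun s hs => ?_⟩
    · have := ha j
      unfold sh
      split_ifs <;> simp <;> omega
    · obtain ⟨j, hj, hl⟩ := hF.2 s hs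
      exact ⟨j, by simpa [sh, hj] using hl⟩
  have hw : Coc (gam (A2 G) a 1) i u → ∃ w, Coc (gam (A2 G) a 1) i w ∧ Cob (dlt (A2 G) a) i (u - w) :=
    fun hv => ⟨u, hv, by rw [sub_self]; exact cob_zero _ _⟩
  have hgam : ∀ F ∈ gam (A2 G) a 1, ∀ p q r t, G.Adj p q → G.Adj r t → ∃ j,
      a j + (if j ∈ F then 1 else 0) < (((if p = j then 1 else 0) + if q = j then 1 else 0) +
        ((if r = j then 1 else 0) + if t = j then 1 else 0) : ℤ) := by
    intro F hF p q r t hpq hrt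
    obtain ⟨j, hj⟩ := (mem_gam.1 hF).2 _ ⟨p, q, r, t, hpq, hrt, rfl⟩
    refine ⟨j, ?_⟩
    simp only [Finsupp.add_apply, Finsupp.single_apply, sh] at hj
    push_cast at hj
    exact hj
  have heq := dlt2_eq (G := G) (N := ∅) (a := a) (fun j => by have := hc j; omega)
    (fun j => by have := ha j; simp; omega)
  rcases Sq_cases (G := G) (N := ∅) (B := {j | a j = 1}) (by simp) with h1 | h1 | h1 | h1
  · exact hvan (heq ▸ h1 k i)
  · exact hvan (heq ▸ h1 ▸ h0 i hi)
  · obtain ⟨p, q, hpq, hB, -⟩ := h1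
    have hp : a p = 1 := by have : p ∈ {j | a j = 1} := by rw [hB]; simp
                            exact this
    have hq : a q = 1 := by have : q ∈ {j | a j = 1} := by rw [hB]; simp
                            exact this
    have hqp := hpq.symm
    have hne := hpq.ne
    rw [hB, Sq_edge hpq] at heq
    refine hw (coc_of_sub hu hsub fun F hF hF' hFi j hj => ?_)
    have hg := hgam F hF
    have hind : F ∈ indepComplex G := by
      intro x hx y hy hxy
      obtain ⟨j, hj⟩ := hg p q x y hpq hxy
      have := hxy.ne
      have := ha j
      grind
    rw [heq] at hF'
    have hF2 : (∃ x ∈ F, G.Adj p x) ∧ ∃ x ∈ F, G.Adj q x := by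
      by_contra hcon
      exact hF' ⟨⟨hind, by simp, by simp⟩, hcon⟩
    obtain ⟨⟨x, hx, hpx⟩, y, hy, hqy⟩ := hF2
    have key : ∀ x ∈ F, ∀ y ∈ F, G.Adj p x → G.Adj q y → x = y := by
      intro x hx y hy hpx hqy
      by_contra hxy
      obtain ⟨j, hj⟩ := hg p x q y hpx hqy
      have := hpx.ne
      have := hqy.ne
      have := ha j
      grind
    obtain rfl := key x hx y hy hpx hqy
    have hall : ∀ f ∈ F, f = x := by
      intro f hf
      rcases h.tri f p q x hpq hqy hpx with h1 | h1 | h1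
      · exact key f hf x hx h1.symm hqy
      · exact (key x hx f hf hpx h1.symm).symm
      · exact absurd h1 (hind f hf x hx)
    have hFx : F = {x} := Finset.eq_singleton_iff_unique_mem.2 ⟨hx, hall⟩
    subst hFx
    rw [Finset.card_singleton] at hFi
    obtain rfl : i = 0 := by omega
    obtain rfl := Finset.mem_singleton.1 hj
    have hpm : {p} ∈ dlt (A2 G) a := by
      rw [heq]
      refine ⟨⟨by simp [indepComplex], by simp, by simp⟩, ?_⟩
      simp
    have := hu.2 {p} hpm (by simp)
    simpa [dl, sg_mul_self, Finset.erase_singleton, sg] using this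
  · obtain ⟨x, y, z, hxy, hyz, hxz, hB, -⟩ := h1
    have hm : ∀ w ∈ ({x, y, z} : Set V), a w = 1 := by rw [← hB]; exact fun w hw => hw
    simp only [Set.mem_insert_iff, Set.mem_singleton_iff, forall_eq_or_imp, forall_eq] at hm
    rw [hB, Sq_triangle hxy hyz hxz] at heq
    refine hw (coc_of_sub hu hsub fun F hF hF' hFi j hj => ?_)
    have hg := hgam F hF
    exfalso
    have := hxy.symm
    have := hyz.symm
    have := hxz.symm
    have := hxy.ne
    have := hyz.ne
    have := hxz.ne
    rcases h.tri j x y z hxy hyz hxz with h1 | h1 | h1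
    · obtain ⟨l, hl⟩ := hg j x y z h1 hyz
      have := h1.ne
      have := ha l
      grind
    · obtain ⟨l, hl⟩ := hg j y x z h1 hxz
      have := h1.ne
      have := ha l
      grind
    · obtain ⟨l, hl⟩ := hg j z x y h1 hxy
      have := h1.ne
      have := ha l
      grind
end

section
variable {V : Type} (k : Type) [Field k] (G : SimpleGraph V)

lemma edgeIdeal_eq : edgeIdeal k G = idl k (A1 G) := by
  unfold edgeIdeal idl
  congr 1
  ext m
  simp only [Set.mem_ofPred_eq, Set.mem_image, A1]
  constructor
  · rintro ⟨p, q, h, rfl⟩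
    exact ⟨_, ⟨p, q, h, rfl⟩, by simp [X, monomial_mul]⟩
  · rintro ⟨_, ⟨p, q, h, rfl⟩, rfl⟩
    exact ⟨p, q, h, by simp [X, monomial_mul]⟩

lemma edgeIdeal_sq_eq : edgeIdeal k G ^ 2 = idl k (A2 G) := by
  rw [edgeIdeal_eq, sq]
  unfold idl
  rw [Ideal.span_mul_span]
  congr 1
  ext m
  simp only [Set.mem_mul, Set.mem_image, A1, A2, Set.mem_ofPred_eq]
  constructor
  · rintro ⟨_, ⟨_, ⟨p, q, h, rfl⟩, rfl⟩, _, ⟨_, ⟨r, t, h', rfl⟩, rfl⟩, rfl⟩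
    exact ⟨_, ⟨p, q, r, t, h, h', rfl⟩, by simp [monomial_mul]⟩
  · rintro ⟨_, ⟨p, q, r, t, h, h', rfl⟩, rfl⟩
    exact ⟨_, ⟨_, ⟨p, q, h, rfl⟩, rfl⟩, _, ⟨_, ⟨r, t, h', rfl⟩, rfl⟩, by simp [monomial_mul]⟩

lemma srIdeal_eq : srIdeal k (indepComplex G) = edgeIdeal k G := by
  classical
  refine le_antisymm (Ideal.span_le.2 ?_) (Ideal.span_le.2 ?_)
  · rintro _ ⟨F, hF, rfl⟩
    simp only [indepComplex, Set.mem_ofPred_eq, not_forall, not_not] at hF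
    obtain ⟨p, hp, q, hq, hpq⟩ := hF
    rw [← Finset.mul_prod_erase F _ hp, ← Finset.mul_prod_erase (F.erase p) _
      (Finset.mem_erase.2 ⟨hpq.ne.symm, hq⟩), ← mul_assoc]
    exact Ideal.mul_mem_right _ _ (Ideal.subset_span ⟨p, q, hpq, rfl⟩)
  · rintro _ ⟨p, q, hpq, rfl⟩
    refine Ideal.subset_span ⟨{p, q}, fun h => h p (by simp) q (by simp) hpq, ?_⟩
    rw [Finset.prod_pair hpq.ne]

variable [Finite V]

lemma card_bdd : BddAbove {c | ∃ F ∈ indepComplex G, F.card = c} := by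
  have := Fintype.ofFinite V
  exact ⟨Fintype.card V, by rintro _ ⟨F, -, rfl⟩; exact Finset.card_le_univ F⟩

lemma exists_card_eq_indepNumber : ∃ F ∈ indepComplex G, F.card = indepNumber G :=
  Nat.sSup_mem (s := {c | ∃ F ∈ indepComplex G, F.card = c})
    ⟨0, ∅, empty_mem_indep, Finset.card_empty⟩ (card_bdd G)

variable {G} in
lemma card_le_indepNumber {F : Finset V} (hF : F ∈ indepComplex G) : F.card ≤ indepNumber G :=
  le_csSup (card_bdd G) ⟨F, hF, rfl⟩

variable {k} in
lemma dim_face_le (P : PrimeSpectrum (MvPolynomial V k)) (F : Finset V)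
    (h : ∀ v ∉ F, X v ∈ P.asIdeal) : ringKrullDim (MvPolynomial V k ⧸ P.asIdeal) ≤ F.card := by
  let φ : MvPolynomial F k →+* MvPolynomial V k ⧸ P.asIdeal :=
    (Ideal.Quotient.mk _).comp (rename (Subtype.val : F → V)).toRingHom
  have hφ : Function.Surjective φ := by
    intro y
    obtain ⟨f, rfl⟩ := Ideal.Quotient.mk_surjective y
    induction f using MvPolynomial.induction_on with
    | C a => exact ⟨C a, by simp [φ]⟩
    | add p q hp hq =>
      obtain ⟨a, ha⟩ := hp
      obtain ⟨b, hb⟩ := hq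
      exact ⟨a + b, by rw [map_add, ha, hb, map_add]⟩
    | mul_X p v hp =>
      obtain ⟨a, ha⟩ := hp
      by_cases hv : v ∈ F
      · exact ⟨a * X ⟨v, hv⟩, by rw [map_mul, ha, map_mul]; simp [φ]⟩
      · exact ⟨0, by rw [map_zero, map_mul, Ideal.Quotient.eq_zero_iff_mem.2 (h v hv), mul_zero]⟩
  refine (ringKrullDim_le_of_surjective φ hφ).trans ?_
  rw [MvPolynomial.ringKrullDim_of_isNoetherianRing, ringKrullDim_eq_zero_of_field]
  simp

theorem ringKrullDim_edge : ringKrullDim (MvPolynomial V k ⧸ edgeIdeal k G) = indepNumber G := by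
  classical
  have := Fintype.ofFinite V
  apply le_antisymm
  · rw [ringKrullDim_quotient]
    refine iSup_le fun p => ?_
    let P : PrimeSpectrum (MvPolynomial V k) := p.head.1
    have hP : edgeIdeal k G ≤ P.asIdeal := p.head.2
    let F : Finset V := Finset.univ.filter fun v => X v ∉ P.asIdeal
    have hF : F ∈ indepComplex G := by
      intro i hi j hj hij
      have := P.isPrime.mem_or_mem (hP (Ideal.subset_span ⟨i, j, hij, rfl⟩))
      simp only [F, Finset.mem_filter, Finset.mem_univ, true_and] at hi hj
      tauto
    have h1 := dim_face_le P F (by simp [F])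
    rw [ringKrullDim_quotient] at h1
    let q : LTSeries (PrimeSpectrum.zeroLocus (P.asIdeal : Set (MvPolynomial V k))) :=
      { length := p.length
        toFun := fun i => ⟨(p i).1, show P ≤ (p i).1 from p.head_le i⟩
        step := fun i => p.step i }
    refine (Order.LTSeries.length_le_krullDim q).trans (h1.trans ?_)
    exact_mod_cast card_le_indepNumber hF
  · obtain ⟨F, hF, hc⟩ := exists_card_eq_indepNumber G
    let ψ : MvPolynomial V k →ₐ[k] MvPolynomial F k := aeval fun v => if h : v ∈ F then X ⟨v, h⟩ else 0
    have hψ : ∀ f ∈ edgeIdeal k G, ψ.toRingHom f = 0 := by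
      intro f hf
      have : edgeIdeal k G ≤ RingHom.ker ψ.toRingHom := by
        refine Ideal.span_le.2 ?_
        rintro _ ⟨i, j, hij, rfl⟩
        have := hF i
        have : i ∉ F ∨ j ∉ F := by
          by_contra hcon
          push Not at hcon
          exact hF i hcon.1 j hcon.2 hij
        simp only [SetLike.mem_coe, RingHom.mem_ker, AlgHom.toRingHom_eq_coe, RingHom.coe_coe, map_mul, ψ, aeval_X]
        rcases this with h | h <;> simp [h]
      exact this hf
    have hs : Function.Surjective (Ideal.Quotient.lift _ ψ.toRingHom hψ) := by
      refine Ideal.Quotient.lift_surjective_of_surjective _ _ fun y => ⟨rename Subtype.val y, ?_⟩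
      simp only [AlgHom.toRingHom_eq_coe, RingHom.coe_coe, ψ, aeval_rename]
      have : ((fun v => if h : v ∈ F then (X ⟨v, h⟩ : MvPolynomial F k) else 0) ∘ (Subtype.val : F → V)) = X := by
        funext v; simp
      rw [this, aeval_X_left_apply]
    have := ringKrullDim_le_of_surjective _ hs
    rw [MvPolynomial.ringKrullDim_of_isNoetherianRing, ringKrullDim_eq_zero_of_field] at this
    simpa [hc] using this

theorem ringKrullDim_edge_sq :
    ringKrullDim (MvPolynomial V k ⧸ edgeIdeal k G ^ 2) = indepNumber G := by
  rw [← ringKrullDim_edge k G, ringKrullDim_quotient, ringKrullDim_quotient,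
    PrimeSpectrum.zeroLocus_pow _ two_ne_zero]

end

section
variable {V : Type} [LinearOrder V] [Fintype V] {k : Type} [Field k] {G : SimpleGraph V}

omit [LinearOrder V] [Fintype V] in
lemma cast_lt_iff {i n : ℕ} : (i : WithBot (WithTop ℕ)) < (n : WithBot ℕ∞) ↔ i < n := by
  change (((i : ℕ∞) : WithBot ℕ∞) < ((n : ℕ∞) : WithBot ℕ∞)) ↔ _
  rw [WithBot.coe_lt_coe, Nat.cast_lt]

theorem quotCM_iff : quotCM k V (srIdeal k (indepComplex G)) ↔
    ∀ i < indepNumber G, ∀ N, Van k (Fam G N ∅) i := by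
  unfold quotCM locCoh
  rw [srIdeal_eq, ringKrullDim_edge]
  refine forall_congr' fun i => imp_congr cast_lt_iff ?_
  rw [edgeIdeal_eq, subsingleton_iff, van_A1_iff]

theorem graphCM_iff : graphCM G ↔ ∀ (k : Type) [Field k], ∀ i < indepNumber G, ∀ N, Van k (Fam G N ∅) i :=
  forall₂_congr fun _ _ => quotCM_iff

omit [LinearOrder V] in
theorem quotGCM_iff : quotGCM k V (edgeIdeal k G ^ 2) ↔ ∀ i < indepNumber G,
    IsFiniteLength (MvPolynomial V k) ((localCohomology (maxIdeal k V) i).obj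
      (ModuleCat.of (MvPolynomial V k) (MvPolynomial V k ⧸ idl k (A2 G)))) := by
  unfold quotGCM locCoh
  rw [ringKrullDim_edge_sq]
  refine forall_congr' fun i => imp_congr cast_lt_iff ?_
  rw [edgeIdeal_sq_eq]

omit [LinearOrder V] in
theorem quotKBuchsbaum_iff : quotKBuchsbaum k V (edgeIdeal k G ^ 2) 1 ↔ ∀ i < indepNumber G,
    ∀ x ∈ maxIdeal k V, ∀ y : (localCohomology (maxIdeal k V) i).obj
      (ModuleCat.of (MvPolynomial V k) (MvPolynomial V k ⧸ idl k (A2 G))), x • y = 0 := by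
  unfold quotKBuchsbaum locCoh
  rw [ringKrullDim_edge_sq, pow_one]
  refine forall_congr' fun i => imp_congr cast_lt_iff ?_
  rw [edgeIdeal_sq_eq]

omit [LinearOrder V] in
theorem quotBuchsbaum_iff : quotBuchsbaum k V (edgeIdeal k G ^ 2) ↔ ∀ i < indepNumber G,
    Function.Surjective (LocCoh.lam (maxIdeal k V) i
      (ModuleCat.of (MvPolynomial V k) (MvPolynomial V k ⧸ idl k (A2 G))) 1) := by
  unfold quotBuchsbaum
  rw [ringKrullDim_edge_sq]
  refine forall_congr' fun i => imp_congr cast_lt_iff ?_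
  rw [edgeIdeal_sq_eq]
  exact Iff.rfl

end

section
variable {V : Type} [LinearOrder V] {k : Type} [Field k] {G : SimpleGraph V} {N : Finset V} {T : Set V} {i : ℕ}

lemma van_zero {Γ : Set (Finset V)} (h : ∅ ∉ Γ) : Van k Γ 0 := fun _ _ =>
  ⟨0, fun _ _ => rfl, fun _ hF hc => absurd (Finset.card_eq_zero.1 hc ▸ hF) h⟩

lemma van_zero_Fam (hN : N.Nonempty) : Van k (Fam G N T) 0 :=
  van_zero fun h => hN.ne_empty (Finset.subset_empty.1 h.2.1)

/-- An independent set avoiding `T` that is maximal with this property. -/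
def MaxIn (G : SimpleGraph V) (T : Set V) (F : Finset V) : Prop :=
  F ∈ indepComplex G ∧ (∀ x ∈ F, x ∉ T) ∧ ∀ w ∉ F, w ∉ T → ∃ x ∈ F, G.Adj x w

lemma exists_maxIn [Finite V] (hN : N ∈ indepComplex G) (hT : ∀ x ∈ N, x ∉ T) :
    ∃ F, N ⊆ F ∧ MaxIn G T F := by
  obtain ⟨F, hF, hmax⟩ := Set.Finite.exists_maximalFor Finset.card {F | N ⊆ F ∧ F ∈ indepComplex G ∧ ∀ x ∈ F, x ∉ T}
    (Set.toFinite _) ⟨N, subset_rfl, hN, hT⟩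
  refine ⟨F, hF.1, hF.2.1, hF.2.2, fun w hw hwT => ?_⟩
  by_contra hc
  push Not at hc
  have := hmax (j := insert w F) ⟨hF.1.trans (Finset.subset_insert _ _), indep_insert.2 ⟨hF.2.1, fun x hx h => hc x hx h.symm⟩,
    by simpa [hwT] using hF.2.2⟩ (Finset.card_le_card (Finset.subset_insert _ _))
  rw [Finset.card_insert_of_notMem hw] at this
  omega

lemma MaxIn.card_le {F : Finset V} {m : ℕ} (h : MaxIn G T F) (hv : ∀ i < m, Van k (Fam G F T) i) :
    m ≤ F.card := by
  by_contra hc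
  have := hv _ (not_le.1 hc)
  rw [Fam_eq_singleton h.1 h.2.1 h.2.2, van_singleton_iff] at this
  exact this rfl

end

lemma indepNumber_eq {W : Type} [Finite W] {H : SimpleGraph W} {n : ℕ} (h : ∃ F ∈ indepComplex H, F.card = n)
    (h' : ∀ F ∈ indepComplex H, F.card ≤ n) : indepNumber H = n := by
  obtain ⟨F, hF, rfl⟩ := h
  obtain ⟨F', hF', e⟩ := exists_card_eq_indepNumber H
  exact le_antisymm (e ▸ h' F' hF') (card_le_indepNumber hF)

section
variable {V : Type} [LinearOrder V] {k : Type} [Field k] {G : SimpleGraph V} {N : Finset V} {T : Set V} {i : ℕ}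

theorem van_vertexLoc {v : V} {N : Finset (vertexLocSet G v)} : Van k (Fam (vertexLoc G v) N ∅) i ↔
    Van k (Fam G (insert v (N.map (Function.Embedding.subtype _))) ∅) (i + 1) := by
  have hv : v ∉ N.map (Function.Embedding.subtype (· ∈ vertexLocSet G v)) := by
    simp only [Finset.mem_map]
    rintro ⟨x, -, e⟩
    exact x.2.1 e
  have e : (vertexLocSet G v)ᶜ ∪ Subtype.val '' (∅ : Set (vertexLocSet G v)) = insert v (G.neighborSet v) := by
    ext w
    simp [vertexLocSet, Set.mem_ofPred_eq]
    tauto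
  unfold vertexLoc
  rw [van_induce, e, van_insert_iff hv (by simp) (by simp +contextual), Fam_congr (T' := ∅)]
  intro w hw
  have := hw v (by simp)
  simpa using this

omit [LinearOrder V] in
lemma mem_edgeLocSet_vertexLoc {v : V} {p q w : vertexLocSet G v} :
    w ∈ edgeLocSet (vertexLoc G v) p q ↔ ¬ G.Adj p w ∧ ¬ G.Adj q w := by
  simp [edgeLocSet, vertexLoc]

theorem van_edgeLoc {v : V} {p q : vertexLocSet G v} {N : Finset (edgeLocSet (vertexLoc G v) p q)} :
    Van k (Fam (edgeLoc (vertexLoc G v) p q) N ∅) i ↔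
    Van k (Fam G (insert v ((N.map (Function.Embedding.subtype _)).map (Function.Embedding.subtype _)))
      (G.neighborSet p ∪ G.neighborSet q)) (i + 1) := by
  have hv : v ∉ (N.map (Function.Embedding.subtype _)).map (Function.Embedding.subtype (· ∈ vertexLocSet G v)) := by
    simp only [Finset.mem_map]
    rintro ⟨x, -, e⟩
    exact x.2.1 e
  have hp := p.2
  have hq := q.2
  have e : (vertexLocSet G v)ᶜ ∪ Subtype.val '' ((edgeLocSet (vertexLoc G v) p q)ᶜ ∪ Subtype.val '' (∅ : Set (edgeLocSet (vertexLoc G v) p q))) =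
      insert v (G.neighborSet v ∪ (G.neighborSet p ∪ G.neighborSet q)) := by
    ext w
    rw [Set.image_empty, Set.union_empty]
    by_cases hw : w ∈ vertexLocSet G v
    · have h2 := hw
      simp only [vertexLocSet, Set.mem_ofPred_eq, SimpleGraph.mem_neighborSet] at h2
      have h3 : w ∈ Subtype.val '' (edgeLocSet (vertexLoc G v) p q)ᶜ ↔ ⟨w, hw⟩ ∈ (edgeLocSet (vertexLoc G v) p q)ᶜ := by
        constructor
        · rintro ⟨x, hx, rfl⟩
          exact hx
        · exact fun h => ⟨_, h, rfl⟩
      rw [Set.mem_union, h3, Set.mem_compl_iff, Set.mem_compl_iff, mem_edgeLocSet_vertexLoc]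
      simp only [hw, h2, Set.mem_insert_iff, Set.mem_union, SimpleGraph.mem_neighborSet]
      tauto
    · have h2 := hw
      simp only [vertexLocSet, Set.mem_ofPred_eq, SimpleGraph.mem_neighborSet] at h2
      simp only [Set.mem_union, Set.mem_compl_iff, hw, Set.mem_insert_iff, SimpleGraph.mem_neighborSet]
      tauto
  have hv' : v ∉ G.neighborSet v ∪ (G.neighborSet p ∪ G.neighborSet q) := by
    simp only [vertexLocSet, Set.mem_ofPred_eq, SimpleGraph.mem_neighborSet] at hp hq
    simp [G.adj_comm _ v, hp.2, hq.2]
  unfold edgeLoc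
  rw [van_induce]
  unfold vertexLoc at *
  rw [van_induce, e, van_insert_iff hv hv' (fun w hw => Or.inl (Or.inl hw)),
    Fam_congr (T' := G.neighborSet p ∪ G.neighborSet q)]
  intro w hw
  have := hw v (by simp)
  simp [this]

variable [Fintype V]

lemma exists_card_eq (h : ∀ i < indepNumber G, ∀ N, Van k (Fam G N ∅) i) (hN : N ∈ indepComplex G) :
    ∃ F ∈ indepComplex G, N ⊆ F ∧ F.card = indepNumber G := by
  obtain ⟨F, hNF, hF⟩ := exists_maxIn (T := ∅) hN (by simp)
  exact ⟨F, hF.1, hNF, le_antisymm (card_le_indepNumber hF.1) (hF.card_le fun i hi => h i hi F)⟩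

omit [Fintype V] in
lemma map_vertexLoc {v : V} {F : Finset (vertexLocSet G v)} (hF : F ∈ indepComplex (vertexLoc G v)) :
    insert v (F.map (Function.Embedding.subtype _)) ∈ indepComplex G ∧
    (insert v (F.map (Function.Embedding.subtype (· ∈ vertexLocSet G v)))).card = F.card + 1 := by
  refine ⟨indep_insert.2 ⟨map_mem_indep.2 hF, ?_⟩, ?_⟩
  · simp only [Finset.mem_map]
    rintro _ ⟨x, -, rfl⟩
    exact x.2.2
  · rw [Finset.card_insert_of_notMem, Finset.card_map]
    simp only [Finset.mem_map]
    rintro ⟨x, -, e⟩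
    exact x.2.1 e

omit [Fintype V] in
lemma exists_vertexLoc {v : V} {F : Finset V} (hF : F ∈ indepComplex G) (hv : v ∈ F) :
    ∃ F' ∈ indepComplex (vertexLoc G v), F = insert v (F'.map (Function.Embedding.subtype (· ∈ vertexLocSet G v))) := by
  obtain ⟨F', h⟩ := exists_map_eq (s := vertexLocSet G v) (F := F.erase v) fun x hx =>
    ⟨(Finset.mem_erase.1 hx).1, hF v hv x (Finset.mem_erase.1 hx).2⟩
  refine ⟨F', map_mem_indep.1 ?_, ?_⟩
  · exact h ▸ indep_mono hF (Finset.erase_subset _ _)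
  · rw [h, Finset.insert_erase hv]

lemma indepNumber_vertexLoc (h : ∀ i < indepNumber G, ∀ N, Van k (Fam G N ∅) i) (v : V) :
    indepNumber (vertexLoc G v) + 1 = indepNumber G := by
  obtain ⟨F, hF, hvF, hd⟩ := exists_card_eq (N := {v}) h (by simp [indepComplex])
  obtain ⟨F', hF', rfl⟩ := exists_vertexLoc hF (by simpa using hvF)
  have h1 : indepNumber (vertexLoc G v) = F'.card := indepNumber_eq ⟨F', hF', rfl⟩ fun F₁ hF₁ => by
    have h1 := map_vertexLoc hF₁
    have h2 := card_le_indepNumber h1.1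
    rw [h1.2, ← hd, (map_vertexLoc hF').2] at h2
    omega
  rw [h1, ← hd, (map_vertexLoc hF').2]

end

section
variable {V : Type} [LinearOrder V] [Fintype V] {G : SimpleGraph V}

omit [LinearOrder V] [Fintype V] in
lemma exists_edgeLoc {v : V} {p q : vertexLocSet G v} {F : Finset (vertexLocSet G v)}
    (hF : F ∈ indepComplex (vertexLoc G v)) (h : ∀ x ∈ F, ¬ G.Adj p x ∧ ¬ G.Adj q x) :
    ∃ F' ∈ indepComplex (edgeLoc (vertexLoc G v) p q), F'.map (Function.Embedding.subtype _) = F := by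
  obtain ⟨F', e⟩ := exists_map_eq (s := edgeLocSet (vertexLoc G v) p q) fun x hx => mem_edgeLocSet_vertexLoc.2 (h x hx)
  exact ⟨F', map_mem_indep.1 (e ▸ hF), e⟩

theorem negCond_of_special (hG : graphCM G)
    (h : ∀ v, specialCM (vertexLoc G v) ∧ (vertexLoc G v).CliqueFree 3) (k : Type) [Field k] :
    NegCond k G (indepNumber G) := by
  have hG' := graphCM_iff.1 hG
  refine ⟨fun N _ i hi => hG' k i hi N, fun v x y z hxy hyz hxz => ?_, fun N hN p q hpq i hi => ?_⟩
  · by_contra hc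
    push Not at hc
    obtain ⟨h1, h2, h3⟩ := hc
    have hx : x ∈ vertexLocSet G v := ⟨by rintro rfl; exact h2 hxy, h1⟩
    have hy : y ∈ vertexLocSet G v := ⟨by rintro rfl; exact h3 hyz, h2⟩
    have hz : z ∈ vertexLocSet G v := ⟨by rintro rfl; exact h1 hxz.symm, h3⟩
    exact (h v).2 {⟨x, hx⟩, ⟨y, hy⟩, ⟨z, hz⟩} (SimpleGraph.is3Clique_triple_iff.2
      ⟨show (vertexLoc G v).Adj ⟨x, hx⟩ ⟨y, hy⟩ from hxy,
        show (vertexLoc G v).Adj ⟨x, hx⟩ ⟨z, hz⟩ from hxz,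
        show (vertexLoc G v).Adj ⟨y, hy⟩ ⟨z, hz⟩ from hyz⟩)
  · obtain _ | i := i
    · exact van_zero_Fam hN
    by_cases hNi : N ∈ indepComplex G
    swap
    · exact Fam_eq_empty (G := G) (Or.inl hNi) ▸ van_empty _
    by_cases hNT : ∃ x ∈ N, x ∈ G.neighborSet p ∪ G.neighborSet q
    · exact Fam_eq_empty (Or.inr hNT) ▸ van_empty _
    push Not at hNT
    obtain ⟨v, hv⟩ := hN
    have hvT := hNT v hv
    simp only [Set.mem_union, SimpleGraph.mem_neighborSet, not_or] at hvT hNT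
    have hp : p ∈ vertexLocSet G v := ⟨by rintro rfl; exact hvT.2 hpq.symm, fun h => hvT.1 h.symm⟩
    have hq : q ∈ vertexLocSet G v := ⟨by rintro rfl; exact hvT.1 hpq, fun h => hvT.2 h.symm⟩
    obtain ⟨N', hN', rfl⟩ := exists_vertexLoc hNi hv
    obtain ⟨N'', hN'', rfl⟩ := exists_edgeLoc (p := ⟨p, hp⟩) (q := ⟨q, hq⟩) hN' fun x hx =>
      hNT _ (Finset.mem_insert_of_mem (Finset.mem_map_of_mem _ hx))
    have := Fintype.ofFinite (edgeLocSet (vertexLoc G v) ⟨p, hp⟩ ⟨q, hq⟩)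
    obtain ⟨h1, h2⟩ := (h v).1.2 ⟨p, hp⟩ ⟨q, hq⟩ hpq
    have h3 := indepNumber_vertexLoc (hG' k) v
    exact van_edgeLoc.1 (graphCM_iff.1 h1 k i (by omega) N'')

theorem special_of_negCond (hG : graphCM G) (h : ∀ (k : Type) [Field k], NegCond k G (indepNumber G)) (v : V) :
    specialCM (vertexLoc G v) ∧ (vertexLoc G v).CliqueFree 3 := by
  have hG' := graphCM_iff.1 hG
  have hv := indepNumber_vertexLoc (hG' ℚ) v
  refine ⟨⟨?_, fun p q hpq => ?_⟩, fun s hs => ?_⟩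
  · have := Fintype.ofFinite (vertexLocSet G v)
    exact graphCM_iff.2 fun k _ i hi N => van_vertexLoc.2 (hG' k _ (by omega) _)
  · have hpq' : G.Adj p q := hpq
    have hcard : indepNumber (edgeLoc (vertexLoc G v) p q) + 1 = indepNumber (vertexLoc G v) := by
      have hle : ∀ F ∈ indepComplex (edgeLoc (vertexLoc G v) p q), F.card + 1 ≤ indepNumber (vertexLoc G v) := by
        intro F hF
        have hF' : F.map (Function.Embedding.subtype _) ∈ indepComplex (vertexLoc G v) := map_mem_indep.2 hF
        have hadj : ∀ x ∈ F.map (Function.Embedding.subtype _), ¬ G.Adj p x ∧ ¬ G.Adj q x := by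
          simp only [Finset.mem_map]
          rintro _ ⟨x, -, rfl⟩
          exact mem_edgeLocSet_vertexLoc.1 x.2
        have := card_le_indepNumber (indep_insert.2 ⟨hF', fun w hw => (hadj w hw).1⟩)
        rwa [Finset.card_insert_of_notMem fun hp => (hadj p hp).2 hpq'.symm, Finset.card_map] at this
      obtain ⟨F, hvF, hF⟩ := exists_maxIn (G := G) (N := {v}) (T := G.neighborSet p ∪ G.neighborSet q)
        (by simp [indepComplex]) (by simpa [G.adj_comm _ v] using ⟨p.2.2, q.2.2⟩)
      have hFc := hF.card_le (m := indepNumber G - 1) fun i hi => (h ℚ).edge F ⟨v, by simpa using hvF⟩ p q hpq' i (by omega)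
      obtain ⟨F', hF', rfl⟩ := exists_vertexLoc hF.1 (by simpa using hvF)
      obtain ⟨F'', hF'', rfl⟩ := exists_edgeLoc (p := p) (q := q) hF' fun x hx => by
        simpa using hF.2.1 _ (Finset.mem_insert_of_mem (Finset.mem_map_of_mem _ hx))
      have h1 := hle F'' hF''
      rw [(map_vertexLoc hF').2, Finset.card_map] at hFc
      rw [indepNumber_eq ⟨F'', hF'', rfl⟩ fun F hF => by have := hle F hF; omega]
      omega
    refine ⟨?_, hcard⟩
    have := Fintype.ofFinite (edgeLocSet (vertexLoc G v) p q)
    exact graphCM_iff.2 fun k _ i hi N => van_edgeLoc.2 ((h k).edge _ ⟨v, by simp⟩ p q hpq' _ (by omega))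
  · obtain ⟨x, y, z, hxy, hxz, hyz, -⟩ := SimpleGraph.is3Clique_iff.1 hs
    rcases (h ℚ).tri v x y z hxy hyz hxz with h1 | h1 | h1
    · exact x.2.2 h1
    · exact y.2.2 h1
    · exact z.2.2 h1

end

section
variable {V : Type} [LinearOrder V] (G : SimpleGraph V) (d : ℕ)

/-- The combinatorial conditions on the links of nonempty independent sets which are forced by
`NegCond`; they do not involve the field. -/
structure LinkCond : Prop where
  card_le : ∀ F ∈ indepComplex G, F.card ≤ d
  tri : ∀ v x y z, G.Adj x y → G.Adj y z → G.Adj x z → G.Adj v x ∨ G.Adj v y ∨ G.Adj v z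
  pure : ∀ F : Finset V, F.Nonempty → MaxIn G ∅ F → d ≤ F.card
  edge : ∀ F : Finset V, F.Nonempty → ∀ p q, G.Adj p q →
    MaxIn G (G.neighborSet p ∪ G.neighborSet q) F → d ≤ F.card + 1

variable {G d} {k : Type} [Field k] {N : Finset V} {T : Set V}

theorem NegCond.linkCond (h : NegCond k G d) (hd : ∀ F ∈ indepComplex G, F.card ≤ d) : LinkCond G d where
  card_le := hd
  tri := h.tri
  pure F hF hm := hm.card_le fun i hi => h.lk F hF i hi
  edge F hF p q hpq hm := by
    have := hm.card_le (m := d - 1) fun i hi => h.edge F hF p q hpq i (by omega)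
    omega

lemma van_chain [Finite V] {T₀ T₁ : Set V} (h01 : T₀ ⊆ T₁)
    (h : ∀ T, T₀ ⊆ T → T ⊆ T₁ → ∀ x ∈ T₁, x ∉ T → ∀ i, Van k (Fam G (insert x N) T) i) :
    (∀ i, Van k (Fam G N T₀) i) ↔ ∀ i, Van k (Fam G N T₁) i := by
  have key : ∀ D : Finset V, (D : Set V) ⊆ T₁ \ T₀ →
      ((∀ i, Van k (Fam G N T₀) i) ↔ ∀ i, Van k (Fam G N (T₀ ∪ D)) i) := by
    intro D
    induction D using Finset.induction_on with
    | empty => simp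
    | insert x D hx ih =>
      intro hD
      rw [Finset.coe_insert, Set.insert_subset_iff] at hD
      have hT := h (T₀ ∪ D) Set.subset_union_left (Set.union_subset h01 (hD.2.trans Set.sdiff_subset)) x hD.1.1
        (by simp [hx, hD.1.2])
      rw [ih hD.2, Finset.coe_insert, Set.union_insert]
      exact ⟨fun H i => (Fam_spl x).van_lower (H i) (hT _), fun H i => (Fam_spl x).van (H i) (hT i)⟩
  have := key (Set.toFinite (T₁ \ T₀)).toFinset (by simp)
  rwa [Set.Finite.coe_toFinset, Set.union_sdiff_cancel h01] at this

/-- A vertex of the link of `F` that is isolated there is isolated in the link of each vertex of `F`. -/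
lemma LinkCond.isolated [Finite V] (hL : LinkCond G d) {F : Finset V} (hF : F ∈ indepComplex G) {v u : V} (hv : v ∈ F)
    (hu : u ∉ F) (huF : ∀ x ∈ F, ¬ G.Adj x u) (h : ∀ w, G.Adj u w → ∃ x ∈ F, G.Adj x w) {w : V} (hw : G.Adj u w) :
    G.Adj v w := by
  by_contra hvw
  obtain ⟨F', hF', hmax⟩ := Set.Finite.exists_maximalFor Finset.card
    {F' | F' ⊆ F ∧ v ∈ F' ∧ ∃ w, G.Adj u w ∧ ∀ x ∈ F', ¬ G.Adj x w}
    (Set.toFinite _) ⟨{v}, by simpa using hv, by simp, w, hw, by simpa using hvw⟩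
  obtain ⟨h1, h2, w, h3, h4⟩ := hF'
  obtain ⟨f, hf, hfw⟩ := h w h3
  have hfF : f ∉ F' := fun hf' => h4 f hf' hfw
  have hall : ∀ z, G.Adj u z → (∀ x ∈ F', ¬ G.Adj x z) → G.Adj f z := by
    intro z hz hzF
    by_contra hc
    have := hmax (j := insert f F') ⟨Finset.insert_subset hf h1, by simp [h2], z, hz, by simpa [hc] using hzF⟩
      (Finset.card_le_card (Finset.subset_insert _ _))
    rw [Finset.card_insert_of_notMem hfF] at this
    omega
  obtain ⟨M, hM, hm⟩ := exists_maxIn (G := G) (N := F') (T := G.neighborSet f ∪ G.neighborSet w)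
    (indep_mono hF h1) (by
      intro x hx
      simp only [Set.mem_union, SimpleGraph.mem_neighborSet, not_or]
      exact ⟨hF f hf x (h1 hx), fun h => h4 x hx h.symm⟩)
  have hc := hL.edge M ⟨v, hM h2⟩ f w hfw hm
  have hMT : ∀ x ∈ M, ¬ G.Adj f x ∧ ¬ G.Adj w x := fun x hx => by simpa using hm.2.1 x hx
  have hMu : ∀ x ∈ M, ¬ G.Adj u x := fun x hx hux =>
    (hMT x hx).1 (hall x hux fun y hy => hm.1 y (hM hy) x hx)
  have h5 : insert u M ∈ indepComplex G := indep_insert.2 ⟨hm.1, hMu⟩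
  have h6 : insert f (insert u M) ∈ indepComplex G := indep_insert.2 ⟨h5, by
    simpa [huF f hf] using fun x hx => (hMT x hx).1⟩
  have h7 := hL.card_le _ h6
  rw [Finset.card_insert_of_notMem, Finset.card_insert_of_notMem] at h7
  · omega
  · exact fun huM => (hMT u huM).2 h3.symm
  · simp only [Finset.mem_insert, not_or]
    exact ⟨fun e => hu (e ▸ hf), fun hfM => (hMT f hfM).2 hfw.symm⟩

variable [Fintype V]

theorem LinkCond.van_of_mem (hL : LinkCond G d) (hN : N ∈ indepComplex G) {v t w : V} (hv : v ∈ N)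
    (htN : t ∉ N) (htN' : ∀ x ∈ N, ¬ G.Adj x t) (htw : G.Adj t w) (hvw : ¬ G.Adj v w) (htT : t ∈ T)
    (hT : ∀ x ∈ T, (∀ z ∈ N, ¬ G.Adj z x) → ¬ G.Adj t x) : ∀ i, Van k (Fam G N T) i := by
  induction hn : Nᶜ.card using Nat.strong_induction_on generalizing N T with
  | _ n ih =>
  subst hn
  have hlt : ∀ x ∉ N, (insert x N)ᶜ.card < Nᶜ.card := fun x hx =>
    Finset.card_lt_card (Finset.compl_ssubset_compl.2 (Finset.ssubset_insert hx))
  by_cases hNT : ∃ x ∈ N, x ∈ T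
  · exact fun i => Fam_eq_empty (Or.inr hNT) ▸ van_empty i
  push Not at hNT
  have step : ∀ T₀ : Set V, t ∈ T₀ → ∀ x, x ∉ N → x ∉ T₀ → ((∀ z ∈ N, ¬ G.Adj z x) → ¬ G.Adj t x) →
      (∀ y ∈ T₀, (∀ z ∈ N, ¬ G.Adj z y) → ¬ G.Adj t y) → ∀ i, Van k (Fam G (insert x N) T₀) i := by
    intro T₀ ht₀ x hxN hxT htx hT₀
    by_cases hx : ∀ z ∈ N, ¬ G.Adj z x
    · refine ih _ (hlt x hxN) (indep_insert.2 ⟨hN, fun w hw h => hx w hw h.symm⟩) (Finset.mem_insert_of_mem hv) ?_ ?_ ht₀ ?_ rfl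
      · simp only [Finset.mem_insert, not_or]
        exact ⟨fun e => hxT (e ▸ ht₀), htN⟩
      · simpa [G.adj_comm x t, htx hx] using htN'
      · exact fun y hy hz => hT₀ y hy fun z hz' => hz z (Finset.mem_insert_of_mem hz')
    · push Not at hx
      obtain ⟨z, hz, hzx⟩ := hx
      exact fun i => Fam_eq_empty (T := T₀) (Or.inl fun h => (indep_insert.1 h).2 z hz hzx.symm) ▸ van_empty i
  have h0 : ∀ i, Van k (Fam G N {t}) i := by
    obtain ⟨b, hb, hbN⟩ : ∃ b, G.Adj t b ∧ ∀ x ∈ N, ¬ G.Adj x b := by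
      by_contra hc
      push Not at hc
      exact hvw (hL.isolated hN hv htN htN' hc htw)
    have hnb : ∀ x, G.Adj b x → (∀ z ∈ N, ¬ G.Adj z x) → ¬ G.Adj t x := by
      intro x hbx hx htx
      rcases hL.tri v t b x hb hbx htx with h | h | h
      · exact htN' v hv h
      · exact hbN v hv h
      · exact hx v hv h
    refine (van_chain (T₁ := {x | G.Adj b x ∧ ∀ z ∈ N, ¬ G.Adj z x}) ?_ ?_).2 ?_
    · rintro _ rfl
      exact ⟨hb.symm, htN'⟩
    · intro T₀ h1 h2 x hx hxT
      exact step T₀ (h1 rfl) x (fun h => hbN x h hx.1.symm) hxT (fun hz => hnb x hx.1 hz) fun y hy hz => hnb y (h2 hy).1 hz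
    · refine (Fam_cone (v := b) (fun h => htN' b h hb.symm) (by simp) fun w hw => ?_).van
      by_cases hc : ∃ x ∈ N, G.Adj x w
      · exact Or.inr hc
      · push Not at hc
        exact Or.inl ⟨hw, hc⟩
  refine (van_chain (T₁ := T) (by simpa using htT) ?_).1 h0
  intro T₀ h1 h2 x hx hxT
  exact step T₀ (h1 rfl) x (fun h => hNT x h hx) hxT (hT x hx) fun y hy => hT y (h2 hy)

theorem LinkCond.van (hL : LinkCond G d) (hN : N.Nonempty) {i : ℕ} (hi : i < d) : Van k (Fam G N ∅) i := by
  induction hn : Nᶜ.card using Nat.strong_induction_on generalizing N with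
  | _ n ih =>
  subst hn
  by_cases hNi : N ∈ indepComplex G
  swap
  · exact Fam_eq_empty (T := ∅) (Or.inl hNi) ▸ van_empty i
  obtain ⟨v, hv⟩ := hN
  by_cases h1 : ∃ t ∉ N, (∀ x ∈ N, ¬ G.Adj x t) ∧ ∃ w, G.Adj t w ∧ ¬ G.Adj v w
  · obtain ⟨t, ht, htN, w, htw, hvw⟩ := h1
    refine (Fam_spl t).van ?_ (ih _ (Finset.card_lt_card (Finset.compl_ssubset_compl.2 (Finset.ssubset_insert ht)))
      ⟨t, Finset.mem_insert_self _ _⟩ rfl)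
    exact hL.van_of_mem hNi hv ht htN htw hvw (by simp) (by simp) i
  push Not at h1
  by_cases h2 : ∃ u ∉ N, ∀ x ∈ N, ¬ G.Adj x u
  · obtain ⟨u, hu, huN⟩ := h2
    exact (Fam_cone hu (by simp) fun w hw => Or.inr ⟨v, hv, h1 u hu huN w hw⟩).van i
  push Not at h2
  have := hL.pure N ⟨v, hv⟩ ⟨hNi, by simp, fun w hw _ => h2 w hw⟩
  rw [Fam_eq_singleton hNi (by simp) fun w hw _ => h2 w hw, van_singleton_iff]
  omega

variable (k) in
theorem LinkCond.negCond (hL : LinkCond G d) : NegCond k G d where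
  lk _ hN _ hi := hL.van hN hi
  tri := hL.tri
  edge N hN p q hpq i hi := by
    by_cases hNi : N ∈ indepComplex G
    swap
    · exact Fam_eq_empty (G := G) (Or.inl hNi) ▸ van_empty _
    by_cases hNT : ∃ x ∈ N, x ∈ G.neighborSet p ∪ G.neighborSet q
    · exact Fam_eq_empty (Or.inr hNT) ▸ van_empty _
    push Not at hNT
    simp only [Set.mem_union, SimpleGraph.mem_neighborSet, not_or] at hNT
    obtain ⟨v, hv⟩ := hN
    have e : G.neighborSet p ∪ G.neighborSet q = insert p ((G.neighborSet p ∪ G.neighborSet q) \ {p}) := by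
      rw [Set.insert_sdiff_singleton, Set.insert_eq_of_mem]
      exact Or.inr hpq.symm
    have hT : ∀ w, G.Adj p w → w ∈ (G.neighborSet p ∪ G.neighborSet q) \ {p} := fun w hw => ⟨Or.inl hw, hw.ne'⟩
    rw [e, van_insert_iff (fun h => (hNT p h).2 hpq.symm) (by simp) fun w hw => Or.inl (hT w hw)]
    have hpN : insert p N ∈ indepComplex G := indep_insert.2 ⟨hNi, fun x hx => (hNT x hx).1⟩
    by_cases ht : ∃ t, G.Adj q t ∧ t ≠ p ∧ ∀ x ∈ insert p N, ¬ G.Adj x t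
    · obtain ⟨t, hqt, htp, ht⟩ := ht
      have htT : t ∈ (G.neighborSet p ∪ G.neighborSet q) \ {p} := ⟨Or.inr hqt, htp⟩
      refine hL.van_of_mem hpN (v := v) (t := t) (w := q) (Finset.mem_insert_of_mem hv) ?_ ht hqt.symm
        (fun h => (hNT v hv).2 h.symm) htT ?_ _
      · simp only [Finset.mem_insert, not_or]
        exact ⟨htp, fun h => (hNT t h).2 hqt⟩
      · rintro x ⟨hx, -⟩ hxN htx
        have hqx : G.Adj q x := hx.resolve_left (hxN p (Finset.mem_insert_self _ _))
        rcases hL.tri v q t x hqt htx hqx with h | h | h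
        · exact (hNT v hv).2 h.symm
        · exact ht v (Finset.mem_insert_of_mem hv) h
        · exact hxN v (Finset.mem_insert_of_mem hv) h
    · push Not at ht
      rw [Fam_congr (T' := ∅)]
      · exact hL.van ⟨p, Finset.mem_insert_self _ _⟩ hi
      · intro w hw
        simp only [Set.mem_sdiff, Set.mem_union, SimpleGraph.mem_neighborSet, Set.mem_singleton_iff,
          Set.mem_empty_iff_false, iff_false]
        rintro ⟨h1 | h1, h2⟩
        · exact hw p (Finset.mem_insert_self _ _) h1
        · obtain ⟨x, hx, hxw⟩ := ht w h1 h2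
          exact hw x hx hxw

end

section
variable {V : Type} [LinearOrder V] {G : SimpleGraph V} {k : Type} [Field k] {N : Finset V}

/-- The vertices of the link of `N`. -/
def Lk (G : SimpleGraph V) (N : Finset V) (x : V) : Prop := x ∉ N ∧ ∀ z ∈ N, ¬ G.Adj z x

lemma sg_smul_inj {F : Finset V} {x : V} {a b : k} (h : sg F x • a = sg F x • b) : a = b := by
  have h1 := congrArg (sg F x • ·) h
  simpa only [← mul_smul, sg_mul_self, one_smul] using h1

lemma insert_mem_Fam {x : V} (hN : N ∈ indepComplex G) (hx : Lk G N x) : insert x N ∈ Fam G N ∅ :=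
  ⟨indep_insert.2 ⟨hN, fun w hw h => hx.2 w hw h.symm⟩, Finset.subset_insert _ _, by simp⟩

lemma dl_insert {f : Finset V → k} {x : V} (hx : x ∉ N) (hf : ∀ F, ¬ N ⊆ F → f F = 0) :
    dl f (insert x N) = sg (insert x N) x • f N := by
  unfold dl
  rw [Finset.sum_eq_single x]
  · rw [Finset.erase_insert hx]
  · intro j hj hjx
    rw [hf, smul_zero]
    intro h
    exact (Finset.mem_erase.1 (h ((Finset.mem_insert.1 hj).resolve_left hjx))).1 rfl
  · simp

/-- Connectivity of the nonadjacency graph on the link of `N`. -/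
theorem conn_of_van (hN : N ∈ indepComplex G) (hv : Van k (Fam G N ∅) (N.card + 1)) (C : V → Prop)
    (hC : ∀ x y, Lk G N x → Lk G N y → x ≠ y → ¬ G.Adj x y → C x → C y) {x y : V} (hx : Lk G N x) (hy : Lk G N y)
    (h : C x) : C y := by
  classical
  set ψ₀ : Finset V → k := fun F => if F = N then 1 else 0 with hψ₀
  have hψ₀N : ∀ F, ¬ N ⊆ F → ψ₀ F = 0 := fun F hF => if_neg fun e => hF e.ge
  have hdψ₀ : ∀ F, ¬ N ⊆ F → dl ψ₀ F = 0 := fun F hF =>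
    dl_eq_zero fun j _ => hψ₀N _ fun h => hF (h.trans (Finset.erase_subset _ _))
  obtain ⟨ψ, hs, hd⟩ := hv (fun F => if F ∈ Fam G N ∅ ∧ ∃ x ∈ F, x ∉ N ∧ C x then dl ψ₀ F else 0) (by
    refine ⟨fun F hF => if_neg fun h => hF h.1, fun F hF hc => ?_⟩
    have hlk : ∀ z ∈ F, z ∉ N → Lk G N z := fun z hz hzN => ⟨hzN, fun w hw => hF.1 w (hF.2.1 hw) z hz⟩
    by_cases hex : ∃ x ∈ F, x ∉ N ∧ C x
    · obtain ⟨x, hx, hxN, hCx⟩ := hex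
      rw [dl_congr (g := dl ψ₀), dl_dl]
      · rfl
      intro j hj
      by_cases hjN : N ⊆ F.erase j
      · refine if_pos ⟨⟨indep_mono hF.1 (Finset.erase_subset _ _), hjN, by simp⟩, ?_⟩
        obtain ⟨z, hz, hzN⟩ : ∃ z ∈ F.erase j, z ∉ N := Finset.exists_mem_notMem_of_card_lt_card (by
          rw [Finset.card_erase_of_mem hj]; omega)
        refine ⟨z, hz, hzN, ?_⟩
        have hzF := Finset.mem_of_mem_erase hz
        by_cases e : x = z
        · exact e ▸ hCx
        · exact hC x z (hlk x hx hxN) (hlk z hzF hzN) e (hF.1 x hx z hzF) hCx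
      · rw [hdψ₀ _ hjN, ite_self]
    · exact dl_eq_zero fun j _ => if_neg fun h => hex (by
        obtain ⟨-, z, hz, h⟩ := h
        exact ⟨z, Finset.mem_of_mem_erase hz, h⟩))
  have hs' : ∀ F, ¬ N ⊆ F → ψ F = 0 := fun F hF => hs F fun h => hF h.2.1
  have key : ∀ z, Lk G N z → ψ N = if C z then 1 else 0 := by
    intro z hz
    have h1 := hd _ (insert_mem_Fam hN hz) (Finset.card_insert_of_notMem hz.1)
    have h2 : (∃ x ∈ insert z N, x ∉ N ∧ C x) ↔ C z := by
      constructor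
      · rintro ⟨x, hx, hxN, hCx⟩
        exact (Finset.mem_insert.1 hx).resolve_right hxN ▸ hCx
      · exact fun h => ⟨z, Finset.mem_insert_self _ _, hz.1, h⟩
    simp only [h2] at h1
    rw [dl_insert hz.1 hs', dl_insert hz.1 hψ₀N] at h1
    by_cases hCz : C z
    · rw [if_pos ⟨insert_mem_Fam hN hz, hCz⟩] at h1
      rw [if_pos hCz, sg_smul_inj h1, hψ₀]
      exact if_pos rfl
    · rw [if_neg fun h => hCz h.2, ← smul_zero (sg (insert z N) z)] at h1
      rw [if_neg hCz, sg_smul_inj h1]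
  by_contra hCy
  have := (key x hx).symm.trans (key y hy)
  rw [if_pos h, if_neg hCy] at this
  exact one_ne_zero this

theorem van_empty_zero [hV : Nonempty V] : Van k (Fam G ∅ ∅) 0 := by
  obtain ⟨x⟩ := hV
  intro u hu
  refine ⟨0, fun _ _ => rfl, fun F hF hi => ?_⟩
  have h1 := hu.2 _ (insert_mem_Fam (x := x) empty_mem_indep ⟨by simp, by simp⟩) (by simp)
  rw [dl_insert (by simp) (by simp), ← smul_zero (sg (insert x ∅) x)] at h1
  rw [Finset.card_eq_zero.1 hi, sg_smul_inj h1]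
  simp [dl]

theorem van_empty_one (hc : ∀ C : V → Prop, (∀ x y, x ≠ y → ¬ G.Adj x y → C x → C y) → ∀ x y, C x → C y) :
    Van k (Fam G ∅ ∅) 1 := by
  intro u hu
  by_cases hV : IsEmpty V
  · exact ⟨0, fun _ _ => rfl, fun F _ hF => by simp [Finset.eq_empty_of_isEmpty F] at hF⟩
  rw [not_isEmpty_iff] at hV
  obtain ⟨x₀⟩ := hV
  have hsg : ∀ x : V, sg {x} x = 1 := fun x => by simp [sg, Finset.filter_singleton]
  have hu' : ∀ x, u {x} = u {x₀} := by
    refine fun x => hc (fun x => u {x} = u {x₀}) (fun x y hxy hadj hx => ?_) x₀ x rfl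
    have h1 := hu.2 {x, y} ⟨by simp [indepComplex, hadj, G.adj_comm y x], by simp, by simp⟩ (by simp [Finset.card_pair hxy])
    have h2 := sg_mul_sg (F := {x, y}) (i := x) (j := y) (by simp) (by simp) hxy
    have e1 : ({x, y} : Finset V).erase x = {y} := by ext z; simp; grind
    have e2 : ({x, y} : Finset V).erase y = {x} := by ext z; simp; grind
    rw [e1, e2, hsg, hsg, mul_one, mul_one] at h2
    rw [dl, Finset.sum_pair hxy, e1, e2, h2, neg_smul, neg_add_eq_zero] at h1
    rw [sg_smul_inj h1, hx]
  refine ⟨fun F => if F = ∅ then u {x₀} else 0, fun F hF => if_neg ?_, fun F hF hi => ?_⟩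
  · rintro rfl
    exact hF ⟨empty_mem_indep, by simp, by simp⟩
  · obtain ⟨x, rfl⟩ := Finset.card_eq_one.1 hi
    simp [dl, hsg, hu']

end

section
variable {V : Type} [LinearOrder V] (G : SimpleGraph V) (d : ℕ)

/-- The combinatorial conditions on the independence complex from which an edge in no triangle
can be found. -/
structure GlobalCond : Prop extends LinkCond G d where
  three_le : 3 ≤ d
  iso : noIsolated G
  exists_facet : ∀ N ∈ indepComplex G, ∃ F ∈ indepComplex G, N ⊆ F ∧ F.card = d
  conn : ∀ N ∈ indepComplex G, N.card + 2 ≤ d → ∀ C : V → Prop,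
    (∀ x y, Lk G N x → Lk G N y → x ≠ y → ¬ G.Adj x y → C x → C y) → ∀ x y, Lk G N x → Lk G N y → C x → C y

variable {G d}

namespace GlobalCond
variable (hG : GlobalCond G d)
include hG

omit [LinearOrder V] in
lemma conn_empty (C : V → Prop) (h : ∀ x y, x ≠ y → ¬ G.Adj x y → C x → C y) {x y : V} (hx : C x) : C y :=
  hG.conn ∅ empty_mem_indep (by have := hG.three_le; simp; omega) C (fun x y _ _ => h x y) x y ⟨by simp, by simp⟩
    ⟨by simp, by simp⟩ hx

lemma card_succ_le {F : Finset V} {x : V} (hF : F ∈ indepComplex G) (hx : x ∉ F) (hxF : ∀ w ∈ F, ¬ G.Adj x w) :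
    F.card + 1 ≤ d := by
  rw [← Finset.card_insert_of_notMem hx]
  exact hG.card_le _ (indep_insert.2 ⟨hF, hxF⟩)

lemma card_add_two_le {F : Finset V} {x y : V} (hF : F ∈ indepComplex G) (hx : x ∉ F) (hxF : ∀ w ∈ F, ¬ G.Adj x w)
    (hy : y ∉ F) (hyF : ∀ w ∈ F, ¬ G.Adj y w) (hxy : x ≠ y) (hadj : ¬ G.Adj x y) : F.card + 2 ≤ d := by
  have := hG.card_succ_le (F := insert x F) (x := y) (indep_insert.2 ⟨hF, hxF⟩) (by simp [hy, hxy.symm])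
    (by simpa [G.adj_comm y x, hadj] using hyF)
  rwa [Finset.card_insert_of_notMem hx] at this

variable [Finite V]

lemma exists_adj {v u : V} (hvu : v ≠ u) (hadj : ¬ G.Adj v u) : ∃ w, G.Adj u w ∧ ¬ G.Adj v w := by
  by_contra hc
  push Not at hc
  have h1 : ∀ x, x ≠ u → ¬ G.Adj u x → ∀ w, G.Adj u w → G.Adj x w := by
    intro x hxu hux
    refine hG.conn {u} (by simp [indepComplex]) (by have := hG.three_le; simp; omega) (fun x => ∀ w, G.Adj u w → G.Adj x w)
      ?_ v x ⟨by simpa using hvu, by simpa [G.adj_comm u v] using hadj⟩ ⟨by simpa using hxu, by simpa using hux⟩ hc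
    intro x y hx hy hxy hxy' hCx w hw
    have hx1 : x ≠ u := by simpa using hx.1
    have hx2 : ¬ G.Adj u x := by simpa using hx.2
    have hy1 : y ≠ u := by simpa using hy.1
    have hy2 : ¬ G.Adj u y := by simpa using hy.2
    exact hG.isolated (F := {x, y}) (v := y) (u := u) (by simp [indepComplex, hxy', G.adj_comm y x]) (by simp)
      (by simp [hx1.symm, hy1.symm]) (by simp [G.adj_comm _ u, hx2, hy2]) (fun z hz => ⟨x, by simp, hCx z hz⟩) hw
  obtain ⟨w, hw⟩ := hG.iso u
  have : ¬ G.Adj u w := by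
    refine hG.conn_empty (fun x => ¬ G.Adj u x) (fun x y hxy hxy' hx hy => ?_) (x := u) G.irrefl
    by_cases hxu : x = u
    · exact hxy' (hxu ▸ hy)
    · exact hxy' (h1 x hxu hx y hy)
  exact this hw

lemma exists_adj_of_lk {F : Finset V} (hF : F ∈ indepComplex G) (hne : F.Nonempty) {u : V} (hu : Lk G F u) :
    ∃ w, G.Adj u w ∧ ∀ x ∈ F, ¬ G.Adj x w := by
  by_contra hc
  push Not at hc
  obtain ⟨v, hv⟩ := hne
  obtain ⟨w, h1, h2⟩ := hG.exists_adj (v := v) (u := u) (fun h => hu.1 (h ▸ hv)) (hu.2 v hv)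
  exact h2 (hG.isolated hF hv hu.1 hu.2 hc h1)

omit [Finite V] in
/-- A property of facets containing `N` that passes to adjacent facets holds for all of them. -/
lemma facet_induction (Q : Finset V → Prop) {N B B' : Finset V}
    (h : ∀ B B', B ∈ indepComplex G → B' ∈ indepComplex G → N ⊆ B → N ⊆ B' → B.card = d → B'.card = d →
      d ≤ (B ∩ B').card + 1 → Q B → Q B')
    (hB : B ∈ indepComplex G) (hB' : B' ∈ indepComplex G) (hNB : N ⊆ B) (hNB' : N ⊆ B') (hc : B.card = d)
    (hc' : B'.card = d) (hQ : Q B) : Q B' := by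
  induction hn : d - N.card using Nat.strong_induction_on generalizing N B B' with
  | _ n ih =>
  subst hn
  by_cases h1 : d ≤ N.card + 1
  · exact h B B' hB hB' hNB hNB' hc hc'
      (h1.trans (Nat.succ_le_succ (Finset.card_le_card (Finset.subset_inter hNB hNB')))) hQ
  push Not at h1
  have hN : N ∈ indepComplex G := indep_mono hB hNB
  have hlk : ∀ M ∈ indepComplex G, N ⊆ M → ∀ x ∈ M, x ∉ N → Lk G N x := fun M hM hNM x hx hxN =>
    ⟨hxN, fun z hz => hM z (hNM hz) x hx⟩
  obtain ⟨x, hx, hxN⟩ : ∃ x ∈ B, x ∉ N := Finset.exists_mem_notMem_of_card_lt_card (by omega)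
  obtain ⟨y, hy, hyN⟩ : ∃ y ∈ B', y ∉ N := Finset.exists_mem_notMem_of_card_lt_card (by omega)
  have step : ∀ z, z ∉ N → ∀ M, M ∈ indepComplex G → insert z N ⊆ M → M.card = d → Q M →
      ∀ M', M' ∈ indepComplex G → insert z N ⊆ M' → M'.card = d → Q M' := by
    intro z hz M hM hzM hMc hQM M' hM' hzM' hMc'
    refine ih _ ?_ (N := insert z N) (fun B B' hB hB' h1 h2 => h B B' hB hB' ((Finset.subset_insert _ _).trans h1)
      ((Finset.subset_insert _ _).trans h2)) hM hM' hzM hzM' hMc hMc' hQM rfl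
    rw [Finset.card_insert_of_notMem hz]
    omega
  have := hG.conn N hN (by omega) (fun z => ∀ M', M' ∈ indepComplex G → insert z N ⊆ M' → M'.card = d → Q M')
    (fun x y hx hy hxy hadj hCx => ?_) x y (hlk B hB hNB x hx hxN) (hlk B' hB' hNB' y hy hyN)
    (step x hxN B hB (Finset.insert_subset hx hNB) hc hQ)
  · exact this B' hB' (Finset.insert_subset hy hNB') hc'
  · obtain ⟨M, hM, hxyM, hMc⟩ := hG.exists_facet (insert x (insert y N)) (by
      refine indep_insert.2 ⟨indep_insert.2 ⟨hN, fun w hw h => hy.2 w hw h.symm⟩, ?_⟩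
      simpa [hadj] using fun w hw h => hx.2 w hw h.symm)
    rw [Finset.insert_subset_iff] at hxyM
    exact step y hy.1 M hM hxyM.2 hMc
      (hCx M hM (Finset.insert_subset hxyM.1 ((Finset.subset_insert _ _).trans hxyM.2)) hMc)

end GlobalCond
end

section
variable {V : Type} [LinearOrder V] {G : SimpleGraph V} {d : ℕ}

/-- The neighbors of `b` having no common nonneighbor with `b`. -/
def Far (G : SimpleGraph V) (b z : V) : Prop := G.Adj b z ∧ ∀ y, G.Adj b y ∨ G.Adj z y

/-- The neighbors of `b` having a common nonneighbor with `b`. -/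
def Near (G : SimpleGraph V) (b z : V) : Prop := G.Adj b z ∧ ∃ y, ¬ G.Adj b y ∧ ¬ G.Adj z y

omit [LinearOrder V] in
lemma far_or_near {b z : V} (h : G.Adj b z) : Far G b z ∨ Near G b z := by
  unfold Far Near
  by_cases hc : ∀ y, G.Adj b y ∨ G.Adj z y
  · exact Or.inl ⟨h, hc⟩
  · push Not at hc
    exact Or.inr ⟨h, hc⟩

omit [LinearOrder V] in
lemma Far.ne {b w u : V} (hw : Far G b w) (hu : Near G b u) : w ≠ u := by
  rintro rfl
  obtain ⟨y, h1, h2⟩ := hu.2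
  exact (hw.2 y).elim h1 h2

namespace GlobalCond
variable (hG : GlobalCond G d) [Finite V] {b w u : V}
include hG

lemma exists_common (hw : Far G b w) (hu : Near G b u) (huw : ¬ G.Adj u w) :
    ∃ A ∈ indepComplex G, A.card + 1 = d ∧ ∀ y, y ∈ A ↔ ¬ G.Adj b y ∧ ¬ G.Adj u y := by
  set A := (Set.toFinite {y | ¬ G.Adj b y ∧ ¬ G.Adj u y}).toFinset with hA
  have hmem : ∀ y, y ∈ A ↔ ¬ G.Adj b y ∧ ¬ G.Adj u y := by simp [hA]
  have hind : A ∈ indepComplex G := by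
    intro y hy y' hy' hyy
    rw [hmem] at hy hy'
    have h1 := (hw.2 y).resolve_left hy.1
    have h2 := (hw.2 y').resolve_left hy'.1
    rcases hG.tri u y y' w hyy h2.symm h1.symm with h | h | h
    · exact hy.2 h
    · exact hy'.2 h
    · exact huw h
  refine ⟨A, hind, le_antisymm ?_ ?_, hmem⟩
  · exact hG.card_succ_le hind (x := b) (by simp [hmem, hu.1.symm]) fun y hy => ((hmem y).1 hy).1
  · obtain ⟨y, hy⟩ := hu.2
    refine hG.edge A ⟨y, (hmem y).2 hy⟩ b u hu.1 ⟨hind, fun x hx => ?_, fun x hx hxT => ?_⟩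
    · simpa using (hmem x).1 hx
    · exact absurd ((hmem x).2 (by simpa using hxT)) hx

lemma crossing (hw : Far G b w) {B B' : Finset V} (hB : B ∈ indepComplex G) (hB' : B' ∈ indepComplex G)
    (hb : b ∈ B) (hb' : b ∈ B') (hc : B.card = d) (hc' : B'.card = d) (hBB : d ≤ (B ∩ B').card + 1)
    (h : ∃ u, G.Adj b u ∧ ¬ G.Adj u w ∧ ∀ a ∈ B, a ≠ b → ¬ G.Adj u a) :
    ∃ u, G.Adj b u ∧ ¬ G.Adj u w ∧ ∀ a ∈ B', a ≠ b → ¬ G.Adj u a := by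
  have hd := hG.three_le
  by_cases he : B ⊆ B'
  · rwa [← Finset.eq_of_subset_of_card_le he (by omega)]
  obtain ⟨v, hv, hvB'⟩ := Finset.not_subset.1 he
  obtain ⟨z, hz, hzB⟩ : ∃ z ∈ B', z ∉ B := by
    by_contra hcon
    push Not at hcon
    exact hvB' (Finset.eq_of_subset_of_card_le hcon (by omega) ▸ hv)
  have hcard : (B ∩ B').card + 1 = d := by
    have : B ∩ B' ⊂ B := Finset.ssubset_iff_subset_ne.2 ⟨Finset.inter_subset_left, fun e => he (Finset.inter_eq_left.1 e)⟩
    have := Finset.card_lt_card this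
    omega
  have eB : insert v (B ∩ B') = B := Finset.eq_of_subset_of_card_le
    (Finset.insert_subset hv Finset.inter_subset_left)
    (by rw [Finset.card_insert_of_notMem (by simp [hvB'])]; omega)
  have eB' : insert z (B ∩ B') = B' := Finset.eq_of_subset_of_card_le
    (Finset.insert_subset hz Finset.inter_subset_right)
    (by rw [Finset.card_insert_of_notMem (by simp [hzB])]; omega)
  have memB : ∀ x ∈ B, x ≠ v → x ∈ B ∩ B' := fun x hx hxv => by
    rw [← eB] at hx; exact Finset.mem_of_mem_insert_of_ne hx hxv
  have memB' : ∀ x ∈ B', x ≠ z → x ∈ B ∩ B' := fun x hx hxz => by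
    rw [← eB'] at hx; exact Finset.mem_of_mem_insert_of_ne hx hxz
  set F := (B ∩ B').erase b with hF
  have hFB : ∀ x ∈ F, x ∈ B ∧ x ∈ B' ∧ x ≠ b := by simp +contextual [hF]
  have hFc : F.card + 2 = d := by
    rw [hF, Finset.card_erase_of_mem (by simp [hb, hb'])]; omega
  have hFi : F ∈ indepComplex G := indep_mono hB fun x hx => (hFB x hx).1
  have hvb : v ≠ b := fun e => hvB' (e ▸ hb')
  have hzb : z ≠ b := fun e => hzB (e ▸ hb)
  have hvz : G.Adj v z := by
    by_contra hvz
    have := hG.card_succ_le hB hzB fun x hx hzx => by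
      by_cases hxv : x = v
      · exact hvz (hxv ▸ hzx.symm)
      · exact hB' z hz x (Finset.mem_inter.1 (memB x hx hxv)).2 hzx
    omega
  obtain ⟨u, hbu, huw, huB⟩ := h
  have huv := huB v hv hvb
  have hbv := hB b hb v hv
  obtain ⟨u', hvu', hu'⟩ := hG.exists_adj_of_lk (F := insert u F) (u := v)
    (indep_insert.2 ⟨hFi, fun x hx => huB x (hFB x hx).1 (hFB x hx).2.2⟩) ⟨u, by simp⟩ ⟨by
      simp only [Finset.mem_insert, not_or]
      exact ⟨fun e => hbv (e ▸ hbu), fun hvF => hvB' (hFB v hvF).2.1⟩, by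
      simpa [huv] using fun x hx => hB x (hFB x hx).1 v hv⟩
  have huu' : ¬ G.Adj u u' := hu' u (by simp)
  have hFu' : ∀ x ∈ F, ¬ G.Adj x u' := fun x hx => hu' x (Finset.mem_insert_of_mem hx)
  have hbu' : G.Adj b u' := by
    by_contra hcon
    obtain ⟨A, hA, -, hmem⟩ := hG.exists_common hw ⟨hbu, v, hbv, huv⟩ huw
    exact hA v ((hmem v).2 ⟨hbv, huv⟩) u' ((hmem u').2 ⟨hcon, huu'⟩) hvu'
  have hu'w : ¬ G.Adj u' w := by
    intro hcon
    have h1 := (hw.2 v).resolve_left hbv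
    rcases hG.tri u v u' w hvu' hcon h1.symm with h | h | h
    · exact huv h
    · exact huu' h
    · exact huw h
  obtain ⟨x₀, hx₀⟩ : F.Nonempty := Finset.card_pos.1 (by omega)
  obtain ⟨A, hA, hAc, hmem⟩ := hG.exists_common hw
    ⟨hbu', x₀, hB b hb x₀ (hFB x₀ hx₀).1, fun h => hFu' x₀ hx₀ h.symm⟩ hu'w
  have hFA : ∀ x ∈ F, x ∈ A := fun x hx => (hmem x).2 ⟨hB b hb x (hFB x hx).1, fun h => hFu' x hx h.symm⟩
  obtain ⟨y, hyA, hyF⟩ : ∃ y ∈ A, y ∉ F := Finset.exists_mem_notMem_of_card_lt_card (by omega)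
  obtain ⟨hby, hu'y⟩ := (hmem y).1 hyA
  have hyv : y ≠ v := fun e => hu'y (e ▸ hvu'.symm)
  have hyb : y ≠ b := fun e => hu'y (e ▸ hbu'.symm)
  have hyBB : y ∉ B ∩ B' := fun h => hyF (Finset.mem_erase.2 ⟨hyb, h⟩)
  have hyF' : ∀ x ∈ B ∩ B', ¬ G.Adj y x := by
    intro x hx hyx
    by_cases hxb : x = b
    · exact hby (hxb ▸ hyx.symm)
    · exact hA y hyA x (hFA x (Finset.mem_erase.2 ⟨hxb, hx⟩)) hyx
  have hyv' : G.Adj y v := by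
    by_contra hcon
    have := hG.card_succ_le hB (x := y) (fun h => hyBB (memB y h hyv)) fun x hx hyx => by
      by_cases hxv : x = v
      · exact hcon (hxv ▸ hyx)
      · exact hyF' x (memB x hx hxv) hyx
    omega
  have hyz : y = z := by
    by_contra hyz
    by_cases hadj : G.Adj y z
    · rcases hG.tri b y v z hyv' hvz hadj with h | h | h
      · exact hby h
      · exact hbv h
      · exact hB' b hb' z hz h
    · have := hG.card_succ_le hB' (x := y) (fun h => hyBB (memB' y h hyz)) fun x hx hyx => by
        by_cases hxz : x = z
        · exact hadj (hxz ▸ hyx)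
        · exact hyF' x (memB' x hx hxz) hyx
      omega
  refine ⟨u', hbu', hu'w, fun a ha hab hu'a => ?_⟩
  by_cases haz : a = z
  · exact hu'y (hyz ▸ haz ▸ hu'a)
  · exact hFu' a (Finset.mem_erase.2 ⟨hab, memB' a ha haz⟩) hu'a.symm

lemma near_not_adj (hw : Far G b w) (hu : Near G b u) (huw : ¬ G.Adj u w) {x : V} (hx : Near G b x) :
    ¬ G.Adj x w := by
  have hd := hG.three_le
  obtain ⟨A, hA, hAc, hmem⟩ := hG.exists_common hw hu huw
  obtain ⟨hbx, y₀, hby₀, hxy₀⟩ := hx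
  obtain ⟨M, hM, hm⟩ := exists_maxIn (G := G) (N := {y₀}) (T := G.neighborSet b ∪ G.neighborSet x)
    (by simp [indepComplex]) (by simp [hby₀, hxy₀])
  have hMx : ∀ y ∈ M, ¬ G.Adj b y ∧ ¬ G.Adj x y := fun y hy => by simpa using hm.2.1 y hy
  have hyM : y₀ ∈ M := by simpa using hM
  have hbM : b ∉ M := fun h => (hMx b h).2 hbx.symm
  have hc1 := hG.edge M ⟨y₀, hyM⟩ b x hbx hm
  have hc2 := hG.card_succ_le hm.1 hbM fun y hy => (hMx y hy).1
  have hbA : b ∉ A := fun h => ((hmem b).1 h).2 hu.1.symm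
  obtain ⟨u', h1, h2, h3⟩ := hG.facet_induction (N := {b})
    (fun B => ∃ u, G.Adj b u ∧ ¬ G.Adj u w ∧ ∀ a ∈ B, a ≠ b → ¬ G.Adj u a)
    (fun B B' hB hB' hb hb' hc hc' hBB => hG.crossing hw hB hB' (by simpa using hb) (by simpa using hb') hc hc' hBB)
    (B := insert b A) (B' := insert b M) (indep_insert.2 ⟨hA, fun y hy => ((hmem y).1 hy).1⟩)
    (indep_insert.2 ⟨hm.1, fun y hy => (hMx y hy).1⟩) (by simp) (by simp)
    (by rw [Finset.card_insert_of_notMem hbA, hAc]) (by rw [Finset.card_insert_of_notMem hbM]; omega)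
    ⟨u, hu.1, huw, fun a ha hab => ((hmem a).1 (Finset.mem_of_mem_insert_of_ne ha hab)).2⟩
  have h3' : ∀ a ∈ M, ¬ G.Adj u' a := fun a ha => h3 a (Finset.mem_insert_of_mem ha) fun e => hbM (e ▸ ha)
  by_cases hxu : x = u'
  · exact hxu ▸ h2
  by_cases hadj : G.Adj x u'
  · rcases hG.tri y₀ x u' b hadj h1.symm hbx.symm with h | h | h
    · exact absurd h.symm hxy₀
    · exact absurd h.symm (h3' y₀ hyM)
    · exact absurd h.symm hby₀
  · have := hG.card_add_two_le hm.1 (x := x) (y := u') (fun h => (hMx x h).1 hbx) (fun y hy => (hMx y hy).2)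
      (fun h => (hMx u' h).1 h1) h3' hxu hadj
    omega

/-- If some edge has no common nonneighbor, then some edge lies in no triangle. -/
theorem exists_edge_of_far (h : ∃ b w, Far G b w) : ∃ b p, G.Adj b p ∧ ∀ x, ¬ (G.Adj b x ∧ G.Adj p x) := by
  obtain ⟨b, w₀, hw₀⟩ := h
  obtain ⟨w, u, hw, hu, huw⟩ : ∃ w u, Far G b w ∧ Near G b u ∧ ¬ G.Adj u w := by
    by_contra hcon
    push Not at hcon
    have : Far G b b := hG.conn_empty (Far G b) (fun x y hxy hadj hx => by
      rcases hx.2 y with h | h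
      · exact (far_or_near h).elim id fun hy => absurd (hcon x y hx hy).symm hadj
      · exact absurd h hadj) hw₀
    exact G.irrefl this.1
  have hstar : ∀ x, Near G b x → ¬ G.Adj x w := fun x hx => hG.near_not_adj hw hu huw hx
  refine ⟨b, w, hw.1, ?_⟩
  rintro x ⟨hbx, hwx⟩
  have hxF : Far G b x := (far_or_near hbx).resolve_right fun hx => hstar x hx hwx.symm
  obtain ⟨A, hA, hAc, hmem⟩ := hG.exists_common hw hu huw
  have hd := hG.three_le
  obtain ⟨a, ha⟩ : A.Nonempty := Finset.card_pos.1 (by omega)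
  by_cases hx : ∃ u', Near G b u' ∧ ¬ G.Adj u' x
  · obtain ⟨u', hu', hu'x⟩ := hx
    have ha' := (hmem a).1 ha
    have h1 := hG.near_not_adj hxF hu' hu'x hu
    rcases hG.tri u w x a hwx ((hxF.2 a).resolve_left ha'.1) ((hw.2 a).resolve_left ha'.1) with h | h | h
    · exact huw h
    · exact h1 h
    · exact ha'.2 h
  · push Not at hx
    obtain ⟨x, x', hxF, hx, hne, hadj, hx'⟩ : ∃ x x', Far G b x ∧ (∀ v, Near G b v → G.Adj v x) ∧ x ≠ x' ∧
        ¬ G.Adj x x' ∧ ¬ (Far G b x' ∧ ∀ v, Near G b v → G.Adj v x') := by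
      by_contra hcon
      push Not at hcon
      have : Far G b b ∧ _ := hG.conn_empty (fun z => Far G b z ∧ ∀ v, Near G b v → G.Adj v z)
        (fun y z hyz hadj hy => hcon y z hy.1 hy.2 hyz hadj) ⟨hxF, hx⟩
      exact G.irrefl this.1.1
    have hbx' : G.Adj b x' := (hxF.2 x').resolve_right hadj
    have hx'F : Far G b x' := (far_or_near hbx').resolve_right fun h => hadj (hx x' h).symm
    obtain ⟨u₁, hu₁, hu₁x⟩ : ∃ v, Near G b v ∧ ¬ G.Adj v x' := by
      by_contra hcon
      push Not at hcon
      exact hx' ⟨hx'F, hcon⟩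
    have hx'N : ∀ v, Near G b v → ¬ G.Adj v x' := fun v hv => hG.near_not_adj hx'F hu₁ hu₁x hv
    have hind : ∀ p q, Near G b p → Near G b q → ¬ G.Adj p q := by
      intro p q hp hq hpq
      rcases hG.tri x' p q x hpq (hx q hq) (hx p hp) with h | h | h
      · exact hx'N p hp h.symm
      · exact hx'N q hq h.symm
      · exact hadj h.symm
    have hs : ∀ v ∈ A, ∃ s, Near G b s ∧ G.Adj v s ∧ ¬ G.Adj u s ∧ ∀ y ∈ A, y ≠ v → ¬ G.Adj y s := by
      intro v hv
      obtain ⟨hbv, huv⟩ := (hmem v).1 hv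
      obtain ⟨s, h1, h2⟩ := hG.exists_adj_of_lk (F := insert u (A.erase v)) (u := v)
        (indep_insert.2 ⟨indep_mono hA (Finset.erase_subset _ _), fun y hy => ((hmem y).1 (Finset.mem_of_mem_erase hy)).2⟩)
        ⟨u, by simp⟩ ⟨by
          simp only [Finset.mem_insert, Finset.mem_erase, not_or]
          exact ⟨fun e => hbv (e ▸ hu.1), fun h => h.1 rfl⟩, by
          simpa [huv] using fun y _ hy => hA y hy v hv⟩
      have h3 : ¬ G.Adj u s := h2 u (by simp)
      have h4 : ∀ y ∈ A, y ≠ v → ¬ G.Adj y s := fun y hy hyv => h2 y (by simp [hy, hyv])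
      refine ⟨s, ⟨?_, ?_⟩, h1, h3, h4⟩
      · by_contra hbs
        exact hA v hv s ((hmem s).2 ⟨hbs, h3⟩) h1
      · have h1A : 1 < A.card := by omega
        obtain ⟨y, hy, hyv⟩ := Finset.exists_mem_ne h1A v
        exact ⟨y, ((hmem y).1 hy).1, fun h => h4 y hy hyv h.symm⟩
    choose! s hs using hs
    have hinj : Set.InjOn s A := by
      intro y hy z hz e
      by_contra hyz
      exact (hs z hz).2.2.2 y hy hyz (e ▸ (hs y hy).2.1)
    have hN : ∀ p ∈ insert u (A.image s), Near G b p := by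
      intro p hp
      rcases Finset.mem_insert.1 hp with rfl | hp
      · exact hu
      · obtain ⟨y, hy, rfl⟩ := Finset.mem_image.1 hp
        exact (hs y hy).1
    have huA : u ∉ A.image s := by
      intro hp
      obtain ⟨y, hy, e⟩ := Finset.mem_image.1 hp
      exact ((hmem y).1 hy).2 (e ▸ (hs y hy).2.1).symm
    have := hG.card_succ_le (F := insert u (A.image s)) (x := x') (fun p hp q hq => hind p q (hN p hp) (hN q hq))
      (fun h => hx'F.ne (hN x' h) rfl) fun p hp h => hx'N p (hN p hp) h.symm
    rw [Finset.card_insert_of_notMem huA, Finset.card_image_of_injOn hinj] at this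
    omega

end GlobalCond
end

section
variable {V : Type} [LinearOrder V] {G : SimpleGraph V} {d : ℕ}

namespace GlobalCond
variable (hG : GlobalCond G d) [Finite V] {p q b c y : V}
include hG

lemma exists_indep (hpq : G.Adj p q) (h : ∃ y, ¬ G.Adj p y ∧ ¬ G.Adj q y) :
    ∃ A ∈ indepComplex G, d ≤ A.card + 1 ∧ ∀ a ∈ A, ¬ G.Adj p a ∧ ¬ G.Adj q a := by
  obtain ⟨y, h1, h2⟩ := h
  obtain ⟨M, hM, hm⟩ := exists_maxIn (G := G) (N := {y}) (T := G.neighborSet p ∪ G.neighborSet q)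
    (by simp [indepComplex]) (by simp [h1, h2])
  exact ⟨M, hm.1, hG.edge M ⟨y, hM (by simp)⟩ p q hpq hm, fun a ha => by simpa using hm.2.1 a ha⟩

lemma exists_finset_card_le (hy : ¬ G.Adj y p) (hyq : ¬ G.Adj y q) (hpq : G.Adj p q) :
    ∃ X : Finset V, X.card + 2 ≤ d ∧ ∀ z, ¬ G.Adj y z → G.Adj p z → z ≠ q → z ∈ X := by
  set X := (Set.toFinite {z | ¬ G.Adj y z ∧ G.Adj p z}).toFinset with hX
  have hmem : ∀ z, z ∈ X ↔ ¬ G.Adj y z ∧ G.Adj p z := by simp [hX]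
  have := hG.card_succ_le (F := X) (x := y) (fun z hz z' hz' hzz => by
      rw [hmem] at hz hz'
      rcases hG.tri y z z' p hzz hz'.2.symm hz.2.symm with h | h | h
      · exact hz.1 h
      · exact hz'.1 h
      · exact hy h)
    (fun h => hy ((hmem y).1 h).2.symm) fun z hz => ((hmem z).1 hz).1
  have hqX : q ∈ X := (hmem q).2 ⟨hyq, hpq⟩
  refine ⟨X.erase q, ?_, fun z h1 h2 h3 => Finset.mem_erase.2 ⟨h3, (hmem z).2 ⟨h1, h2⟩⟩⟩
  have := Finset.card_pos.2 ⟨q, hqX⟩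
  rw [Finset.card_erase_of_mem hqX]
  omega

omit [Finite V] in
lemma exists_not_adj {A : Finset V} (hA : A ∈ indepComplex G) (hAc : d ≤ A.card + 1)
    (hAb : ∀ a ∈ A, ¬ G.Adj b a ∧ ¬ G.Adj y a) (hpq : G.Adj p q) (hyp : ¬ G.Adj y p) (hyq : ¬ G.Adj y q)
    (hbp : G.Adj b p) (hby : G.Adj b y) : ∃ t ∈ A, ¬ G.Adj t q := by
  by_contra hcon
  push Not at hcon
  have := hG.card_add_two_le hA (x := p) (y := y) (fun h => (hAb p h).1 hbp) (fun a ha hpa => by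
      rcases hG.tri y a p q hpa.symm hpq (hcon a ha) with h | h | h
      · exact (hAb a ha).2 h
      · exact hyp h
      · exact hyq h)
    (fun h => (hAb y h).1 hby) (fun a ha => (hAb a ha).2) (by rintro rfl; exact hyq hpq) fun h => hyp h.symm
  omega

lemma false_of_two_triangles {A : Finset V} (hA : A ∈ indepComplex G) (hAc : d ≤ A.card + 1)
    (hAb : ∀ a ∈ A, ¬ G.Adj b a ∧ ¬ G.Adj y a) (hpq : G.Adj p q) (hyp : ¬ G.Adj y p) (hyq : ¬ G.Adj y q)
    (hbp : G.Adj b p) (hbq : G.Adj b q) (hcp : G.Adj c p) (hcq : G.Adj c q) (hby : G.Adj b y) (hbc : b ≠ c)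
    {x : V} (hx : x ∈ A) (hcx : ¬ G.Adj c x) (hxp : ¬ G.Adj x p) : False := by
  obtain ⟨hbx, hyx⟩ := hAb x hx
  have hxq : G.Adj x q := by grind [hG.tri x b p q hbp hpq hbq, G.adj_comm x b]
  obtain ⟨t, ht, htq⟩ := hG.exists_not_adj hA hAc hAb hpq hyp hyq hbp hby
  obtain ⟨hbt, hyt⟩ := hAb t ht
  have htp : G.Adj t p := by grind [hG.tri t b p q hbp hpq hbq, G.adj_comm t b]
  have hxt := hA x hx t ht
  have hbc' : ¬ G.Adj b c := fun h => by grind [hG.tri x b p c hbp hcp.symm h, G.adj_comm x b, G.adj_comm x c]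
  have hct : ¬ G.Adj c t := fun h => by grind [hG.tri x t p c htp hcp.symm h.symm, G.adj_comm x c]
  obtain ⟨r, hcr, hr⟩ := hG.exists_adj_of_lk (F := {b, x, t}) (u := c) (by
      refine indep_insert.2 ⟨indep_insert.2 ⟨by simp [indepComplex], by simpa using hxt⟩, ?_⟩
      simp [hbx, hbt]) ⟨b, by simp⟩ ⟨by grind, by simp [hbc', G.adj_comm x c, G.adj_comm t c, hcx, hct]⟩
  have hbr := hr b (by simp)
  have hxr := hr x (by simp)
  have htr := hr t (by simp)
  rcases hG.tri r b p q hbp hpq hbq with h | h | h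
  · exact hbr h.symm
  · grind [hG.tri x r c p hcr.symm hcp h, G.adj_comm x c]
  · grind [hG.tri t c q r hcq h.symm hcr, G.adj_comm t c]

lemma triangle_unique (H : ∀ b w, G.Adj b w → ∃ y, ¬ G.Adj b y ∧ ¬ G.Adj w y) (hpq : G.Adj p q) (hbp : G.Adj b p)
    (hbq : G.Adj b q) (hcp : G.Adj c p) (hcq : G.Adj c q) : b = c := by
  by_contra hbc
  obtain ⟨y, hpy, hqy⟩ := H p q hpq
  rw [G.adj_comm] at hpy hqy
  have hyb : ∀ b, G.Adj b p → G.Adj b q → G.Adj b y := fun b hbp hbq => by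
    grind [hG.tri y b p q hbp hpq hbq, G.adj_comm y b]
  have hby := hyb b hbp hbq
  have hcy := hyb c hcp hcq
  obtain ⟨A, hA, hAc, hAb⟩ := hG.exists_indep hby (H b y hby)
  obtain ⟨B, hB, hBc, hBb⟩ := hG.exists_indep hcy (H c y hcy)
  obtain ⟨X, hX, hX'⟩ := hG.exists_finset_card_le hpy hqy hpq
  obtain ⟨Z, hZ, hZ'⟩ := hG.exists_finset_card_le hqy hpy hpq.symm
  have hsub : ∀ b, G.Adj b p → G.Adj b q → ∀ a, ¬ G.Adj b a → ¬ G.Adj y a → a ∈ X ∪ Z := by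
    intro b hbp hbq a h1 h2
    rw [Finset.mem_union]
    grind [hG.tri a b p q hbp hpq hbq, G.adj_comm a b, G.adj_comm a p, G.adj_comm a q]
  have h1 : (A ∪ B).card ≤ (X ∪ Z).card := Finset.card_le_card (Finset.union_subset
    (fun a ha => hsub b hbp hbq a (hAb a ha).1 (hAb a ha).2) fun a ha => hsub c hcp hcq a (hBb a ha).1 (hBb a ha).2)
  have h2 := Finset.card_union_le X Z
  have h3 := Finset.card_union_add_card_inter A B
  obtain ⟨x, hx⟩ : (A ∩ B).Nonempty := Finset.card_pos.1 (by omega)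
  rw [Finset.mem_inter] at hx
  by_cases hxp : G.Adj x p
  · refine hG.false_of_two_triangles hA hAc hAb hpq.symm hqy hpy hbq hbp hcq hcp hby hbc hx.1 (hBb x hx.2).1 fun hxq => ?_
    grind [hG.tri y x p q hxp hpq hxq]
  · exact hG.false_of_two_triangles hA hAc hAb hpq hpy hqy hbp hbq hcp hcq hby hbc hx.1 (hBb x hx.2).1 hxp

/-- Some edge lies in no triangle. -/
theorem exists_edge [Nonempty V] : ∃ b p, G.Adj b p ∧ ∀ x, ¬ (G.Adj b x ∧ G.Adj p x) := by
  by_cases hfar : ∃ b w, Far G b w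
  · exact hG.exists_edge_of_far hfar
  have H : ∀ b w, G.Adj b w → ∃ y, ¬ G.Adj b y ∧ ¬ G.Adj w y := by
    intro b w hbw
    by_contra hcon
    exact hfar ⟨b, w, hbw, fun y => by by_contra h; exact hcon ⟨y, not_or.1 h⟩⟩
  by_contra hT
  push Not at hT
  have huniq : ∀ p q b c, G.Adj p q → G.Adj b p → G.Adj b q → G.Adj c p → G.Adj c q → b = c :=
    fun p q b c h1 h2 h3 h4 h5 => hG.triangle_unique H h1 h2 h3 h4 h5
  obtain ⟨b⟩ := ‹Nonempty V›
  obtain ⟨p, hbp⟩ := hG.iso b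
  obtain ⟨q, hbq, hpq⟩ := hT b p hbp
  obtain ⟨M, hM, hMc, hMpq⟩ := hG.exists_indep hpq (H p q hpq)
  have hbM : ∀ y ∈ M, G.Adj b y := fun y hy => by
    have := hMpq y hy
    grind [hG.tri y b p q hbp hpq hbq, G.adj_comm y b, G.adj_comm y p, G.adj_comm y q]
  choose! s hs using fun y hy => hT b y (hbM y hy)
  have hspq : ∀ y ∈ M, ¬ G.Adj p (s y) ∧ ¬ G.Adj q (s y) := by
    intro y hy
    have h1 := hMpq y hy
    have h2 := hs y hy
    constructor
    · intro h
      grind [huniq b p (s y) q, G.adj_comm]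
    · intro h
      grind [huniq b q (s y) p, G.adj_comm]
  have hsM : ∀ y ∈ M, ∀ y' ∈ M, y ≠ y' → ¬ G.Adj (s y) y' := by
    intro y hy y' hy' hne h
    exact hne (huniq b (s y) y y' (hs y hy).1 (hbM y hy).symm (hs y hy).2 (hbM y' hy').symm h.symm)
  have hsne : ∀ y ∈ M, ∀ y' ∈ M, y ≠ y' → s y ≠ s y' := by
    intro y hy y' hy' hne e
    exact hsM y hy y' hy' hne (e ▸ (hs y' hy').2.symm)
  have hss : ∀ y ∈ M, ∀ y' ∈ M, ¬ G.Adj (s y) (s y') := by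
    intro y hy y' hy' h
    by_cases hne : y = y'
    · exact G.irrefl (hne ▸ h)
    · have := huniq b (s y) y (s y') (hs y hy).1 (hbM y hy).symm (hs y hy).2 (hs y' hy').1.symm h.symm
      exact hM y' hy' y hy (this ▸ (hs y' hy').2)
  obtain ⟨t, hbt, hqt⟩ := H b q hbq
  classical
  have hm : ∃ m : V → V, ∀ y ∈ M, ¬ G.Adj t (m y) ∧ (m y = y ∨ m y = s y) := by
    refine ⟨fun y => if G.Adj t y then s y else y, fun y hy => ?_⟩
    by_cases hty : G.Adj t y
    · simp only [hty, if_true, or_true, and_true]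
      intro hts
      exact hqt (huniq y (s y) b t (hs y hy).2 (hbM y hy) (hs y hy).1 hty hts ▸ hbq.symm)
    · simp [hty]
  obtain ⟨m, hm⟩ := hm
  have hmb : ∀ y ∈ M, G.Adj b (m y) ∧ ¬ G.Adj q (m y) := by
    intro y hy
    rcases (hm y hy).2 with e | e <;> rw [e]
    · exact ⟨hbM y hy, (hMpq y hy).2⟩
    · exact ⟨(hs y hy).1, (hspq y hy).2⟩
  have hinj : Set.InjOn m M := by
    intro y hy y' hy' e
    by_contra hne
    rcases (hm y hy).2 with e1 | e1 <;> rcases (hm y' hy').2 with e2 | e2 <;> rw [e1, e2] at e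
    · exact hne e
    · exact hM y hy y' hy' (e ▸ (hs y' hy').2.symm)
    · exact hM y' hy' y hy (e ▸ (hs y hy).2.symm)
    · exact hsne y hy y' hy' hne e
  have hMi : M.image m ∈ indepComplex G := by
    intro u hu u' hu'
    obtain ⟨y, hy, rfl⟩ := Finset.mem_image.1 hu
    obtain ⟨y', hy', rfl⟩ := Finset.mem_image.1 hu'
    by_cases hne : y = y'
    · rw [hne]
      exact G.irrefl
    rcases (hm y hy).2 with e1 | e1 <;> rcases (hm y' hy').2 with e2 | e2 <;> rw [e1, e2]
    · exact hM y hy y' hy'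
    · exact fun h => hsM y' hy' y hy (Ne.symm hne) h.symm
    · exact hsM y hy y' hy' hne
    · exact hss y hy y' hy'
  have hqM : q ∉ M.image m := by
    intro h
    obtain ⟨y, hy, e⟩ := Finset.mem_image.1 h
    rcases (hm y hy).2 with e1 | e1
    · exact (hMpq y hy).1 (e1 ▸ e ▸ hpq)
    · exact (hspq y hy).1 (e1 ▸ e ▸ hpq)
  have := hG.card_add_two_le hMi (x := t) (y := q) (fun h => by
      obtain ⟨y, hy, e⟩ := Finset.mem_image.1 h
      exact hbt (e ▸ (hmb y hy).1))
    (by simpa using fun y hy => (hm y hy).1) hqM (by simpa using fun y hy => (hmb y hy).2)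
    (by rintro rfl; exact hbt hbq) fun h => hqt h.symm
  rw [Finset.card_image_of_injOn hinj] at this
  omega

end GlobalCond
end

section
variable {V : Type} [LinearOrder V] [Fintype V] {G : SimpleGraph V} {k : Type} [Field k]

lemma van_empty_of_edge {d : ℕ} (hL : LinkCond G d) {b p : V} (hbp : G.Adj b p)
    (hT : ∀ x, ¬ (G.Adj b x ∧ G.Adj p x)) (hadj : ∀ x, x ≠ p → ¬ G.Adj x p → ∃ w, G.Adj p w ∧ ¬ G.Adj x w)
    {i : ℕ} (hi : i < d) : Van k (Fam G ∅ ∅) i := by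
  refine (Fam_spl p).van ?_ (hL.van (by simp) hi)
  rw [insert_empty_eq]
  refine (van_chain (T₁ := G.neighborSet b) (Set.singleton_subset_iff.2 hbp) fun T h0 h1 x hxb hxT => ?_).2
    (Fam_cone (v := b) (by simp) (show ¬ G.Adj b b from G.irrefl) fun w hw => Or.inl hw).van i
  have hpT : p ∈ T := h0 rfl
  have hxp : x ≠ p := fun e => hxT (e ▸ hpT)
  have hxp' : ¬ G.Adj x p := fun h => hT x ⟨hxb, h.symm⟩
  obtain ⟨w, hw, hxw⟩ := hadj x hxp hxp'
  exact hL.van_of_mem (v := x) (t := p) (by simp [indepComplex]) (by simp) (by simpa using hxp.symm)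
    (by simpa using hxp') hw hxw hpT fun y hy _ h => hT y ⟨h1 hy, h⟩

/-- If the independence complex satisfies `LinkCond` and is Cohen–Macaulay over some field, then it
is Cohen–Macaulay over every field. -/
theorem graphCM_of_van [Nonempty V] (hiso : noIsolated G) (hL : LinkCond G (indepNumber G))
    (h : ∀ i < indepNumber G, Van k (Fam G ∅ ∅) i) : graphCM G := by
  have hall : ∀ i < indepNumber G, ∀ N, Van k (Fam G N ∅) i := by
    intro i hi N
    rcases N.eq_empty_or_nonempty with rfl | hN
    · exact h i hi
    · exact hL.van hN hi
  rw [graphCM_iff]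
  intro k' _ i hi N
  rcases N.eq_empty_or_nonempty with rfl | hN
  swap
  · exact hL.van hN hi
  rcases i with _ | _ | i
  · exact van_empty_zero
  · refine van_empty_one fun C hC x y hx => ?_
    exact conn_of_van (k := k) (N := ∅) empty_mem_indep (by simpa using h 1 hi) C (fun x y _ _ => hC x y)
      ⟨by simp, by simp⟩ ⟨by simp, by simp⟩ hx
  · have hG : GlobalCond G (indepNumber G) :=
      { hL with
        three_le := by omega
        iso := hiso
        exists_facet := fun N hN => exists_card_eq hall hN
        conn := fun N hN hc C hC x y hx hy hCx =>
          conn_of_van (k := k) hN (hall _ (by omega) N) C hC hx hy hCx }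
    obtain ⟨b, p, hbp, hT⟩ := hG.exists_edge
    exact van_empty_of_edge hL hbp hT (fun x hxp hadj => hG.exists_adj hxp hadj) hi

/-- The four conditions on the square of the edge ideal of a graph without isolated vertices. -/
theorem tfae_of_noIsolated (k : Type) [Field k] (hiso : noIsolated G) :
    List.TFAE [quotBuchsbaum k V (edgeIdeal k G ^ 2), quotKBuchsbaum k V (edgeIdeal k G ^ 2) 1,
      graphCM G ∧ quotGCM k V (edgeIdeal k G ^ 2),
      graphCM G ∧ ∀ v : V, specialCM (vertexLoc G v) ∧ (vertexLoc G v).CliqueFree 3] := by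
  have hd : ∀ F ∈ indepComplex G, F.card ≤ indepNumber G := fun F hF => card_le_indepNumber hF
  rw [quotBuchsbaum_iff, quotKBuchsbaum_iff, quotGCM_iff]
  tfae_have 1 → 2 := fun h i hi x hx y => LocCoh.smul_eq_zero_of_surjective (h i hi) y (by rwa [pow_one])
  tfae_have 2 → 3 := by
    intro h
    have hv : ∀ a : V → ℤ, (∃ j, a j < 0) → ∀ i < indepNumber G, Van k (dlt (A2 G) a) i :=
      fun a ha i hi => van_of_killed (h i hi) ha
    refine ⟨?_, fun i hi => finiteLength_of_van fun a ha => hv a ha i hi⟩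
    rcases isEmpty_or_nonempty V with hV | hV
    · rw [graphCM_iff]
      intro k' _ i hi
      obtain ⟨F, -, hF⟩ := exists_card_eq_indepNumber G
      rw [← hF, Finset.eq_empty_of_isEmpty F, Finset.card_empty] at hi
      omega
    · exact graphCM_of_van hiso ((negCond_of_van hd hv).linkCond hd) fun i hi => van_empty_of_killed (h i hi)
  tfae_have 3 → 4 := fun h => ⟨h.1, special_of_negCond h.1 fun k' _ =>
    ((negCond_of_finiteLength hd h.2).linkCond hd).negCond k'⟩
  tfae_have 4 → 1 := fun h i hi => surjective_of_negCond (negCond_of_special h.1 h.2 k)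
    (fun i hi => graphCM_iff.1 h.1 k i hi ∅) hi
  tfae_finish

end
end Mono

/-- **Theorem 3.15.** For the edge ideal `I(G)` of a graph `G`, the following are
equivalent: (i) `S/I(G)²` is Buchsbaum; (ii) `S/I(G)²` is 1-Buchsbaum;
(iii) `G` is Cohen–Macaulay and `S/I(G)²` is generalized Cohen–Macaulay;
(iv) `G` is Cohen–Macaulay and `G_i` is special Cohen–Macaulay and triangle-free
for all `i`. -/
theorem second_power_buchsbaum_TFAE {n : ℕ} (k : Type) [Field k]
    (G : SimpleGraph (Fin n)) (hiso : noIsolated G) :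
    List.TFAE
      [quotBuchsbaum k (Fin n) ((edgeIdeal k G) ^ 2),
       quotKBuchsbaum k (Fin n) ((edgeIdeal k G) ^ 2) 1,
       graphCM G ∧ quotGCM k (Fin n) ((edgeIdeal k G) ^ 2),
       graphCM G ∧ ∀ i : Fin n,
         specialCM (vertexLoc G i) ∧ (vertexLoc G i).CliqueFree 3] :=
  Mono.tfae_of_noIsolated k hiso
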